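/- If κ is a measurable cardinal, then LD^Ramsey_κ holds: there is a partial function ℓ : κ ⇀ V_κ such that for every set A ∈ H(κ⁺) and every B ⊆ κ there is a nice, iterable, weakly amenable structure ⟨M, F⟩ with ℓ, A, B ∈ M whose ultrapower map j satisfies j(ℓ)(κ) = A. -/

import Mathlib

open FirstOrder

universe u

namespace LaverDiamond

/-- The relation symbols of the language of set theory: a single binary relation `mem`. -/
inductive memRel : ℕ → Type
  | mem : memRel 2

/-- The first-order language of set theory. -/
def SetLang : FirstOrder.Language := ⟨fun _ => Empty, memRel⟩

/-- Any class of ZF-sets is a structure in the language of set theory, with the true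
membership relation. -/
instance classStructure (M : Set ZFSet.{u}) : SetLang.Structure M where
  funMap := fun {_} f _ => f.elim
  RelMap := fun {_} r x => match r with
    | .mem => (x 0 : ZFSet) ∈ (x 1 : ZFSet)

/-- A (fully) elementary embedding from the class `M` to the class `N`, both classes of
ZF-sets equipped with the true membership relation.  It is coded by a global function
`j : ZFSet → ZFSet` mapping `M` into `N`, elementary for all first-order formulas
with parameters from `M`. -/
structure ClassEmb (M N : Set ZFSet.{u}) where
  j : ZFSet.{u} → ZFSet.{u}
  maps : ∀ x, x ∈ M → j x ∈ N
  elem : ∀ {n : ℕ} (φ : SetLang.Formula (Fin n)) (v : Fin n → ZFSet.{u}) (hv : ∀ i, v i ∈ M),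
    φ.Realize (fun i => (⟨v i, hv i⟩ : M)) ↔ φ.Realize (fun i => (⟨j (v i), maps _ (hv i)⟩ : N))

/-- The universe of all ZF-sets, as a class. -/
def V : Set ZFSet.{u} := Set.univ

/-- A transitive class of ZF-sets. -/
def TransClass (M : Set ZFSet.{u}) : Prop := ∀ x ∈ M, ∀ y ∈ x, y ∈ M

/-- `j` has critical point `κ`: `κ` is an ordinal, fixed below `κ`, with `j(κ) > κ`. -/
def CritPt (j : ZFSet.{u} → ZFSet.{u}) (κ : ZFSet.{u}) : Prop :=
  κ.IsOrdinal ∧ κ ∈ j κ ∧ ∀ α : ZFSet, α.IsOrdinal → α ∈ κ → j α = α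

/-- `x` is a member of the rank-initial segment `V_θ`. -/
def MemV (θ x : ZFSet.{u}) : Prop := x.rank < θ.rank

/-- `κ` is a cardinal: an ordinal not equinumerous with any smaller ordinal. -/
def IsCard (κ : ZFSet.{u}) : Prop :=
  κ.IsOrdinal ∧ ∀ β ∈ κ, Cardinal.mk β.toSet < Cardinal.mk κ.toSet

/-- `x ∈ H(θ⁺)`, i.e. `x` has hereditary size at most `θ`. -/
def MemH (θ x : ZFSet.{u}) : Prop :=
  ∃ t : ZFSet, t.IsTransitive ∧ x ∈ t ∧ Cardinal.mk t.toSet ≤ Cardinal.mk θ.toSet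

/-- `f` is a set-function with domain `θ` taking values in the class `M`. -/
def IsFuncInto (θ : ZFSet.{u}) (M : Set ZFSet.{u}) (f : ZFSet.{u}) : Prop :=
  (∀ p ∈ f, ∃ a b : ZFSet, a ∈ θ ∧ b ∈ M ∧ p = ZFSet.pair a b) ∧
  ∀ a ∈ θ, ∃! b : ZFSet, ZFSet.pair a b ∈ f

/-- The class `M` is closed under `θ`-sequences: `M^θ ⊆ M`. -/
def SeqClosed (θ : ZFSet.{u}) (M : Set ZFSet.{u}) : Prop :=
  ∀ f : ZFSet, IsFuncInto θ M f → f ∈ M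

/-- The set `M` is closed under `<κ`-sequences: `M^{<κ} ⊆ M`. -/
def SeqClosedLt (κ M : ZFSet.{u}) : Prop :=
  ∀ α : ZFSet, α ∈ κ → ∀ f : ZFSet, IsFuncInto α M.toSet f → f ∈ M

/-- `ℓ` is a partial function from `κ` to `V_κ` (coded as a set of Kuratowski pairs). -/
def IsPFun (κ ℓ : ZFSet.{u}) : Prop :=
  (∀ p ∈ ℓ, ∃ γ A : ZFSet, γ ∈ κ ∧ MemV κ A ∧ p = ZFSet.pair γ A) ∧
  ∀ γ A B : ZFSet, ZFSet.pair γ A ∈ ℓ → ZFSet.pair γ B ∈ ℓ → A = B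

/-- The set `r` is the restriction to `κ` of the class function `ℓ` (defined on the
ordinals below `κ`), coded as a set of Kuratowski pairs. -/
def RestrictEq (ℓ : ZFSet.{u} → ZFSet.{u}) (κ r : ZFSet.{u}) : Prop :=
  ∀ p : ZFSet, p ∈ r ↔ ∃ γ : ZFSet, γ ∈ κ ∧ p = ZFSet.pair γ (ℓ γ)

/-- The set `r` is the restriction to `κ` of the class function `ℓ` restricted further to
the class `D`. -/
def RestrictEqOn (ℓ : ZFSet.{u} → ZFSet.{u}) (D : Set ZFSet.{u}) (κ r : ZFSet.{u}) : Prop :=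
  ∀ p : ZFSet, p ∈ r ↔ ∃ γ : ZFSet, γ ∈ κ ∧ γ ∈ D ∧ p = ZFSet.pair γ (ℓ γ)

/-- The set `r` is the restriction to `δ` of the set partial function `ℓ`. -/
def RestrictSet (ℓ δ r : ZFSet.{u}) : Prop :=
  ∀ p : ZFSet, p ∈ r ↔ p ∈ ℓ ∧ ∃ γ A : ZFSet, γ ∈ δ ∧ p = ZFSet.pair γ A

/-! ### Supercompactness -/

/-- A `θ`-supercompactness embedding with critical point `κ`: an elementary embedding
`j : V → M` with `M` a transitive class closed under `θ`-sequences and `j(κ) > θ`. -/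
structure SCEmb (κ θ : ZFSet.{u}) where
  M : Set ZFSet.{u}
  trans : TransClass M
  e : ClassEmb V M
  crit : CritPt e.j κ
  closed : SeqClosed θ M
  big : θ ∈ e.j κ

/-- `κ` is `θ`-supercompact. -/
def SCAt (κ θ : ZFSet.{u}) : Prop := Nonempty (SCEmb κ θ)

/-- `κ` is supercompact: `θ`-supercompact for every cardinal `θ`. -/
def Supercompact (κ : ZFSet.{u}) : Prop := ∀ θ : ZFSet, IsCard θ → SCAt κ θ

/-- `ℓ` is a Laver function witnessing the Laver diamond `LD^sc_κ`. -/
def LDscFun (κ ℓ : ZFSet.{u}) : Prop :=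
  IsPFun κ ℓ ∧ ∀ θ A : ZFSet, IsCard θ → MemH θ A →
    ∃ E : SCEmb κ θ, ZFSet.pair κ A ∈ E.e.j ℓ

/-- The Laver diamond principle `LD^sc_κ`. -/
def LDsc (κ : ZFSet.{u}) : Prop := ∃ ℓ : ZFSet, LDscFun κ ℓ

/-- A universal `LD^sc` Laver function. -/
def UnivLDsc (ℓ : ZFSet.{u} → ZFSet.{u}) : Prop :=
  ∀ κ : ZFSet, Supercompact κ → ∃ r : ZFSet, RestrictEq ℓ κ r ∧ LDscFun κ r

/-! ### Strongness -/

/-- A `θ`-strongness embedding with critical point `κ`: an elementary `j : V → M` with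
`M` a transitive class and `V_θ ⊆ M`. -/
structure StrEmb (κ θ : ZFSet.{u}) where
  M : Set ZFSet.{u}
  trans : TransClass M
  e : ClassEmb V M
  crit : CritPt e.j κ
  vsub : ∀ x : ZFSet, MemV θ x → x ∈ M

/-- `κ` is `θ`-strong. -/
def StrongAt (κ θ : ZFSet.{u}) : Prop := Nonempty (StrEmb κ θ)

/-- `κ` is a strong cardinal. -/
def Strong (κ : ZFSet.{u}) : Prop := ∀ θ : ZFSet, θ.IsOrdinal → StrongAt κ θ

/-- `ℓ` witnesses the Laver diamond `LD^strong_κ`. -/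
def LDstrongFun (κ ℓ : ZFSet.{u}) : Prop :=
  IsPFun κ ℓ ∧ ∀ θ A : ZFSet, θ.IsOrdinal → MemV θ A →
    ∃ E : StrEmb κ θ, ZFSet.pair κ A ∈ E.e.j ℓ

/-- The Laver diamond principle `LD^strong_κ`. -/
def LDstrong (κ : ZFSet.{u}) : Prop := ∃ ℓ : ZFSet, LDstrongFun κ ℓ

/-- A universal `LD^strong` Laver function. -/
def UnivLDstrong (ℓ : ZFSet.{u} → ZFSet.{u}) : Prop :=
  ∀ κ : ZFSet, Strong κ → ∃ r : ZFSet, RestrictEq ℓ κ r ∧ LDstrongFun κ r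

/-! ### Measurability -/

/-- An embedding witnessing measurability of `κ`: an elementary `j : V → M`
with `M` a transitive class and critical point `κ`. -/
structure MeasEmb (κ : ZFSet.{u}) where
  M : Set ZFSet.{u}
  trans : TransClass M
  e : ClassEmb V M
  crit : CritPt e.j κ

/-- `κ` is a measurable cardinal. -/
def MeasurableCard (κ : ZFSet.{u}) : Prop := Nonempty (MeasEmb κ)

/-- `ℓ` witnesses the Laver diamond `LD^meas_κ`. -/
def LDmeasFun (κ ℓ : ZFSet.{u}) : Prop :=
  IsPFun κ ℓ ∧ ∀ A : ZFSet, MemH κ A → ∃ E : MeasEmb κ, ZFSet.pair κ A ∈ E.e.j ℓ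

/-- The Laver diamond principle `LD^meas_κ`. -/
def LDmeas (κ : ZFSet.{u}) : Prop := ∃ ℓ : ZFSet, LDmeasFun κ ℓ

/-- A universal `LD^meas` Laver function. -/
def UnivLDmeas (ℓ : ZFSet.{u} → ZFSet.{u}) : Prop :=
  ∀ κ : ZFSet, MeasurableCard κ → ∃ r : ZFSet, RestrictEq ℓ κ r ∧ LDmeasFun κ r

/-! ### Weak compactness -/

/-- `κ` is weakly compact: every transitive set `M` of size `κ` with `κ ∈ M` admits an
elementary embedding `j : M → N` into a transitive set `N` with critical point `κ`. -/
def WeaklyCompact (κ : ZFSet.{u}) : Prop :=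
  ∀ M : ZFSet, M.IsTransitive → Cardinal.mk M.toSet = Cardinal.mk κ.toSet → κ ∈ M →
    ∃ N : ZFSet, N.IsTransitive ∧ ∃ e : ClassEmb M.toSet N.toSet, CritPt e.j κ

/-- `ℓ` witnesses the Laver diamond `LD^wc_κ`. -/
def LDwcFun (κ ℓ : ZFSet.{u}) : Prop :=
  IsPFun κ ℓ ∧ ∀ A M : ZFSet, MemH κ A →
    M.IsTransitive → Cardinal.mk M.toSet = Cardinal.mk κ.toSet → κ ∈ M → A ∈ M → ℓ ∈ M →
    ∃ N : ZFSet, N.IsTransitive ∧ ∃ e : ClassEmb M.toSet N.toSet,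
      CritPt e.j κ ∧ ZFSet.pair κ A ∈ e.j ℓ

/-- The Laver diamond principle `LD^wc_κ`. -/
def LDwc (κ : ZFSet.{u}) : Prop := ∃ ℓ : ZFSet, LDwcFun κ ℓ

/-- A universal `LD^wc` Laver function. -/
def UnivLDwc (ℓ : ZFSet.{u} → ZFSet.{u}) : Prop :=
  ∀ κ : ZFSet, WeaklyCompact κ → ∃ r : ZFSet, RestrictEq ℓ κ r ∧ LDwcFun κ r

/-! ### Nice structures and unfoldability -/

/-- `M` is a nice structure for `κ`: a transitive set of size `κ`, closed under
`<κ`-sequences, with `κ ∈ M`. -/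
def Nice (κ M : ZFSet.{u}) : Prop :=
  M.IsTransitive ∧ Cardinal.mk M.toSet = Cardinal.mk κ.toSet ∧ SeqClosedLt κ M ∧ κ ∈ M

/-- `κ` is unfoldable: for every ordinal `θ`, every nice structure admits a
`θ`-unfoldability embedding. -/
def Unfoldable (κ : ZFSet.{u}) : Prop :=
  ∀ θ M : ZFSet, θ.IsOrdinal → Nice κ M →
    ∃ N : ZFSet, N.IsTransitive ∧ ∃ e : ClassEmb M.toSet N.toSet, CritPt e.j κ ∧ θ ∈ e.j κ

/-- `ℓ` witnesses the Laver diamond `LD^unf_κ`. -/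
def LDunfFun (κ ℓ : ZFSet.{u}) : Prop :=
  IsPFun κ ℓ ∧ ∀ θ A M : ZFSet, θ.IsOrdinal → MemH κ A →
    M.IsTransitive → Cardinal.mk M.toSet = Cardinal.mk κ.toSet → SeqClosedLt κ M →
    κ ∈ M → ℓ ∈ M → A ∈ M →
    ∃ N : ZFSet, N.IsTransitive ∧ ∃ e : ClassEmb M.toSet N.toSet,
      CritPt e.j κ ∧ θ ∈ e.j κ ∧ ZFSet.pair κ A ∈ e.j ℓ

/-- The Laver diamond principle `LD^unf_κ`. -/
def LDunf (κ : ZFSet.{u}) : Prop := ∃ ℓ : ZFSet, LDunfFun κ ℓ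

/-- `ℓ` witnesses the Laver diamond `LD^sunf_κ` for strong unfoldability. -/
def LDsunfFun (κ ℓ : ZFSet.{u}) : Prop :=
  IsPFun κ ℓ ∧ ∀ θ A M : ZFSet, IsCard θ → MemH θ A →
    M.IsTransitive → Cardinal.mk M.toSet = Cardinal.mk κ.toSet → SeqClosedLt κ M →
    κ ∈ M → ℓ ∈ M →
    ∃ N : ZFSet, N.IsTransitive ∧ (∀ x : ZFSet, MemV θ x → x ∈ N) ∧
      ∃ e : ClassEmb M.toSet N.toSet, CritPt e.j κ ∧ θ ∈ e.j κ ∧ ZFSet.pair κ A ∈ e.j ℓ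

/-! ### Ramsey cardinals -/

/-- `F` is a weakly amenable `M`-normal measure on `κ`. -/
def MNormalMeasure (κ M F : ZFSet.{u}) : Prop :=
  (∀ X ∈ F, X ⊆ κ ∧ X ∈ M) ∧ κ ∈ F ∧ (∅ : ZFSet) ∉ F ∧
  (∀ X Y : ZFSet, X ∈ F → Y ∈ F → X ∩ Y ∈ F) ∧
  (∀ X Y : ZFSet, X ∈ F → Y ∈ M → X ⊆ Y → Y ⊆ κ → Y ∈ F) ∧
  (∀ X : ZFSet, X ∈ M → X ⊆ κ → (X ∈ F ∨ κ \ X ∈ F)) ∧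
  (∀ ξ ∈ κ, ({ξ} : ZFSet) ∉ F) ∧
  (∀ γ f : ZFSet, γ ∈ κ → f ∈ M → IsFuncInto γ F.toSet f →
    ZFSet.sep (fun ξ => ∀ a X : ZFSet, ZFSet.pair a X ∈ f → ξ ∈ X) κ ∈ F) ∧
  (∀ f : ZFSet, f ∈ M → IsFuncInto κ F.toSet f →
    ZFSet.sep (fun ξ => ∀ a X : ZFSet, ZFSet.pair a X ∈ f → a ∈ ξ → ξ ∈ X) κ ∈ F) ∧
  (∀ D : ZFSet, D ∈ M → MemH κ D → F ∩ D ∈ M)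

/-- `j` is (isomorphic to) the ultrapower map of `M` by the `M`-measure `F` on `κ`, with
transitive (wellfounded) target `N`: `j` is elementary, has critical point `κ`, derives the
measure `F` at `κ`, and every element of `N` has the form `j(f)(κ)` for some function
`f ∈ M` with domain `κ`. -/
def IsUltrapowerMap (κ M F N : ZFSet.{u}) (j : ZFSet.{u} → ZFSet.{u}) : Prop :=
  N.IsTransitive ∧ (∃ e : ClassEmb M.toSet N.toSet, e.j = j) ∧ CritPt j κ ∧
  (∀ X : ZFSet, X ∈ M → X ⊆ κ → (X ∈ F ↔ κ ∈ j X)) ∧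
  (∀ y ∈ N, ∃ f : ZFSet, f ∈ M ∧ (∀ a ∈ κ, ∃! b : ZFSet, ZFSet.pair a b ∈ f) ∧
    ZFSet.pair κ y ∈ j f)

/-- A wellfounded iteration of `⟨M, F⟩` of length `δ`: a commuting system of elementary
embeddings between transitive models, starting at `⟨M, F⟩`, taking ultrapowers by the
image measures at successor steps and direct limits at limit stages. -/
structure Iteration (κ M F δ : ZFSet.{u}) where
  Mod : ZFSet.{u} → ZFSet.{u}
  Meas : ZFSet.{u} → ZFSet.{u}
  cp : ZFSet.{u} → ZFSet.{u}
  emb : ZFSet.{u} → ZFSet.{u} → ZFSet.{u} → ZFSet.{u}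
  mod_zero : Mod ∅ = M
  meas_zero : Meas ∅ = F
  cp_zero : cp ∅ = κ
  trans' : ∀ i : ZFSet, i ∈ δ → (Mod i).IsTransitive
  elem' : ∀ i k : ZFSet, i ∈ δ → k ∈ δ → i ∈ k →
    ∃ e : ClassEmb (Mod i).toSet (Mod k).toSet, e.j = emb i k
  comm : ∀ i k l : ZFSet, i ∈ δ → k ∈ δ → l ∈ δ → i ∈ k → k ∈ l →
    ∀ x ∈ Mod i, emb k l (emb i k x) = emb i l x
  cp_emb : ∀ i : ZFSet, i ∈ δ → i ≠ ∅ → cp i = emb ∅ i κ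
  succ' : ∀ i : ZFSet, i ∈ δ → insert i i ∈ δ →
    IsUltrapowerMap (cp i) (Mod i) (Meas i) (Mod (insert i i)) (emb i (insert i i)) ∧
    (∀ Y : ZFSet, Y ∈ Meas (insert i i) ↔
      ∃ D : ZFSet, D ∈ Mod i ∧ Y ∈ emb i (insert i i) (Meas i ∩ D))
  limit' : ∀ l : ZFSet, l ∈ δ → l ≠ ∅ → (∀ i ∈ l, insert i i ∈ l) →
    (∀ y ∈ Mod l, ∃ i : ZFSet, i ∈ l ∧ ∃ x, x ∈ Mod i ∧ emb i l x = y) ∧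
    (∀ Y : ZFSet, Y ∈ Meas l ↔
      ∃ i : ZFSet, i ∈ l ∧ ∃ D, D ∈ Mod i ∧ Y ∈ emb i l (Meas i ∩ D))

/-- `⟨M, F⟩` is iterable: all its iterations (of any ordinal length) are wellfounded,
i.e. realized by transitive models. -/
def Iterable (κ M F : ZFSet.{u}) : Prop :=
  ∀ δ : ZFSet, δ.IsOrdinal → Nonempty (Iteration κ M F δ)

/-! ### Constructibility -/

/-- `X` is a subset of `M` definable over `⟨M, ∈⟩` with parameters. -/
def DefinableSubset (M X : ZFSet.{u}) : Prop :=
  X ⊆ M ∧ ∃ (n : ℕ) (φ : SetLang.Formula (Fin (n + 1))) (v : Fin n → ZFSet.{u})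
    (hv : ∀ i, v i ∈ M.toSet),
    ∀ a : ZFSet, a ∈ X ↔ ∃ ha : a ∈ M.toSet,
      φ.Realize (Fin.cons (⟨a, ha⟩ : M.toSet) (fun i => (⟨v i, hv i⟩ : M.toSet)))

/-- The set of all subsets of `M` definable over `⟨M, ∈⟩` with parameters. -/
noncomputable def DefSet (M : ZFSet.{u}) : ZFSet.{u} :=
  ZFSet.sep (fun X => DefinableSubset M X) (ZFSet.powerset M)

/-- `h` codes the constructible hierarchy up to `δ`: a function with domain `δ` such that
`h(β) = ⋃_{γ<β} Def(h(γ))` for every `β < δ`. -/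
def IsLHierarchy (δ h : ZFSet.{u}) : Prop :=
  δ.IsOrdinal ∧
  (∀ p ∈ h, ∃ β y : ZFSet, β ∈ δ ∧ p = ZFSet.pair β y) ∧
  (∀ β ∈ δ, ∃! y : ZFSet, ZFSet.pair β y ∈ h) ∧
  ∀ β y : ZFSet, ZFSet.pair β y ∈ h →
    ∀ z : ZFSet, z ∈ y ↔ ∃ γ x : ZFSet, γ ∈ β ∧ ZFSet.pair γ x ∈ h ∧ z ∈ DefSet x

/-- `x` is constructible: it appears at some level of some constructible hierarchy. -/
def Constructible (x : ZFSet.{u}) : Prop :=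
  ∃ δ h β y : ZFSet, IsLHierarchy δ h ∧ ZFSet.pair β y ∈ h ∧ x ∈ y

/-- The axiom of constructibility `V = L`. -/
def VeqL : Prop := ∀ x : ZFSet.{u}, Constructible x

/-! ### Normal measures -/

/-- `U` is a normal measure on `κ`: a `κ`-complete nonprincipal ultrafilter on `κ`
closed under diagonal intersections. -/
def IsNormalMeasure (κ U : ZFSet.{u}) : Prop :=
  (∀ X ∈ U, X ⊆ κ) ∧ κ ∈ U ∧ (∅ : ZFSet) ∉ U ∧
  (∀ X Y : ZFSet, X ∈ U → Y ∈ U → X ∩ Y ∈ U) ∧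
  (∀ X Y : ZFSet, X ∈ U → X ⊆ Y → Y ⊆ κ → Y ∈ U) ∧
  (∀ X : ZFSet, X ⊆ κ → (X ∈ U ∨ κ \ X ∈ U)) ∧
  (∀ ξ ∈ κ, ({ξ} : ZFSet) ∉ U) ∧
  (∀ γ f : ZFSet, γ ∈ κ → IsFuncInto γ U.toSet f →
    ZFSet.sep (fun ξ => ∀ a X : ZFSet, ZFSet.pair a X ∈ f → ξ ∈ X) κ ∈ U) ∧
  (∀ f : ZFSet, IsFuncInto κ U.toSet f →
    ZFSet.sep (fun ξ => ∀ a X : ZFSet, ZFSet.pair a X ∈ f → a ∈ ξ → ξ ∈ X) κ ∈ U)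

end LaverDiamond

namespace LaverDiamond

/-! ### The normal ultrafilter derived from an embedding -/

open Language in
/-- The atomic formula `t₁ ∈ t₂`. -/
def memFm {α : Type} {n : ℕ} (t₁ t₂ : SetLang.Term (α ⊕ Fin n)) : SetLang.BoundedFormula α n :=
  Relations.boundedFormula₂ (L := SetLang) (memRel.mem : SetLang.Relations 2) t₁ t₂

open Language in
theorem realize_memFm {M : Set ZFSet.{u}} {α : Type} {n : ℕ} (t₁ t₂ : SetLang.Term (α ⊕ Fin n))
    (v : α → M) (xs : Fin n → M) :
    (memFm t₁ t₂).Realize v xs ↔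
      ((t₁.realize (Sum.elim v xs) : M) : ZFSet) ∈ ((t₂.realize (Sum.elim v xs) : M) : ZFSet) := by
  simp only [memFm]
  rfl

/-- The free variable `i` as a term. -/
abbrev fv {α : Type} {n : ℕ} (i : α) : SetLang.Term (α ⊕ Fin n) := Language.Term.var (Sum.inl i)

/-- The bound variable `i` as a term. -/
abbrev bv {α : Type} {n : ℕ} (i : Fin n) : SetLang.Term (α ⊕ Fin n) := Language.Term.var (Sum.inr i)

section Embedding

variable {κ : ZFSet.{u}} (E : MeasEmb κ)

theorem MeasEmb.mem_M (x : ZFSet.{u}) : E.e.j x ∈ E.M := E.e.maps x trivial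

theorem MeasEmb.mem_of_mem {x y : ZFSet.{u}} (h : y ∈ E.e.j x) : y ∈ E.M :=
  E.trans _ (E.mem_M x) _ h

open Language in
theorem MeasEmb.sdiff {a b c : ZFSet.{u}} (h : ∀ z, z ∈ c ↔ z ∈ a ∧ z ∉ b) (z : ZFSet.{u}) :
    z ∈ E.e.j c ↔ z ∈ E.e.j a ∧ z ∉ E.e.j b := by
  have := E.e.elem (n := 3) (BoundedFormula.all ((memFm (bv 0) (fv 2)).iff
    (memFm (bv 0) (fv 0) ⊓ (memFm (bv 0) (fv 1)).not)) : SetLang.BoundedFormula (Fin 3) 0) ![a, b, c]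
    (fun i => trivial)
  simp [Formula.Realize, realize_memFm, Fin.snoc] at this
  have h2 := this.1 (fun a _ => h a)
  by_cases hz : z ∈ E.M
  · exact h2 z hz
  · exact ⟨fun h => (hz (E.mem_of_mem h)).elim, fun h => (hz (E.mem_of_mem h.1)).elim⟩

open Language in
theorem MeasEmb.sep_gt {a b c : ZFSet.{u}} (h : ∀ z, z ∈ c ↔ z ∈ a ∧ b ∈ z) (z : ZFSet.{u}) :
    z ∈ E.e.j c ↔ z ∈ E.e.j a ∧ E.e.j b ∈ z := by
  have := E.e.elem (n := 3) (BoundedFormula.all ((memFm (bv 0) (fv 2)).iff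
    (memFm (bv 0) (fv 0) ⊓ (memFm (fv 1) (bv 0)))) : SetLang.BoundedFormula (Fin 3) 0) ![a, b, c]
    (fun i => trivial)
  simp [Formula.Realize, realize_memFm, Fin.snoc] at this
  have h2 := this.1 (fun a _ => h a)
  by_cases hz : z ∈ E.M
  · exact h2 z hz
  · exact ⟨fun h => (hz (E.mem_of_mem h)).elim, fun h => (hz (E.mem_of_mem h.1)).elim⟩

open Language in
/-- The formula saying that the third bound variable is the unordered pair of the first two. -/
def pairFm {α : Type} : SetLang.BoundedFormula α 3 :=
  BoundedFormula.all ((memFm (bv 3) (bv 2)).iff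
    ((Term.bdEqual (bv 3) (bv 0)) ⊔ (Term.bdEqual (bv 3) (bv 1))))

open Language in
theorem realize_pairFm {M : Set ZFSet.{u}} (hM : TransClass M) {α : Type} (v : α → M)
    (xs : Fin 3 → M) : (pairFm (α := α)).Realize v xs ↔
      ((xs 2 : M) : ZFSet) = {((xs 0 : M) : ZFSet), ((xs 1 : M) : ZFSet)} := by
  simp [pairFm, realize_memFm, Fin.snoc, ZFSet.ext_iff, Subtype.ext_iff]
  constructor
  · intro h z
    constructor
    · intro hz
      exact (h z (hM _ (xs 2).2 _ hz)).1 hz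
    · rintro (hz | hz)
      · obtain rfl := ZFSet.ext hz
        exact (h _ (xs 0).2).2 (Or.inl fun _ => Iff.rfl)
      · obtain rfl := ZFSet.ext hz
        exact (h _ (xs 1).2).2 (Or.inr fun _ => Iff.rfl)
  · intro h z _
    exact h z

open Language in
theorem MeasEmb.regressive {r s : ZFSet.{u}} (h : ∀ z ∈ s, ∃ w ∈ z, ({z, w} : ZFSet) ∈ r) :
    ∀ z ∈ E.e.j s, ∃ w ∈ z, ({z, w} : ZFSet) ∈ E.e.j r := by
  have := E.e.elem (n := 2) (BoundedFormula.all ((memFm (bv 0) (fv 1)).imp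
    (BoundedFormula.ex ((memFm (bv 1) (bv 0)) ⊓ BoundedFormula.ex ((memFm (bv 2) (fv 0)) ⊓ pairFm)))) :
      SetLang.BoundedFormula (Fin 2) 0) ![r, s]
    (fun i => trivial)
  simp [Formula.Realize, realize_memFm, realize_pairFm E.trans,
    realize_pairFm (M := V) (fun _ _ _ _ => trivial), Fin.snoc] at this
  have h2 := this.1 (by
    intro z _ hz
    obtain ⟨w, hw, hw'⟩ := h z hz
    exact ⟨w, hw, hw', trivial, trivial⟩)
  intro z hz
  obtain ⟨w, hw, h, -⟩ := h2 z (E.mem_of_mem hz) hz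
  exact ⟨w, hw, h⟩

open Language in
theorem MeasEmb.fiber {a r c s : ZFSet.{u}}
    (h : ∀ z, z ∈ s ↔ z ∈ a ∧ c ∈ z ∧ ({z, c} : ZFSet) ∈ r) {z : ZFSet.{u}}
    (hz : z ∈ E.e.j a) (hc : E.e.j c ∈ z) (hr : ({z, E.e.j c} : ZFSet) ∈ E.e.j r) : z ∈ E.e.j s := by
  have := E.e.elem (n := 4) (BoundedFormula.all ((memFm (bv 0) (fv 3)).iff
    ((memFm (bv 0) (fv 0)) ⊓ ((memFm (fv 2) (bv 0)) ⊓ BoundedFormula.ex ((Term.bdEqual (bv 1) (fv 2)) ⊓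
      BoundedFormula.ex ((memFm (bv 2) (fv 1)) ⊓ pairFm))))) :
      SetLang.BoundedFormula (Fin 4) 0) ![a, r, c, s]
    (fun i => trivial)
  simp [Formula.Realize, realize_memFm, realize_pairFm E.trans,
    realize_pairFm (M := V) (fun _ _ _ _ => trivial), Fin.snoc] at this
  exact (this.1 (fun z _ => (h z).trans ⟨fun h => ⟨h.1, h.2.1, h.2.2, trivial⟩,
    fun h => ⟨h.1, h.2.1, h.2.2.1⟩⟩) z (E.mem_of_mem hz)).2 ⟨hz, hc, hr, E.mem_of_mem hr⟩

/-- The part of `κ` whose ranks lie in `S`. -/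
noncomputable def rankPart (κ : ZFSet.{u}) (S : Set Ordinal.{u}) : ZFSet.{u} :=
  ZFSet.sep (fun γ => γ.rank ∈ S) κ

theorem mem_rankPart {S : Set Ordinal.{u}} {γ : ZFSet.{u}} :
    γ ∈ rankPart κ S ↔ γ ∈ κ ∧ γ.rank ∈ S := ZFSet.mem_sep

theorem MeasEmb.j_rankPart_sdiff (S T : Set Ordinal.{u}) (z : ZFSet.{u}) :
    z ∈ E.e.j (rankPart κ (S \ T)) ↔ z ∈ E.e.j (rankPart κ S) ∧ z ∉ E.e.j (rankPart κ T) := by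
  apply E.sdiff
  intro z
  simp only [mem_rankPart, Set.mem_sdiff]
  tauto

theorem rankPart_univ : rankPart κ Set.univ = κ := by
  ext z; simp [mem_rankPart]

theorem MeasEmb.mem_j_compl (S : Set Ordinal.{u}) :
    κ ∈ E.e.j (rankPart κ Sᶜ) ↔ κ ∉ E.e.j (rankPart κ S) := by
  rw [Set.compl_eq_univ_sdiff, E.j_rankPart_sdiff, rankPart_univ]
  exact and_iff_right E.crit.2.1

theorem MeasEmb.mem_j_inter (S T : Set Ordinal.{u}) :
    κ ∈ E.e.j (rankPart κ (S ∩ T)) ↔ κ ∈ E.e.j (rankPart κ S) ∧ κ ∈ E.e.j (rankPart κ T) := by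
  rw [← Set.sdiff_compl, E.j_rankPart_sdiff, E.mem_j_compl, not_not]

/-- The ultrafilter on the ordinals derived from `E`. -/
def MeasEmb.ultra : Ultrafilter Ordinal.{u} :=
  Ultrafilter.ofComplNotMemIff
    { sets := {S | κ ∈ E.e.j (rankPart κ S)}
      univ_sets := by
        rw [Set.mem_ofPred_eq, rankPart_univ]
        exact E.crit.2.1
      sets_of_superset := by
        intro S T hS hST
        rw [← Set.inter_eq_left.2 hST] at hS
        exact ((E.mem_j_inter S T).1 hS).2
      inter_sets := fun hS hT => (E.mem_j_inter _ _).2 ⟨hS, hT⟩ }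
    (fun S => by
      change κ ∉ E.e.j (rankPart κ Sᶜ) ↔ κ ∈ E.e.j (rankPart κ S)
      rw [E.mem_j_compl, not_not])

theorem MeasEmb.mem_ultra {S : Set Ordinal.{u}} :
    S ∈ E.ultra ↔ κ ∈ E.e.j (rankPart κ S) := Iff.rfl

end Embedding

/-- The image of a set under an arbitrary function. -/
noncomputable def img (f : ZFSet.{u} → ZFSet.{u}) (x : ZFSet.{u}) : ZFSet.{u} :=
  ZFSet.range (fun y : {y // y ∈ x} => f y)

theorem mem_img {f : ZFSet.{u} → ZFSet.{u}} {x z : ZFSet.{u}} :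
    z ∈ img f x ↔ ∃ y ∈ x, f y = z := by
  simp [img]

theorem pair_eq_of_lt {a b c d : ZFSet.{u}} (hb : b ∈ a) (hd : d ∈ c)
    (h : ({a, b} : ZFSet) = {c, d}) : a = c ∧ b = d := by
  have h1 : a ∈ ({c, d} : ZFSet) := h ▸ by simp
  have h2 : b ∈ ({c, d} : ZFSet) := h ▸ by simp
  have h3 : d ∈ ({a, b} : ZFSet) := h ▸ by simp
  simp only [ZFSet.mem_pair] at h1 h2 h3
  rcases h1 with rfl | rfl
  · rcases h2 with rfl | rfl
    · exact (ZFSet.mem_irrefl _ hb).elim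
    · exact ⟨rfl, rfl⟩
  · rcases h2 with rfl | rfl
    · exact (ZFSet.mem_asymm hb hd).elim
    · exact (ZFSet.mem_irrefl _ hb).elim

/-- A normal, fine ultrafilter on the ordinals concentrating on the ordinals below `κ`. -/
structure NormalUltra (κ : Ordinal.{u}) (U : Ultrafilter Ordinal.{u}) : Prop where
  lt : ∀ᶠ γ in U, γ < κ
  gt : ∀ η < κ, ∀ᶠ γ in U, η < γ
  press : ∀ f : Ordinal.{u} → Ordinal.{u}, (∀ᶠ γ in U, f γ < γ) → ∃ η < κ, ∀ᶠ γ in U, f γ = η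

theorem rank_mem_of_mem {κ γ : ZFSet.{u}} (hκ : κ.IsOrdinal) (h : γ ∈ κ) :
    γ.IsOrdinal ∧ γ.rank.toZFSet = γ :=
  ⟨hκ.mem h, (hκ.mem h).toZFSet_rank_eq⟩

theorem MeasEmb.normal {κ : ZFSet.{u}} (E : MeasEmb κ) : NormalUltra κ.rank E.ultra where
  lt := by
    change _ ∈ E.ultra
    rw [E.mem_ultra]
    convert E.crit.2.1 using 2
    ext z
    rw [mem_rankPart]
    exact ⟨fun h => h.1, fun h => ⟨h, ZFSet.rank_lt_of_mem h⟩⟩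
  gt := by
    intro η hη
    have hk := E.crit.1
    have h1 : η.toZFSet ∈ κ := by
      rwa [← hk.toZFSet_rank_eq, Ordinal.toZFSet_mem_toZFSet_iff]
    change _ ∈ E.ultra
    rw [E.mem_ultra, E.sep_gt (a := κ) (b := η.toZFSet)]
    · exact ⟨E.crit.2.1, by rwa [E.crit.2.2 _ (ZFSet.isOrdinal_toZFSet η) h1]⟩
    · intro z
      rw [mem_rankPart]
      refine and_congr_right fun hz => ?_
      obtain ⟨h2, h3⟩ := rank_mem_of_mem hk hz
      rw [Set.mem_ofPred_eq, ← Ordinal.toZFSet_mem_toZFSet_iff, h3]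
  press := by
    intro f hf
    have hk := E.crit.1
    set s := rankPart κ {γ | f γ < γ} with hs
    let g : ZFSet → ZFSet := fun γ => {γ, (f γ.rank).toZFSet}
    have hs' : ∀ z ∈ s, (f z.rank).toZFSet ∈ z := by
      intro z hz
      obtain ⟨hz1, hz2⟩ := mem_rankPart.1 hz
      rw [← (rank_mem_of_mem hk hz1).2, Ordinal.toZFSet_mem_toZFSet_iff, Ordinal.rank_toZFSet]
      exact hz2
    obtain ⟨w, hw, hr⟩ := E.regressive (r := img g s) (s := s)
      (fun z hz => ⟨(f z.rank).toZFSet, hs' z hz, mem_img.2 ⟨z, hz, rfl⟩⟩) κ (E.mem_ultra.1 hf)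
    obtain ⟨hw1, hw2⟩ := rank_mem_of_mem hk hw
    refine ⟨w.rank, ZFSet.rank_lt_of_mem hw, ?_⟩
    have hjw : E.e.j w = w := E.crit.2.2 _ hw1 hw
    have key := E.fiber (a := κ) (r := img g s) (c := w)
      (s := ZFSet.sep (fun z => w ∈ z ∧ ({z, w} : ZFSet) ∈ img g s) κ) (z := κ)
      (fun z => ZFSet.mem_sep) E.crit.2.1 (by rwa [hjw]) (by rwa [hjw])
    change _ ∈ E.ultra
    rw [E.mem_ultra]
    refine ((E.mem_j_inter _ {γ | w ∈ γ.toZFSet ∧ {γ.toZFSet, w} ∈ img g s}).1 ?_).1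
    convert key using 2
    ext z
    rw [mem_rankPart, ZFSet.mem_sep]
    refine and_congr_right fun hz => ?_
    simp only [Set.mem_inter_iff, Set.mem_ofPred_eq, (rank_mem_of_mem hk hz).2]
    refine and_iff_right_of_imp ?_
    rintro ⟨h1, h2⟩
    obtain ⟨y, hy, h3⟩ := mem_img.1 h2
    obtain ⟨rfl, h4⟩ := pair_eq_of_lt (hs' y hy) h1 h3
    rw [← h4, Ordinal.rank_toZFSet]

namespace NormalUltra

variable {κ : Ordinal.{u}} {U : Ultrafilter Ordinal.{u}} (hU : NormalUltra κ U)
include hU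

theorem gt_const {ξ : Ordinal.{u}} {f : Ordinal.{u} → Ordinal.{u}} (hξ : ξ < κ)
    (h : ∀ᶠ γ in U, f γ ≤ ξ) : ∃ η < κ, ∀ᶠ γ in U, f γ = η :=
  hU.press f (by filter_upwards [h, hU.gt ξ hξ] with γ h1 h2 using h1.trans_lt h2)

theorem complete {α : Ordinal.{u}} (hα : α < κ) {P : Ordinal.{u} → Ordinal.{u} → Prop}
    (h : ∀ i < α, ∀ᶠ γ in U, P i γ) : ∀ᶠ γ in U, ∀ i < α, P i γ := by
  by_contra hn
  rw [← Ultrafilter.eventually_not] at hn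
  push Not at hn
  have hn' : ∀ᶠ γ in U, ∃ i, i < α ∧ ¬ P i γ := hn
  obtain ⟨f, hf⟩ : ∃ f : Ordinal.{u} → Ordinal.{u}, ∀ᶠ γ in U, f γ < α ∧ ¬ P (f γ) γ := by
    classical
    refine ⟨fun γ => if h : ∃ i, i < α ∧ ¬ P i γ then h.choose else 0, ?_⟩
    filter_upwards [hn'] with γ hγ
    rw [dif_pos hγ]
    exact hγ.choose_spec
  obtain ⟨η, hη, hη'⟩ := hU.gt_const (f := f) hα (hf.mono fun _ h => h.1.le)
  obtain ⟨γ, h1, h2⟩ := (hη'.and hf).exists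
  rw [h1] at h2
  have : ∀ᶠ γ in (U : Filter Ordinal.{u}), False := by
    filter_upwards [hη', hf, h η h2.1] with γ h3 h4 h5
    rw [h3] at h4
    exact h4.2 h5
  obtain ⟨_, h6⟩ := this.exists
  exact h6

theorem pos : 0 < κ := by
  obtain ⟨γ, h⟩ := hU.lt.exists
  exact (zero_le (a := γ)).trans_lt h

theorem succ_lt {η : Ordinal.{u}} (h : η < κ) : η + 1 < κ := by
  obtain ⟨γ, h1, h2⟩ := (hU.lt.and (hU.gt η h)).exists
  exact (Order.succ_le_of_lt h2).trans_lt h1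

theorem nat_lt (n : ℕ) : (n : Ordinal.{u}) < κ := by
  induction n with
  | zero => simpa using hU.pos
  | succ n ih => exact_mod_cast hU.succ_lt ih

theorem omega_lt : Ordinal.omega0 < κ := by
  by_contra h
  have h1 : κ ≤ Ordinal.omega0 := not_lt.1 h
  have h2 : ∀ᶠ γ in U, Ordinal.pred γ < γ := by
    filter_upwards [hU.lt, hU.gt 0 hU.pos] with γ h3 h4
    obtain ⟨n, rfl⟩ := Ordinal.lt_omega0.1 (h3.trans_le h1)
    obtain _ | n := n
    · simp at h4
    · rw [Nat.cast_succ, Ordinal.pred_add_one]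
      exact Order.lt_succ _
  obtain ⟨η, hη, h3⟩ := hU.press _ h2
  obtain ⟨n, rfl⟩ := Ordinal.lt_omega0.1 (hη.trans_le h1)
  have h4 := hU.gt _ (hU.nat_lt (n + 1))
  obtain ⟨γ, h5, h6, h7⟩ := (h3.and (h4.and hU.lt)).exists
  obtain ⟨m, rfl⟩ := Ordinal.lt_omega0.1 (h7.trans_le h1)
  obtain _ | m := m
  · simp at h6
  · rw [Nat.cast_succ, Ordinal.pred_add_one] at h5
    norm_cast at h5 h6
    omega

theorem countable {ι : Type*} [Countable ι] {P : ι → Ordinal.{u} → Prop}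
    (h : ∀ i, ∀ᶠ γ in U, P i γ) : ∀ᶠ γ in U, ∀ i, P i γ := by
  obtain ⟨f, hf⟩ := exists_injective_nat ι
  have := hU.complete hU.omega_lt (P := fun a γ => ∀ i, (f i : Ordinal) = a → P i γ) (by
    intro a ha
    obtain ⟨n, rfl⟩ := Ordinal.lt_omega0.1 ha
    by_cases hn : ∃ i, f i = n
    · obtain ⟨i, rfl⟩ := hn
      filter_upwards [h i] with γ hγ j hj
      obtain rfl : j = i := hf (by exact_mod_cast hj)
      exact hγ
    · filter_upwards with γ j hj
      exact (hn ⟨j, by exact_mod_cast hj⟩).elim)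
  filter_upwards [this] with γ hγ i
  exact hγ _ (Ordinal.natCast_lt_omega0 _) i rfl

theorem sup_lt {α : Ordinal.{u}} (hα : α < κ) {f : Ordinal.{u} → Ordinal.{u}}
    (h : ∀ i < α, f i < κ) : ∃ β < κ, ∀ i < α, f i < β := by
  obtain ⟨γ, h1, h2⟩ := ((hU.complete hα (P := fun i γ => f i < γ)
    (fun i hi => hU.gt _ (h i hi))).and hU.lt).exists
  exact ⟨γ, h2, h1⟩

theorem seq_const {α : Ordinal.{u}} (hα : α < κ) {f : Ordinal.{u} → Ordinal.{u} → Ordinal.{u}}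
    (h : ∀ i < α, ∀ᶠ γ in U, f γ i < γ) :
    ∃ s : Ordinal.{u} → Ordinal.{u}, (∀ i < α, s i < κ) ∧ (∀ i, α ≤ i → s i = 0) ∧
      ∀ᶠ γ in U, ∀ i < α, f γ i = s i := by
  classical
  choose s hs1 hs2 using fun i => fun hi : i < α => hU.press (fun γ => f γ i) (h i hi)
  refine ⟨fun i => if hi : i < α then s i hi else 0, ?_, ?_, ?_⟩
  · intro i hi
    simpa [hi] using hs1 i hi
  · intro i hi
    simp [not_lt.2 hi]
  · refine hU.complete hα (P := fun i γ => f γ i = _) fun i hi => ?_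
    simpa [hi] using hs2 i hi

theorem mk_fun_lt {α β : Ordinal.{u}} (hα : α < κ) (hβ : β < κ) :
    Cardinal.mk (Set.Iio α → Set.Iio β) < Cardinal.mk (Set.Iio κ) := by
  by_contra h
  obtain ⟨g⟩ := Cardinal.le_def _ _ |>.1 (not_lt.1 h)
  classical
  obtain ⟨s, -, -, hs⟩ := hU.seq_const hα (f := fun γ i =>
    if h : γ < κ ∧ i < α then g ⟨γ, h.1⟩ ⟨i, h.2⟩ else 0) (by
      intro i hi
      filter_upwards [hU.lt, hU.gt β hβ] with γ h1 h2
      rw [dif_pos ⟨h1, hi⟩]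
      exact lt_trans (g ⟨γ, h1⟩ ⟨i, hi⟩).2 h2)
  obtain ⟨γ, h1, h2⟩ := (hs.and hU.lt).exists
  obtain ⟨γ', h1', h2', h3⟩ := (hs.and (hU.lt.and (hU.gt γ h2))).exists
  have : g ⟨γ, h2⟩ = g ⟨γ', h2'⟩ := by
    ext i
    have := (h1 i i.2).trans (h1' i i.2).symm
    rwa [dif_pos ⟨h2, i.2⟩, dif_pos ⟨h2', i.2⟩] at this
  have := g.injective this
  exact h3.ne (congrArg Subtype.val this)

theorem aleph0_le : Cardinal.aleph0 ≤ Cardinal.mk (Set.Iio κ) := by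
  rw [Cardinal.aleph0_le_mk_iff]
  exact Infinite.of_injective (fun n : ℕ => (⟨n, hU.nat_lt n⟩ : Set.Iio κ))
    fun a b h => by simpa using congrArg Subtype.val h

theorem mk_seq_le : Cardinal.mk (Σ α : Set.Iio κ, (Set.Iio α.1 → Set.Iio κ)) ≤
    Cardinal.mk (Set.Iio κ) := by
  have h1 : Cardinal.mk (Σ α : Set.Iio κ, (Set.Iio α.1 → Set.Iio κ)) ≤
      Cardinal.mk (Σ α : Set.Iio κ, Σ β : Set.Iio κ, (Set.Iio α.1 → Set.Iio β.1)) := by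
    refine Cardinal.mk_le_of_surjective
      (f := fun x => ⟨x.1, fun i => ⟨x.2.2 i, Set.mem_Iio.2 (lt_trans (Set.mem_Iio.1 (x.2.2 i).2) (Set.mem_Iio.1 x.2.1.2))⟩⟩) ?_
    rintro ⟨α, s⟩
    classical
    obtain ⟨β, hβ, h⟩ := hU.sup_lt α.2 (f := fun i => if h : i < α then s ⟨i, h⟩ else 0)
      (fun i hi => by rw [dif_pos (show i < α.1 from hi)]; exact (s ⟨i, hi⟩).2)
    refine ⟨⟨α, ⟨β, hβ⟩, fun i => ⟨s i, ?_⟩⟩, rfl⟩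
    have h3 := h i.1 i.2
    rwa [dif_pos (show i.1 < α.1 from i.2)] at h3
  refine h1.trans ?_
  rw [Cardinal.mk_sigma]
  have hle : ∀ α : Set.Iio κ, Cardinal.mk (Σ β : Set.Iio κ, (Set.Iio α.1 → Set.Iio β.1)) ≤
      Cardinal.mk (Set.Iio κ) := by
    intro α
    rw [Cardinal.mk_sigma]
    refine (Cardinal.sum_le_sum _ (fun _ => Cardinal.mk (Set.Iio κ))
      fun β => (hU.mk_fun_lt α.2 β.2).le).trans ?_
    rw [Cardinal.sum_const', Cardinal.mul_eq_self hU.aleph0_le]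
  refine (Cardinal.sum_le_sum _ (fun _ => Cardinal.mk (Set.Iio κ)) hle).trans ?_
  rw [Cardinal.sum_const', Cardinal.mul_eq_self hU.aleph0_le]

end NormalUltra

/-! ### The reflected axioms -/

/-- Formulas of set theory with an additional unary predicate, in de Bruijn notation. -/
inductive Fm
  | fls
  | eq (i j : ℕ)
  | mem (i j : ℕ)
  | meas (i : ℕ)
  | imp (φ ψ : Fm)
  | all (φ : Fm)
  deriving Countable

/-- A binary relation on optional values, false on undefined ones. -/
def OptRel {X : Type*} (R : X → X → Prop) : Option X → Option X → Prop
  | some a, some b => R a b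
  | _, _ => False

/-- Satisfaction in the structure with universe `D`, membership `E` and predicate `F`. -/
def Sat {X : Type*} (D : X → Prop) (E : X → X → Prop) (F : X → Prop) : Fm → List X → Prop
  | .fls, _ => False
  | .eq i j, l => OptRel (· = ·) l[i]? l[j]?
  | .mem i j, l => OptRel E l[i]? l[j]?
  | .meas i, l => OptRel (fun a _ => F a) l[i]? l[i]?
  | .imp φ ψ, l => Sat D E F φ l → Sat D E F ψ l
  | .all φ, l => ∀ y, D y → Sat D E F φ (y :: l)

/-- Names for the operations of the coded structures. -/
inductive Op
  | cst (n : ℕ)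
  | pr
  | ev
  | cnst
  | quant
  | press
  | graph
  | cov
  | amen
  | chi (φ : Fm) (n : ℕ)
  | sk (φ : Fm) (n : ℕ)
  | sharp (i : Op)
  deriving Countable

/-- A set-theoretic structure coded by ordinals. -/
structure Str where
  E : Ordinal.{u} → Ordinal.{u} → Prop
  F : Ordinal.{u} → Prop
  o : Ordinal.{u} → Ordinal.{u}
  B : Op → Ordinal.{u} → Ordinal.{u} → Ordinal.{u}

namespace Str

/-- The value of the coded function `t` at the coded ordinal `ξ`. -/
abbrev ap (G : Str.{u}) (t ξ : Ordinal.{u}) : Ordinal.{u} := G.B .ev t (G.o ξ)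

/-- The named constants. -/
abbrev c (G : Str.{u}) (n : ℕ) : Ordinal.{u} := G.B (.cst n) 0 0

/-- Codes of lists. -/
def code (G : Str.{u}) : List Ordinal.{u} → Ordinal.{u}
  | [] => G.c 2
  | y :: l => G.B .pr y (G.code l)

/-- The predicate `P` holds on a set in the coded measure. -/
def AE (γ : Ordinal.{u}) (G : Str.{u}) (P : Ordinal.{u} → Prop) : Prop :=
  ∃ d, d < γ ∧ G.F d ∧ ∀ ξ, ξ < γ → G.E (G.o ξ) d → P ξ

/-- The structure is closed under its operations below `γ`. -/
def Closed (γ : Ordinal.{u}) (G : Str.{u}) : Prop :=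
  (∀ ξ, ξ < γ → G.o ξ < γ) ∧ ∀ i, ∀ a, a < γ → ∀ b, b < γ → G.B i a b < γ

end Str

/-- There is no descending `ω`-sequence of ordinals below `γ` with respect to `R`. -/
def NoDesc (γ : Ordinal.{u}) (R : Ordinal.{u} → Ordinal.{u} → Prop) : Prop :=
  ∀ s : ℕ → Ordinal.{u}, (∀ n, s n < γ) → ¬ ∀ n, R (s (n + 1)) (s n)

/-- The axioms on sets. -/
def AxSet (γ : Ordinal.{u}) (G : Str.{u}) : Prop :=
  (∀ a, a < γ → ∀ b, b < γ → (∀ z, z < γ → (G.E z a ↔ G.E z b)) → a = b) ∧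
  (∀ (α : Ordinal.{u}) (s : Ordinal.{u} → Ordinal.{u}), (α < γ ∧ (∀ i, s i < γ) ∧ ∀ i, α ≤ i → s i = 0) →
    ∃ a, a < γ ∧ ∀ z, z < γ → (G.E z a ↔ ∃ i, i < γ ∧ i < α ∧ z = s i)) ∧
  NoDesc γ G.E ∧
  (∀ ξ, ξ < γ → ∀ z, z < γ → (G.E z (G.o ξ) ↔ ∃ η, η < γ ∧ η < ξ ∧ z = G.o η)) ∧
  (∀ z, z < γ → (G.E z (G.c 0) ↔ ∃ η, η < γ ∧ z = G.o η)) ∧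
  (∀ a, a < γ → ∀ b, b < γ → ∀ z, z < γ → (G.E z (G.B .pr a b) ↔
    (∀ w, w < γ → (G.E w z ↔ w = a)) ∨ ∀ w, w < γ → (G.E w z ↔ w = a ∨ w = b))) ∧
  (∀ f, f < γ → ∀ ξ, ξ < γ → ∀ y, y < γ → G.E (G.B .pr (G.o ξ) y) f →
    (∀ y', y' < γ → G.E (G.B .pr (G.o ξ) y') f → y' = y) → G.ap f ξ = y) ∧
  (∀ t, t < γ → ∀ z, z < γ → (G.E z (G.B .graph t t) ↔
    ∃ ξ, ξ < γ ∧ z = G.B .pr (G.o ξ) (G.ap t ξ)))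

/-- The axioms on the measure. -/
def AxMeas (γ : Ordinal.{u}) (G : Str.{u}) : Prop :=
  (∀ a, a < γ → G.F a → ∀ z, z < γ → G.E z a → G.E z (G.c 0)) ∧
  G.F (G.c 0) ∧
  (∀ a, a < γ → ∀ b, b < γ → G.F a → (∀ z, z < γ → G.E z a → G.E z b) →
    (∀ z, z < γ → G.E z b → G.E z (G.c 0)) → G.F b) ∧
  (∀ (α : Ordinal.{u}) (s : Ordinal.{u} → Ordinal.{u}), (α < γ ∧ (∀ i, s i < γ) ∧ ∀ i, α ≤ i → s i = 0) →
    (∀ i, i < γ → i < α → G.F (s i)) → ∃ d, d < γ ∧ G.F d ∧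
      ∀ ξ, ξ < γ → (G.E (G.o ξ) d ↔ ∀ i, i < γ → i < α → G.E (G.o ξ) (s i))) ∧
  (∀ a, a < γ → (∀ z, z < γ → G.E z a → G.E z (G.c 0)) → G.F a ∨
    ∃ d, d < γ ∧ G.F d ∧ ∀ ξ, ξ < γ → (G.E (G.o ξ) d ↔ ¬ G.E (G.o ξ) a)) ∧
  (∀ η, η < γ → G.AE γ fun ξ => η < ξ) ∧
  (∀ a, a < γ → G.F a → ∃ ξ, ξ < γ ∧ G.E (G.o ξ) a) ∧
  (∀ t, t < γ → (∀ ξ, ξ < γ → G.F (G.ap t ξ)) → ∃ d, d < γ ∧ G.F d ∧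
    ∀ ξ, ξ < γ → (G.E (G.o ξ) d ↔ ∀ η, η < γ → η < ξ → G.E (G.o ξ) (G.ap t η))) ∧
  (∀ t, t < γ → (G.AE γ fun ξ => G.ap t ξ = G.c 2) ∨ G.AE γ fun ξ => G.ap t ξ ≠ G.c 2) ∧
  (∀ t, t < γ → ∀ s, s < γ →
    (G.AE γ fun ξ => ∃ ζ, ζ < γ ∧ ζ < ξ ∧ G.ap t ξ = G.ap (G.ap s ξ) ζ) →
    ∃ ζ, ζ < γ ∧ G.B .press t s = G.o ζ ∧ G.AE γ fun ξ => G.ap t ξ = G.ap (G.ap s ξ) ζ)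

/-- The axioms on the operations. -/
def AxOp (γ : Ordinal.{u}) (G : Str.{u}) : Prop :=
  (∀ i, ∀ t, t < γ → ∀ s, s < γ → ∀ ξ, ξ < γ →
    G.ap (G.B (.sharp i) t s) ξ = G.B i (G.ap t ξ) (G.ap s ξ)) ∧
  (∀ a, a < γ → ∀ b, b < γ → ∀ ξ, ξ < γ → G.ap (G.B .cnst a b) ξ = a) ∧
  (∀ ξ, ξ < γ → G.ap (G.c 1) ξ = G.o ξ) ∧
  (∀ t, t < γ → ∀ s, s < γ →
    (G.B .quant t s = G.c 2 ↔ G.AE γ fun ξ => G.ap t ξ = G.c 2)) ∧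
  (∀ t, t < γ → ∀ s, s < γ → ∀ ξ, ξ < γ → G.E (G.ap t ξ) (G.B .cov t s)) ∧
  (∀ a, a < γ → ∀ b, b < γ → ∀ z, z < γ → (G.E z (G.B .amen a b) ↔ G.E z a ∧ G.F z)) ∧
  (∀ φ, ∀ l : List Ordinal.{u}, (∀ x ∈ l, x < γ) → ∀ w, w < γ →
    (G.B (.chi φ l.length) (G.code l) w = G.c 2 ↔ Sat (· < γ) G.E G.F φ l)) ∧
  (∀ φ, ∀ l : List Ordinal.{u}, (∀ x ∈ l, x < γ) → ∀ w, w < γ →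
    ∀ y, y < γ → ¬ Sat (· < γ) G.E G.F φ (y :: l) →
      ¬ Sat (· < γ) G.E G.F φ (G.B (.sk φ l.length) (G.code l) w :: l))

/-- The axioms on the coded Laver function `L` and the parameters `c` and `b`. -/
def AxData (γ : Ordinal.{u}) (G : Str.{u}) (L : Ordinal.{u} → Ordinal.{u} → Ordinal.{u} → Prop)
    (c : Ordinal.{u} → Ordinal.{u} → Prop) (b : Ordinal.{u} → Prop) : Prop :=
  (∀ z, z < γ → (G.E z (G.c 3) ↔ ∃ ξ, ξ < γ ∧ b ξ ∧ z = G.o ξ)) ∧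
  (NoDesc γ c → ∀ η, η < γ → ∀ z, z < γ →
    (G.E z (G.ap (G.c 4) η) ↔ ∃ ζ, ζ < γ ∧ c ζ η ∧ z = G.ap (G.c 4) ζ)) ∧
  (∀ ξ, ξ < γ → NoDesc ξ (L ξ) → ∀ η, η < γ → η < ξ → ∀ z, z < γ →
    (G.E z (G.ap (G.ap (G.c 5) ξ) η) ↔
      ∃ ζ, ζ < γ ∧ ζ < ξ ∧ L ξ ζ η ∧ z = G.ap (G.ap (G.c 5) ξ) ζ)) ∧
  (∀ z, z < γ → (G.E z (G.c 6) ↔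
    ∃ ξ, ξ < γ ∧ 0 < ξ ∧ NoDesc ξ (L ξ) ∧ z = G.B .pr (G.o ξ) (G.ap (G.ap (G.c 5) ξ) 0))) ∧
  G.AE γ fun ξ => ∀ ζ, ζ < γ → ∀ η, η < γ → ζ < ξ → η < ξ → (L ξ ζ η ↔ c ζ η)

/-- There is a coded structure satisfying all the axioms. -/
def Good (γ : Ordinal.{u}) (L : Ordinal.{u} → Ordinal.{u} → Ordinal.{u} → Prop)
    (c : Ordinal.{u} → Ordinal.{u} → Prop) (b : Ordinal.{u} → Prop) : Prop :=
  ∃ G : Str.{u}, G.Closed γ ∧ AxSet γ G ∧ AxMeas γ G ∧ AxOp γ G ∧ AxData γ G L c b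

/-! ### Reflection -/

section Reflection

variable {κ : Ordinal.{u}} {U : Ultrafilter Ordinal.{u}}

/-- The truth value of `R` at `κ` is its truth value almost everywhere. -/
def Refl (U : Ultrafilter Ordinal.{u}) (κ : Ordinal.{u}) (R : Ordinal.{u} → Prop) : Prop :=
  ∀ᶠ γ in U, (R γ ↔ R κ)

/-- The value of `T` at `κ` is below `κ` and is its value almost everywhere. -/
def TRefl (U : Ultrafilter Ordinal.{u}) (κ : Ordinal.{u}) (T : Ordinal.{u} → Ordinal.{u}) : Prop :=
  (∀ᶠ γ in U, T γ = T κ) ∧ T κ < κ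

theorem Refl.iff {R : Ordinal.{u} → Prop} (h : Refl U κ R) : (∀ᶠ γ in U, R γ) ↔ R κ := by
  constructor
  · intro h1
    obtain ⟨γ, h2, h3⟩ := (h1.and h).exists
    exact h3.1 h2
  · intro h1
    filter_upwards [h] with γ h2 using h2.2 h1

theorem Refl.const (P : Prop) : Refl U κ (fun _ => P) := Filter.Eventually.of_forall fun _ => Iff.rfl

theorem Refl.not {P : Ordinal.{u} → Prop} (hP : Refl U κ P) : Refl U κ (fun γ => ¬ P γ) := by
  filter_upwards [hP] with γ h1
  rw [h1]

theorem Refl.and {P Q : Ordinal.{u} → Prop} (hP : Refl U κ P) (hQ : Refl U κ Q) :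
    Refl U κ (fun γ => P γ ∧ Q γ) := by
  filter_upwards [hP, hQ] with γ h1 h2
  rw [h1, h2]

theorem Refl.or {P Q : Ordinal.{u} → Prop} (hP : Refl U κ P) (hQ : Refl U κ Q) :
    Refl U κ (fun γ => P γ ∨ Q γ) := by
  filter_upwards [hP, hQ] with γ h1 h2
  rw [h1, h2]

theorem Refl.imp {P Q : Ordinal.{u} → Prop} (hP : Refl U κ P) (hQ : Refl U κ Q) :
    Refl U κ (fun γ => P γ → Q γ) := by
  filter_upwards [hP, hQ] with γ h1 h2
  rw [h1, h2]

theorem Refl.iff' {P Q : Ordinal.{u} → Prop} (hP : Refl U κ P) (hQ : Refl U κ Q) :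
    Refl U κ (fun γ => P γ ↔ Q γ) := by
  filter_upwards [hP, hQ] with γ h1 h2
  rw [h1, h2]

theorem TRefl.eq {T S : Ordinal.{u} → Ordinal.{u}} (hT : TRefl U κ T) (hS : TRefl U κ S) :
    Refl U κ (fun γ => T γ = S γ) := by
  filter_upwards [hT.1, hS.1] with γ h1 h2
  rw [h1, h2]

theorem TRefl.const {ξ : Ordinal.{u}} (h : ξ < κ) : TRefl U κ (fun _ => ξ) :=
  ⟨Filter.Eventually.of_forall fun _ => rfl, h⟩

variable (hU : NormalUltra κ U)

include hU in
theorem NormalUltra.refl_lt {T : Ordinal.{u} → Ordinal.{u}} (hT : TRefl U κ T) :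
    Refl U κ (fun γ => T γ < γ) := by
  filter_upwards [hT.1, hU.gt _ hT.2] with γ h1 h2
  rw [h1]
  exact iff_of_true h2 hT.2

/-- Quantification over a domain which can be pressed down. -/
theorem refl_forall_of_press {T : Type*} {D : Ordinal.{u} → T → Prop}
    {P : Ordinal.{u} → T → Prop} (hD : ∀ t, D κ t → ∀ᶠ γ in U, D γ t)
    (hpress : ∀ f : Ordinal.{u} → T, (∀ᶠ γ in U, D γ (f γ)) → ∃ t, D κ t ∧ ∀ᶠ γ in U, f γ = t)
    (h : ∀ t, D κ t → Refl U κ (fun γ => P γ t)) : Refl U κ (fun γ => ∀ t, D γ t → P γ t) := by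
  by_cases hκ : ∀ t, D κ t → P κ t
  · suffices h1 : ∀ᶠ γ in U, ∀ t, D γ t → P γ t by
      filter_upwards [h1] with γ h2 using iff_of_true h2 hκ
    by_contra hn
    rw [← Ultrafilter.eventually_not] at hn
    push Not at hn
    classical
    obtain ⟨f, hf⟩ : ∃ f : Ordinal.{u} → T, ∀ᶠ γ in U, D γ (f γ) ∧ ¬ P γ (f γ) := by
      obtain ⟨γ₀, t₀, -⟩ := Filter.Eventually.exists (f := (U : Filter Ordinal.{u})) hn
      refine ⟨fun γ => if h : ∃ t, D γ t ∧ ¬ P γ t then h.choose else t₀, ?_⟩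
      filter_upwards [hn] with γ hγ
      rw [dif_pos hγ]
      exact hγ.choose_spec
    obtain ⟨t, ht, h1⟩ := hpress f (hf.mono fun _ h => h.1)
    obtain ⟨γ, h2, h3, h4⟩ := (h1.and (hf.and (h t ht))).exists
    rw [h2] at h3
    exact h3.2 (h4.2 (hκ t ht))
  · push Not at hκ
    obtain ⟨t, ht, hP⟩ := hκ
    filter_upwards [hD t ht, h t ht] with γ h1 h2
    refine iff_of_false (fun h3 => hP (h2.1 (h3 t h1))) fun h3 => hP (h3 t ht)

include hU

theorem NormalUltra.refl_forall {P : Ordinal.{u} → Ordinal.{u} → Prop}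
    (h : ∀ ξ, ξ < κ → Refl U κ (fun γ => P γ ξ)) : Refl U κ (fun γ => ∀ ξ, ξ < γ → P γ ξ) :=
  refl_forall_of_press (D := fun γ ξ => ξ < γ) (fun ξ hξ => hU.gt ξ hξ) (fun f hf => hU.press f hf) h

theorem NormalUltra.refl_exists {P : Ordinal.{u} → Ordinal.{u} → Prop}
    (h : ∀ ξ, ξ < κ → Refl U κ (fun γ => P γ ξ)) : Refl U κ (fun γ => ∃ ξ, ξ < γ ∧ P γ ξ) := by
  have := (hU.refl_forall (fun ξ hξ => (h ξ hξ).not)).not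
  simpa only [not_forall, not_not, exists_prop] using this

theorem NormalUltra.refl_forall_countable {ι : Type*} [Countable ι] {P : Ordinal.{u} → ι → Prop}
    (h : ∀ i, Refl U κ (fun γ => P γ i)) : Refl U κ (fun γ => ∀ i, P γ i) := by
  filter_upwards [hU.countable h] with γ h1
  exact forall_congr' h1

theorem NormalUltra.refl_forall_seq {P : Ordinal.{u} → Ordinal.{u} → (Ordinal.{u} → Ordinal.{u}) → Prop}
    (h : ∀ (α : Ordinal.{u}) (s : Ordinal.{u} → Ordinal.{u}), α < κ → (∀ i, s i < κ) → Refl U κ (fun γ => P γ α s)) :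
    Refl U κ (fun γ => ∀ (α : Ordinal.{u}) (s : Ordinal.{u} → Ordinal.{u}), (α < γ ∧ (∀ i, s i < γ) ∧ ∀ i, α ≤ i → s i = 0) → P γ α s) := by
  have := refl_forall_of_press (T := Ordinal.{u} × (Ordinal.{u} → Ordinal.{u}))
    (D := fun γ t => t.1 < γ ∧ (∀ i, t.2 i < γ) ∧ ∀ i, t.1 ≤ i → t.2 i = 0)
    (P := fun γ t => P γ t.1 t.2) ?_ ?_ (fun t ht => h t.1 t.2 ht.1 ht.2.1)
  · simpa only [Prod.forall] using this
  · rintro ⟨α, s⟩ ⟨h1, h2, h3⟩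
    filter_upwards [hU.gt _ h1, hU.complete h1 (P := fun i γ => s i < γ) fun i _ => hU.gt _ (h2 i),
      hU.gt 0 hU.pos] with γ h4 h5 h6
    refine ⟨h4, fun i => ?_, h3⟩
    rcases lt_or_ge i α with h7 | h7
    · exact h5 i h7
    · exact (h3 i h7).trans_lt h6
  · intro f hf
    obtain ⟨α, hα, h1⟩ := hU.press (fun γ => (f γ).1) (hf.mono fun _ h => h.1)
    obtain ⟨s, hs1, hs2, hs3⟩ := hU.seq_const hα (f := fun γ => (f γ).2)
      (fun i hi => hf.mono fun _ h => h.2.1 i)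
    refine ⟨(α, s), ⟨hα, fun i => ?_, hs2⟩, ?_⟩
    · rcases lt_or_ge i α with h7 | h7
      · exact hs1 i h7
      · exact (hs2 i h7).trans_lt hU.pos
    · filter_upwards [hf, h1, hs3] with γ h2 h3 h4
      refine Prod.ext h3 (funext fun i => ?_)
      rcases lt_or_ge i α with h7 | h7
      · exact h4 i h7
      · rw [h2.2.2 i (h3.le.trans h7)]
        exact (hs2 i h7).symm

theorem NormalUltra.refl_forall_nat {P : Ordinal.{u} → (ℕ → Ordinal.{u}) → Prop}
    (h : ∀ s : ℕ → Ordinal.{u}, (∀ n, s n < κ) → Refl U κ (fun γ => P γ s)) :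
    Refl U κ (fun γ => ∀ s : ℕ → Ordinal.{u}, (∀ n, s n < γ) → P γ s) := by
  refine refl_forall_of_press (D := fun γ (s : ℕ → Ordinal.{u}) => ∀ n, s n < γ)
    (fun s hs => hU.countable fun n => hU.gt _ (hs n)) (fun f hf => ?_) h
  choose s hs1 hs2 using fun n => hU.press (fun γ => f γ n) (hf.mono fun _ h => h n)
  exact ⟨s, hs1, (hU.countable hs2).mono fun γ h => funext h⟩

theorem NormalUltra.refl_forall_list {P : Ordinal.{u} → List Ordinal.{u} → Prop}
    (h : ∀ l, (∀ x ∈ l, x < κ) → Refl U κ (fun γ => P γ l)) :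
    Refl U κ (fun γ => ∀ l : List Ordinal.{u}, (∀ x ∈ l, x < γ) → P γ l) := by
  have key : ∀ n, Refl U κ (fun γ => ∀ l : List Ordinal.{u}, (∀ x ∈ l, x < γ) → l.length = n → P γ l) := by
    intro n
    induction n generalizing P with
    | zero =>
      have := h [] (by simp)
      filter_upwards [this] with γ h1
      simpa only [List.length_eq_zero_iff, forall_eq_apply_imp_iff, imp.swap (b := _ = _),
        forall_eq, List.not_mem_nil, false_imp_iff, implies_true, true_imp_iff] using h1
    | succ n ih =>
      have := hU.refl_forall (P := fun γ x => ∀ l : List Ordinal.{u}, (∀ x ∈ l, x < γ) →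
        l.length = n → P γ (x :: l)) fun x hx => ih (P := fun γ l => P γ (x :: l)) fun l hl =>
          h _ (by simpa [hx] using hl)
      have h2 : ∀ γ, (∀ x, x < γ → ∀ l : List Ordinal.{u}, (∀ x ∈ l, x < γ) →
          l.length = n → P γ (x :: l)) ↔
          (∀ l : List Ordinal.{u}, (∀ x ∈ l, x < γ) → l.length = n + 1 → P γ l) := by
        intro γ
        constructor
        · rintro h3 (_ | ⟨x, l⟩) h4 h5
          · simp at h5
          · simp only [List.mem_cons, forall_eq_or_imp] at h4
            exact h3 x h4.1 l h4.2 (by simpa using h5)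
        · intro h3 x hx l hl hn
          exact h3 _ (by simpa [hx] using hl) (by simpa using hn)
      simpa only [h2] using this
  have := hU.refl_forall_countable key
  have h2 : ∀ γ, (∀ n, ∀ l : List Ordinal.{u}, (∀ x ∈ l, x < γ) → l.length = n → P γ l) ↔
      ∀ l : List Ordinal.{u}, (∀ x ∈ l, x < γ) → P γ l :=
    fun γ => ⟨fun h l hl => h _ l hl rfl, fun h n l hl _ => h l hl⟩
  simpa only [h2] using this

end Reflection

section Coherent

variable {κ : Ordinal.{u}} {U : Ultrafilter Ordinal.{u}}

/-- A family of structures cohering with its value at `κ`. -/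
structure Coh (U : Ultrafilter Ordinal.{u}) (κ : Ordinal.{u}) (G : Ordinal.{u} → Str.{u}) : Prop where
  E : ∀ a b, a < κ → b < κ → Refl U κ (fun γ => (G γ).E a b)
  F : ∀ a, a < κ → Refl U κ (fun γ => (G γ).F a)
  o : ∀ ξ, ξ < κ → TRefl U κ (fun γ => (G γ).o ξ)
  B : ∀ i a b, a < κ → b < κ → TRefl U κ (fun γ => (G γ).B i a b)

variable {G : Ordinal.{u} → Str.{u}} (hG : Coh U κ G)

section
include hG

theorem Coh.tE {S T : Ordinal.{u} → Ordinal.{u}} (hS : TRefl U κ S) (hT : TRefl U κ T) :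
    Refl U κ (fun γ => (G γ).E (S γ) (T γ)) := by
  filter_upwards [hS.1, hT.1, hG.E _ _ hS.2 hT.2] with γ h1 h2 h3
  rw [h1, h2, h3]

theorem Coh.tF {S : Ordinal.{u} → Ordinal.{u}} (hS : TRefl U κ S) :
    Refl U κ (fun γ => (G γ).F (S γ)) := by
  filter_upwards [hS.1, hG.F _ hS.2] with γ h1 h3
  rw [h1, h3]

theorem Coh.to {S : Ordinal.{u} → Ordinal.{u}} (hS : TRefl U κ S) :
    TRefl U κ (fun γ => (G γ).o (S γ)) := by
  refine ⟨?_, (hG.o _ hS.2).2⟩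
  filter_upwards [hS.1, (hG.o _ hS.2).1] with γ h1 h3
  rw [h1, h3]

theorem Coh.tB {S T : Ordinal.{u} → Ordinal.{u}} (i : Op) (hS : TRefl U κ S) (hT : TRefl U κ T) :
    TRefl U κ (fun γ => (G γ).B i (S γ) (T γ)) := by
  refine ⟨?_, (hG.B _ _ _ hS.2 hT.2).2⟩
  filter_upwards [hS.1, hT.1, (hG.B i _ _ hS.2 hT.2).1] with γ h1 h2 h3
  rw [h1, h2, h3]

end

variable (hU : NormalUltra κ U)
include hG hU

theorem Coh.tc (n : ℕ) : TRefl U κ (fun γ => (G γ).c n) :=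
  hG.B _ _ _ hU.pos hU.pos

theorem Coh.tcode {l : List Ordinal.{u}} (hl : ∀ x ∈ l, x < κ) :
    TRefl U κ (fun γ => (G γ).code l) := by
  induction l with
  | nil => exact hG.tc hU 2
  | cons x l ih =>
    simp only [List.mem_cons, forall_eq_or_imp] at hl
    exact hG.tB _ (TRefl.const hl.1) (ih hl.2)

theorem Coh.tsat (φ : Fm) (l : List (Ordinal.{u} → Ordinal.{u})) (hl : ∀ x ∈ l, TRefl U κ x) :
    Refl U κ (fun γ => Sat (· < γ) (G γ).E (G γ).F φ (l.map (fun x => x γ))) := by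
  induction φ generalizing l with
  | fls => exact Refl.const _
  | eq i j =>
    simp only [Sat, List.getElem?_map]
    rcases hi : l[i]? with _ | a
    · exact Refl.const False
    rcases hj : l[j]? with _ | b
    · exact Refl.const False
    exact (hl _ (List.mem_of_getElem? hi)).eq (hl _ (List.mem_of_getElem? hj))
  | mem i j =>
    simp only [Sat, List.getElem?_map]
    rcases hi : l[i]? with _ | a
    · exact Refl.const False
    rcases hj : l[j]? with _ | b
    · exact Refl.const False
    exact hG.tE (hl _ (List.mem_of_getElem? hi)) (hl _ (List.mem_of_getElem? hj))
  | meas i =>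
    simp only [Sat, List.getElem?_map]
    rcases hi : l[i]? with _ | a
    · exact Refl.const False
    exact hG.tF (hl _ (List.mem_of_getElem? hi))
  | imp φ ψ h1 h2 => exact (h1 l hl).imp (h2 l hl)
  | all φ h =>
    refine hU.refl_forall fun ξ hξ => ?_
    exact h ((fun _ => ξ) :: l) (by simpa [TRefl.const hξ] using hl)

theorem Coh.tsat_cons (φ : Fm) {T : Ordinal.{u} → Ordinal.{u}} (hT : TRefl U κ T)
    {l : List Ordinal.{u}} (hl : ∀ x ∈ l, x < κ) :
    Refl U κ (fun γ => Sat (· < γ) (G γ).E (G γ).F φ (T γ :: l)) := by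
  have h : ∀ γ : Ordinal.{u}, (l.map fun x => (fun _ => x : Ordinal.{u} → Ordinal.{u})).map
      (fun x => x γ) = l := fun γ => by rw [List.map_map]; exact List.map_id l
  simpa only [List.map_cons, h] using hG.tsat hU φ (T :: l.map fun x => fun _ => x)
    (by simpa [hT] using fun x hx => TRefl.const (hl x hx))

theorem Coh.tsat_const (φ : Fm) {l : List Ordinal.{u}} (hl : ∀ x ∈ l, x < κ) :
    Refl U κ (fun γ => Sat (· < γ) (G γ).E (G γ).F φ l) := by
  have h : ∀ γ : Ordinal.{u}, (l.map fun x => (fun _ => x : Ordinal.{u} → Ordinal.{u})).map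
      (fun x => x γ) = l := fun γ => by rw [List.map_map]; exact List.map_id l
  simpa only [h] using hG.tsat hU φ (l.map fun x => fun _ => x)
    (by simpa using fun x hx => TRefl.const (hl x hx))

theorem Coh.tClosed : Refl U κ (fun γ => (G γ).Closed γ) :=
  (hU.refl_forall fun _ hξ => hU.refl_lt (hG.to (TRefl.const hξ))).and <|
    hU.refl_forall_countable fun i => hU.refl_forall fun _ ha => hU.refl_forall fun _ hb =>
      hU.refl_lt (hG.tB i (TRefl.const ha) (TRefl.const hb))

omit hG in
theorem NormalUltra.tNoDesc {R : Ordinal.{u} → Ordinal.{u} → Ordinal.{u} → Prop}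
    (hR : ∀ a b, a < κ → b < κ → Refl U κ (fun γ => R γ a b)) :
    Refl U κ (fun γ => NoDesc γ (R γ)) :=
  hU.refl_forall_nat fun _ hs =>
    (hU.refl_forall_countable fun n => hR _ _ (hs (n + 1)) (hs n)).not

set_option maxHeartbeats 1000000 in
theorem Coh.tAxSet : Refl U κ (fun γ => AxSet γ (G γ)) := by
  unfold AxSet
  repeat' first
    | assumption
    | exact hU.tNoDesc hG.E
    | (refine hU.refl_forall_seq fun α s hα hs => ?_)
    | (refine hU.refl_forall fun _ _ => ?_)
    | (refine hU.refl_exists fun _ _ => ?_)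
    | apply hG.tE
    | apply hG.tF
    | exact Refl.const _
    | apply TRefl.eq
    | exact hG.tc hU _
    | apply hG.to
    | apply hG.tB
    | exact TRefl.const (by first | assumption | exact hU.pos)
    | apply Refl.and
    | apply Refl.or
    | apply Refl.iff'
    | apply Refl.imp

set_option maxHeartbeats 1000000 in
theorem Coh.tAxMeas : Refl U κ (fun γ => AxMeas γ (G γ)) := by
  unfold AxMeas
  repeat' first
    | (refine hU.refl_forall_seq fun α s hα hs => ?_)
    | (refine hU.refl_forall fun _ _ => ?_)
    | (refine hU.refl_exists fun _ _ => ?_)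
    | apply hG.tE
    | apply hG.tF
    | exact Refl.const _
    | apply TRefl.eq
    | exact hG.tc hU _
    | apply hG.to
    | apply hG.tB
    | exact TRefl.const (by first | assumption | exact hU.pos | exact hs _)
    | apply Refl.and
    | apply Refl.or
    | apply Refl.iff'
    | apply Refl.not
    | apply Refl.imp

set_option maxHeartbeats 1000000 in
theorem Coh.tAxOp : Refl U κ (fun γ => AxOp γ (G γ)) := by
  unfold AxOp
  repeat' first
    | (refine hU.refl_forall fun _ _ => ?_)
    | (refine hU.refl_exists fun _ _ => ?_)
    | (refine hU.refl_forall_list fun _ _ => ?_)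
    | (refine hU.refl_forall_countable fun _ => ?_)
    | apply hG.tE
    | apply hG.tF
    | exact hG.tsat_const hU _ (by assumption)
    | refine hG.tsat_cons hU _ ?_ (by assumption)
    | apply TRefl.eq
    | exact hG.tc hU _
    | exact hG.tcode hU (by assumption)
    | apply hG.to
    | apply hG.tB
    | exact TRefl.const (by first | assumption | exact hU.pos)
    | apply Refl.and
    | apply Refl.or
    | apply Refl.iff'
    | apply Refl.not
    | apply Refl.imp

set_option maxHeartbeats 1000000 in
theorem Coh.tAxData {L : Ordinal.{u} → Ordinal.{u} → Ordinal.{u} → Ordinal.{u} → Prop}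
    {c : Ordinal.{u} → Ordinal.{u} → Ordinal.{u} → Prop} {b : Ordinal.{u} → Ordinal.{u} → Prop}
    (hL : ∀ ξ, ξ < κ → ∀ᶠ γ in U, L γ ξ = L κ ξ)
    (hc : ∀ ζ η, ζ < κ → η < κ → Refl U κ (fun γ => c γ ζ η))
    (hb : ∀ ζ, ζ < κ → Refl U κ (fun γ => b γ ζ)) :
    Refl U κ (fun γ => AxData γ (G γ) (L γ) (c γ) (b γ)) := by
  have hL1 : ∀ ξ, ξ < κ → Refl U κ (fun γ => NoDesc ξ (L γ ξ)) := fun ξ hξ => by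
    filter_upwards [hL ξ hξ] with γ h
    rw [h]
  have hL2 : ∀ ξ, ξ < κ → ∀ ζ η, Refl U κ (fun γ => L γ ξ ζ η) := fun ξ hξ ζ η => by
    filter_upwards [hL ξ hξ] with γ h
    rw [h]
  unfold AxData
  repeat' first
    | (refine hU.refl_forall fun _ _ => ?_)
    | (refine hU.refl_exists fun _ _ => ?_)
    | exact hU.tNoDesc hc
    | exact hL1 _ (by assumption)
    | exact hL2 _ (by assumption) _ _
    | exact hc _ _ (by assumption) (by assumption)
    | exact hb _ (by assumption)
    | apply hG.tE
    | apply hG.tF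
    | exact Refl.const _
    | apply TRefl.eq
    | exact hG.tc hU _
    | apply hG.to
    | apply hG.tB
    | exact TRefl.const (by first | assumption | exact hU.pos)
    | apply Refl.and
    | apply Refl.or
    | apply Refl.iff'
    | apply Refl.not
    | apply Refl.imp

end Coherent

section GoodReflection

variable {κ : Ordinal.{u}} {U : Ultrafilter Ordinal.{u}} (hU : NormalUltra κ U)
include hU

theorem NormalUltra.eventually_ne : ∀ᶠ γ in U, γ ≠ κ := hU.lt.mono fun _ h => h.ne

theorem NormalUltra.refl_limit (P : Ordinal.{u} → Prop) :
    Refl U κ (fun γ => if γ = κ then ∀ᶠ δ in U, P δ else P γ) := by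
  by_cases h : ∀ᶠ δ in U, P δ
  · filter_upwards [h, hU.eventually_ne] with γ h1 h2
    simp [h1, h2, h]
  · filter_upwards [Ultrafilter.eventually_not.2 h, hU.eventually_ne] with γ h1 h2
    simp [h1, h2, h]

/-- The value on which a regressive function is constant almost everywhere. -/
noncomputable def pressed (U : Ultrafilter Ordinal.{u}) (κ : Ordinal.{u})
    (f : Ordinal.{u} → Ordinal.{u}) : Ordinal.{u} :=
  Classical.epsilon fun ξ => ξ < κ ∧ ∀ᶠ γ in U, f γ = ξ

theorem NormalUltra.trefl_limit {f : Ordinal.{u} → Ordinal.{u}} (hf : ∀ᶠ γ in U, f γ < γ) :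
    TRefl U κ (fun γ => if γ = κ then pressed U κ f else f γ) := by
  have h : pressed U κ f < κ ∧ ∀ᶠ γ in U, f γ = pressed U κ f :=
    Classical.epsilon_spec (hU.press f hf)
  refine ⟨?_, by simpa using h.1⟩
  filter_upwards [h.2, hU.eventually_ne] with γ h1 h2
  simp [h1, h2]

theorem NormalUltra.refl_good {L : Ordinal.{u} → Ordinal.{u} → Ordinal.{u} → Ordinal.{u} → Prop}
    {c : Ordinal.{u} → Ordinal.{u} → Ordinal.{u} → Prop} {b : Ordinal.{u} → Ordinal.{u} → Prop}
    (hL : ∀ ξ, ξ < κ → ∀ᶠ γ in U, L γ ξ = L κ ξ)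
    (hc : ∀ ζ η, ζ < κ → η < κ → Refl U κ (fun γ => c γ ζ η))
    (hb : ∀ ζ, ζ < κ → Refl U κ (fun γ => b γ ζ)) :
    Refl U κ (fun γ => Good γ (L γ) (c γ) (b γ)) := by
  have key : ∀ G : Ordinal.{u} → Str.{u}, Coh U κ G → Refl U κ (fun γ => (G γ).Closed γ ∧
      AxSet γ (G γ) ∧ AxMeas γ (G γ) ∧ AxOp γ (G γ) ∧ AxData γ (G γ) (L γ) (c γ) (b γ)) :=
    fun G hG => (hG.tClosed hU).and ((hG.tAxSet hU).and ((hG.tAxMeas hU).and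
      ((hG.tAxOp hU).and (hG.tAxData hU hL hc hb))))
  by_cases hκ : Good κ (L κ) (c κ) (b κ)
  · obtain ⟨G, hG⟩ := hκ
    have hcl := hG.1
    have := key (fun _ => G) ⟨fun _ _ _ _ => Refl.const _, fun _ _ => Refl.const _,
      fun _ h => TRefl.const (hcl.1 _ h), fun _ _ _ h h' => TRefl.const (hcl.2 _ _ h _ h')⟩
    filter_upwards [this] with γ h
    exact iff_of_true ⟨G, h.2 hG⟩ ⟨G, hG⟩
  · suffices h : ¬ ∀ᶠ γ in U, Good γ (L γ) (c γ) (b γ) by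
      filter_upwards [Ultrafilter.eventually_not.2 h] with γ h1 using iff_of_false h1 hκ
    intro h
    refine hκ ?_
    classical
    let G : Ordinal.{u} → Str.{u} := fun γ =>
      if h : Good γ (L γ) (c γ) (b γ) then h.choose else ⟨fun _ _ => True, fun _ => True, id, fun _ => 0⟩
    have hG : ∀ᶠ γ in U, (G γ).Closed γ ∧
      AxSet γ (G γ) ∧ AxMeas γ (G γ) ∧ AxOp γ (G γ) ∧ AxData γ (G γ) (L γ) (c γ) (b γ) := by
      filter_upwards [h] with γ h1
      simp only [G, dif_pos h1]
      exact h1.choose_spec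
    let G' : Ordinal.{u} → Str.{u} := fun γ =>
      { E := fun a b => if γ = κ then ∀ᶠ δ in U, (G δ).E a b else (G γ).E a b
        F := fun a => if γ = κ then ∀ᶠ δ in U, (G δ).F a else (G γ).F a
        o := fun ξ => if γ = κ then pressed U κ (fun δ => (G δ).o ξ) else (G γ).o ξ
        B := fun i a b => if γ = κ then pressed U κ (fun δ => (G δ).B i a b) else (G γ).B i a b }
    have hG' : Coh U κ G' := ⟨fun a b _ _ => hU.refl_limit _, fun a _ => hU.refl_limit _,
      fun ξ hξ => hU.trefl_limit (by
        filter_upwards [hG, hU.gt _ hξ] with γ h1 h2 using h1.1.1 _ h2),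
      fun i a b ha hb => hU.trefl_limit (by
        filter_upwards [hG, hU.gt _ ha, hU.gt _ hb] with γ h1 h2 h3 using h1.1.2 _ _ h2 _ h3)⟩
    refine ⟨G' κ, (key G' hG').iff.1 ?_⟩
    filter_upwards [hG, hU.eventually_ne] with γ h1 h2
    have : G' γ = G γ := by simp [G', h2]
    rwa [this]

end GoodReflection

open Classical in
/-- The restriction of a sequence of relations to the indices below `γ`. -/
noncomputable def trunc (γ : Ordinal.{u}) (L : Ordinal.{u} → Ordinal.{u} → Ordinal.{u} → Prop) :
    Ordinal.{u} → Ordinal.{u} → Ordinal.{u} → Prop :=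
  fun ξ => if ξ < γ then L ξ else fun _ _ => False

open Classical in
/-- The coded Laver function, picking a least failure of `Good` at each stage. -/
noncomputable def laver (γ : Ordinal.{u}) : Ordinal.{u} → Ordinal.{u} → Prop :=
  Classical.epsilon fun c => ∃ b, ¬ Good γ
    (fun ξ => if _ : ξ < γ then laver ξ else fun _ _ => False) c b
termination_by γ

theorem laver_spec {γ : Ordinal.{u}} (h : ∃ c b, ¬ Good γ (trunc γ laver) c b) :
    ∃ b, ¬ Good γ (trunc γ laver) (laver γ) b := by
  have : laver γ = Classical.epsilon fun c => ∃ b, ¬ Good γ (trunc γ laver) c b := by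
    rw [laver]
    rfl
  rw [this]
  exact Classical.epsilon_spec h

theorem NormalUltra.good_laver {κ : Ordinal.{u}} {U : Ultrafilter Ordinal.{u}}
    (hU : NormalUltra κ U)
    (hgood : ∀ c b, (∀ᶠ γ in U, ∀ ζ, ζ < γ → ∀ η, η < γ → (laver γ ζ η ↔ c ζ η)) →
      Good κ (trunc κ laver) c b)
    (c : Ordinal.{u} → Ordinal.{u} → Prop) (b : Ordinal.{u} → Prop) :
    Good κ (trunc κ laver) c b := by
  by_contra hn
  have hL : ∀ ξ, ξ < κ → ∀ᶠ γ in U, trunc γ laver ξ = trunc κ laver ξ := fun ξ hξ => by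
    filter_upwards [hU.gt ξ hξ] with γ h
    simp [trunc, h, hξ]
  have h1 : ∀ᶠ γ in U, ¬ Good γ (trunc γ laver) c b :=
    (hU.refl_good (L := fun γ => trunc γ laver) hL (c := fun _ => c) (b := fun _ => b)
      (fun _ _ _ _ => Refl.const _) (fun _ _ => Refl.const _)).not.iff.2 hn
  choose b' hb' using fun γ => fun h => laver_spec (γ := γ) ⟨c, b, h⟩
  classical
  let bb : Ordinal.{u} → Ordinal.{u} → Prop := fun γ =>
    if h : ¬ Good γ (trunc γ laver) c b then b' γ h else fun _ => False
  let c' : Ordinal.{u} → Ordinal.{u} → Ordinal.{u} → Prop := fun γ ζ η =>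
    if γ = κ then ∀ᶠ δ in U, laver δ ζ η else laver γ ζ η
  let b'' : Ordinal.{u} → Ordinal.{u} → Prop := fun γ ζ =>
    if γ = κ then ∀ᶠ δ in U, bb δ ζ else bb γ ζ
  have h2 := hU.refl_good (L := fun γ => trunc γ laver) hL (c := c') (b := b'')
    (fun _ _ _ _ => hU.refl_limit _) (fun _ _ => hU.refl_limit _)
  refine h2.not.iff.1 ?_ (hgood _ _ ?_)
  · filter_upwards [h1, hU.eventually_ne] with γ h3 h4
    have e1 : c' γ = laver γ := by
      funext ζ η
      simp [c', h4]
    have e2 : b'' γ = b' γ h3 := by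
      funext ζ
      simp [b'', h4, bb, h3]
    rw [e1, e2]
    exact hb' γ h3
  · have h5 : Refl U κ (fun γ => ∀ ζ, ζ < γ → ∀ η, η < γ → (c' γ ζ η ↔ c' κ ζ η)) :=
      hU.refl_forall fun ζ _ => hU.refl_forall fun η _ => (hU.refl_limit _).iff' (Refl.const _)
    filter_upwards [h5.iff.2 fun _ _ _ _ => Iff.rfl, hU.eventually_ne] with γ h6 h7 ζ hζ η hη
    rw [← h6 ζ hζ η hη]
    simp [c', h7]

/-! ### The operations in the universe -/

section Collapse

/-- `f` collapses the relation `R` on `γ`. -/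
def IsColl (γ : Ordinal.{u}) (R : Ordinal.{u} → Ordinal.{u} → Prop)
    (f : Ordinal.{u} → ZFSet.{u}) : Prop :=
  ∀ η, η < γ → ∀ z, z ∈ f η ↔ ∃ ζ, ζ < γ ∧ R ζ η ∧ z = f ζ

theorem NoDesc.wf {γ : Ordinal.{u}} {R : Ordinal.{u} → Ordinal.{u} → Prop} (h : NoDesc γ R) :
    WellFounded (fun a b : Set.Iio γ => R a b) := by
  rw [wellFounded_iff_isEmpty_descending_chain]
  refine ⟨fun s => ?_⟩
  exact h (fun n => s.1 n) (fun n => (s.1 n).2) s.2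

theorem NoDesc.exists_coll {γ : Ordinal.{u}} {R : Ordinal.{u} → Ordinal.{u} → Prop}
    (h : NoDesc γ R) : ∃ f, IsColl γ R f := by
  classical
  let g : Set.Iio γ → ZFSet.{u} := h.wf.fix fun η ih =>
    ZFSet.range (fun ζ : {ζ : Set.Iio γ // R ζ η} => ih ζ.1 ζ.2)
  refine ⟨fun η => if h : η < γ then g ⟨η, h⟩ else ∅, fun η hη z => ?_⟩
  have h1 : g ⟨η, hη⟩ = ZFSet.range (fun ζ : {ζ : Set.Iio γ // R ζ η} => g ζ.1) :=
    h.wf.fix_eq _ _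
  simp only [dif_pos hη, h1, ZFSet.mem_range]
  constructor
  · rintro ⟨⟨⟨ζ, hζ⟩, h2⟩, rfl⟩
    exact ⟨ζ, hζ, h2, by rw [dif_pos (Set.mem_Iio.1 hζ)]⟩
  · rintro ⟨ζ, hζ, h2, rfl⟩
    exact ⟨⟨⟨ζ, hζ⟩, h2⟩, by rw [dif_pos hζ]⟩

/-- The collapse of a relation on `γ`. -/
noncomputable def coll (γ : Ordinal.{u}) (R : Ordinal.{u} → Ordinal.{u} → Prop) :
    Ordinal.{u} → ZFSet.{u} :=
  Classical.epsilon (IsColl γ R)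

theorem NoDesc.coll {γ : Ordinal.{u}} {R : Ordinal.{u} → Ordinal.{u} → Prop} (h : NoDesc γ R) :
    IsColl γ R (coll γ R) := Classical.epsilon_spec h.exists_coll

end Collapse

/-- Additional operations under which the coded structure is closed. -/
inductive Ex
  | upair
  | wit
  | compl
  | tail
  | inter
  | diag
  | eqv
  | pset
  | guess
  deriving Countable

namespace Univ

/-- The value of the function `f` at `x`. -/
noncomputable def app (f x : ZFSet.{u}) : ZFSet.{u} := Classical.epsilon fun y => ZFSet.pair x y ∈ f

/-- The set coding the truth value `true`. -/
def one : ZFSet.{u} := {∅}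

theorem one_ne : one ≠ (∅ : ZFSet.{u}) := by
  intro h
  have : (∅ : ZFSet.{u}) ∈ one := by simp [one]
  rw [h] at this
  exact ZFSet.notMem_empty _ this

/-- The set coding a list of sets. -/
noncomputable def code : List ZFSet.{u} → ZFSet.{u}
  | [] => one
  | y :: l => ZFSet.pair y (code l)

theorem code_inj {l m : List ZFSet.{u}} (hn : l.length = m.length) (h : code l = code m) : l = m := by
  induction l generalizing m with
  | nil => simpa [eq_comm] using hn
  | cons x l ih =>
    rcases m with _ | ⟨y, m⟩
    · simp at hn
    · simp only [code, ZFSet.pair_inj] at h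
      rw [h.1, ih (by simpa using hn) h.2]

variable (κ : Ordinal.{u}) (U : Ultrafilter Ordinal.{u})
  (L : Ordinal.{u} → Ordinal.{u} → Ordinal.{u} → Prop)
  (c : Ordinal.{u} → Ordinal.{u} → Prop) (b : Ordinal.{u} → Prop)

/-- The set of codes of the ordinals below `κ` satisfying `P`. -/
noncomputable def osep (P : Ordinal.{u} → Prop) : ZFSet.{u} :=
  ZFSet.sep (fun x => P x.rank) κ.toZFSet

/-- The set coding a function on `κ`. -/
noncomputable def fn (f : Ordinal.{u} → ZFSet.{u}) : ZFSet.{u} :=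
  img (fun x => ZFSet.pair x (f x.rank)) κ.toZFSet

/-- The predicate of belonging to the measure. -/
def FV (a : ZFSet.{u}) : Prop := a ⊆ κ.toZFSet ∧ ∀ᶠ γ : Ordinal.{u} in U, γ.toZFSet ∈ a

variable {κ}

theorem mem_osep {P : Ordinal.{u} → Prop} {z : ZFSet.{u}} :
    z ∈ osep κ P ↔ ∃ ξ, ξ < κ ∧ P ξ ∧ z = ξ.toZFSet := by
  simp only [osep, ZFSet.mem_sep, Ordinal.mem_toZFSet_iff]
  constructor
  · rintro ⟨⟨ξ, h1, rfl⟩, h2⟩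
    rw [Ordinal.rank_toZFSet] at h2
    exact ⟨ξ, h1, h2, rfl⟩
  · rintro ⟨ξ, h1, h2, rfl⟩
    exact ⟨⟨ξ, h1, rfl⟩, by rwa [Ordinal.rank_toZFSet]⟩

theorem toZFSet_mem_osep {P : Ordinal.{u} → Prop} {ξ : Ordinal.{u}} :
    ξ.toZFSet ∈ osep κ P ↔ ξ < κ ∧ P ξ := by
  rw [mem_osep]
  constructor
  · rintro ⟨η, h1, h2, h3⟩
    rw [Ordinal.toZFSet_injective h3]
    exact ⟨h1, h2⟩
  · rintro ⟨h1, h2⟩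
    exact ⟨ξ, h1, h2, rfl⟩

theorem osep_subset {P : Ordinal.{u} → Prop} : osep κ P ⊆ κ.toZFSet :=
  fun _ h => (ZFSet.mem_sep.1 h).1

theorem mem_fn {f : Ordinal.{u} → ZFSet.{u}} {z : ZFSet.{u}} :
    z ∈ fn κ f ↔ ∃ ξ, ξ < κ ∧ z = ZFSet.pair ξ.toZFSet (f ξ) := by
  simp only [fn, mem_img, Ordinal.mem_toZFSet_iff]
  constructor
  · rintro ⟨_, ⟨ξ, h1, rfl⟩, rfl⟩
    exact ⟨ξ, h1, by rw [Ordinal.rank_toZFSet]⟩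
  · rintro ⟨ξ, h1, rfl⟩
    exact ⟨_, ⟨ξ, h1, rfl⟩, by rw [Ordinal.rank_toZFSet]⟩

theorem app_fn {f : Ordinal.{u} → ZFSet.{u}} {ξ : Ordinal.{u}} (h : ξ < κ) :
    app (fn κ f) ξ.toZFSet = f ξ := by
  have h1 : ∃ y, ZFSet.pair ξ.toZFSet y ∈ fn κ f := ⟨f ξ, mem_fn.2 ⟨ξ, h, rfl⟩⟩
  have h2 : ZFSet.pair ξ.toZFSet (app (fn κ f) ξ.toZFSet) ∈ fn κ f := Classical.epsilon_spec h1
  obtain ⟨η, h3, h4⟩ := mem_fn.1 h2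
  rw [ZFSet.pair_inj] at h4
  rw [h4.2, Ordinal.toZFSet_injective h4.1]

theorem FV_osep (hU : NormalUltra κ U) {P : Ordinal.{u} → Prop} :
    FV κ U (osep κ P) ↔ ∀ᶠ γ in U, P γ := by
  constructor
  · intro h
    filter_upwards [h.2] with γ h1 using (toZFSet_mem_osep.1 h1).2
  · intro h
    refine ⟨osep_subset, ?_⟩
    filter_upwards [h, hU.lt] with γ h1 h2 using toZFSet_mem_osep.2 ⟨h2, h1⟩

variable (κ)

/-- The stationary value of a pair of functions. -/
noncomputable def pressVal (t s : ZFSet.{u}) : Ordinal.{u} :=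
  Classical.epsilon fun ζ => ζ < κ ∧
    ∀ᶠ γ : Ordinal.{u} in U, app t γ.toZFSet = app (app s γ.toZFSet) ζ.toZFSet

open Classical in
/-- The operations on the universe. -/
noncomputable def op : Op → ZFSet.{u} → ZFSet.{u} → ZFSet.{u}
  | .cst 0, _, _ => κ.toZFSet
  | .cst 1, _, _ => fn κ fun ξ => ξ.toZFSet
  | .cst 2, _, _ => one
  | .cst 3, _, _ => osep κ b
  | .cst 4, _, _ => fn κ (coll κ c)
  | .cst 5, _, _ => fn κ fun ξ => fn κ (coll ξ (L ξ))
  | .cst 6, _, _ => img (fun x => ZFSet.pair x (coll x.rank (L x.rank) 0))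
      (osep κ fun ξ => 0 < ξ ∧ NoDesc ξ (L ξ))
  | .cst _, _, _ => ∅
  | .pr, x, y => ZFSet.pair x y
  | .ev, f, x => app f x
  | .cnst, x, _ => fn κ fun _ => x
  | .quant, t, _ => if ∀ᶠ γ : Ordinal.{u} in U, app t γ.toZFSet = one then one else ∅
  | .press, t, s => (pressVal κ U t s).toZFSet
  | .graph, t, _ => fn κ fun ξ => app t ξ.toZFSet
  | .cov, t, _ => img (app t) κ.toZFSet
  | .amen, x, _ => ZFSet.sep (FV κ U) x
  | .chi φ n, t, _ => if ∃ l : List ZFSet.{u}, l.length = n ∧ code l = t ∧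
      Sat (fun _ => True) (fun x y => x ∈ y) (FV κ U) φ l then one else ∅
  | .sk φ n, t, _ => Classical.epsilon fun y => ∃ l : List ZFSet.{u}, l.length = n ∧ code l = t ∧
      ¬ Sat (fun _ => True) (fun x y => x ∈ y) (FV κ U) φ (y :: l)
  | .sharp i, t, s => fn κ fun ξ => op i (app t ξ.toZFSet) (app s ξ.toZFSet)

/-- The additional operations on the universe. -/
noncomputable def opEx : Ex → ZFSet.{u} → ZFSet.{u} → ZFSet.{u}
  | .upair, x, y => {x, y}
  | .wit, x, y => Classical.epsilon fun z => z ∈ x ∧ z ∉ y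
  | .compl, x, _ => osep κ fun ξ => ξ.toZFSet ∉ x
  | .tail, x, _ => osep κ fun ξ => x ∈ ξ.toZFSet
  | .inter, x, _ => osep κ fun ξ => ∀ z ∈ x, ξ.toZFSet ∈ z
  | .diag, t, _ => osep κ fun ξ => ∀ η < ξ, ξ.toZFSet ∈ app t η.toZFSet
  | .eqv, t, s => osep κ fun ξ => app t ξ.toZFSet = s
  | .pset, t, s => osep κ fun ξ => app t ξ.toZFSet = app (app s ξ.toZFSet) (pressVal κ U t s).toZFSet
  | .guess, _, _ => osep κ fun ξ => ∀ ζ < ξ, ∀ η < ξ, (L ξ ζ η ↔ c ζ η)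

/-- The shapes of terms for elements of the hull. -/
abbrev Shape := (Set.Iio κ ⊕ Option (Op ⊕ Ex)) × Set.Iio κ

open Classical in
/-- Extension of a short sequence of sets by the empty set. -/
noncomputable def ext {α : Set.Iio κ} (s : Set.Iio α.1 → ZFSet.{u}) (i : Ordinal.{u}) : ZFSet.{u} :=
  if h : i < α.1 then s ⟨i, h⟩ else ∅

/-- Evaluation of terms. -/
noncomputable def step : (Σ a : Shape κ, (Set.Iio a.2.1 → ZFSet.{u})) → ZFSet.{u}
  | ⟨(.inl ξ, _), _⟩ => ξ.1.toZFSet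
  | ⟨(.inr none, _), s⟩ => ZFSet.range s
  | ⟨(.inr (some (.inl i)), _), s⟩ => op κ U L c b i (ext κ s 0) (ext κ s 1)
  | ⟨(.inr (some (.inr i)), _), s⟩ => opEx κ U L c i (ext κ s 0) (ext κ s 1)

/-- The hull: the closure of the ordinals below `κ` under the operations and under
short sequences. -/
def hull : Set ZFSet.{u} :=
  Set.range (WType.elim (β := fun a : Shape κ => Set.Iio a.2.1) ZFSet.{u} (step κ U L c b))

variable {κ U L c b}

theorem toZFSet_mem_hull {ξ : Ordinal.{u}} (h : ξ < κ) : ξ.toZFSet ∈ hull κ U L c b :=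
  ⟨WType.mk (.inl ⟨ξ, h⟩, ⟨0, (zero_le (a := ξ)).trans_lt h⟩) fun i => absurd i.2 (by simp), rfl⟩

theorem range_mem_hull {α : Ordinal.{u}} (h : α < κ) {s : Set.Iio α → ZFSet.{u}}
    (hs : ∀ i, s i ∈ hull κ U L c b) : ZFSet.range s ∈ hull κ U L c b := by
  choose t ht using hs
  refine ⟨WType.mk (.inr none, ⟨α, h⟩) t, ?_⟩
  simp only [WType.elim, step]
  congr 1
  exact funext ht

theorem pair_fun (hU : NormalUltra κ U) {x y : ZFSet.{u}} (hx : x ∈ hull κ U L c b)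
    (hy : y ∈ hull κ U L c b) (i : Option (Op ⊕ Ex)) :
    ∃ s : Set.Iio (2 : Ordinal.{u}) → ZFSet.{u}, ∃ h : 2 < κ, ext κ (α := ⟨2, h⟩) s 0 = x ∧
      ext κ (α := ⟨2, h⟩) s 1 = y ∧ step κ U L c b ⟨(.inr i, ⟨2, h⟩), s⟩ ∈ hull κ U L c b := by
  obtain ⟨x, rfl⟩ := hx
  obtain ⟨y, rfl⟩ := hy
  classical
  have h : (2 : Ordinal.{u}) < κ := by exact_mod_cast hU.nat_lt 2
  let t : Set.Iio (2 : Ordinal.{u}) → WType (fun a : Shape κ => Set.Iio a.2.1) :=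
    fun i => if i.1 = 0 then x else y
  refine ⟨fun i => WType.elim ZFSet.{u} (step κ U L c b) (t i), h, ?_, ?_,
    WType.mk (.inr i, ⟨2, h⟩) t, rfl⟩
  · simp [ext, t]
  · simp [ext, t]

theorem op_mem_hull (hU : NormalUltra κ U) (i : Op) {x y : ZFSet.{u}} (hx : x ∈ hull κ U L c b)
    (hy : y ∈ hull κ U L c b) : op κ U L c b i x y ∈ hull κ U L c b := by
  obtain ⟨s, h, rfl, rfl, h1⟩ := pair_fun hU hx hy (some (.inl i))
  exact h1

theorem opEx_mem_hull (hU : NormalUltra κ U) (i : Ex) {x y : ZFSet.{u}} (hx : x ∈ hull κ U L c b)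
    (hy : y ∈ hull κ U L c b) : opEx κ U L c i x y ∈ hull κ U L c b := by
  obtain ⟨s, h, rfl, rfl, h1⟩ := pair_fun hU hx hy (some (.inr i))
  exact h1

theorem mk_hull (hU : NormalUltra κ U) :
    Cardinal.mk (hull κ U L c b) = Cardinal.mk (Set.Iio κ) := by
  apply le_antisymm
  · refine Cardinal.mk_range_le.trans (WType.cardinalMk_le_of_le ?_)
    have h0 := hU.aleph0_le
    calc (Cardinal.sum fun a : Shape κ => Cardinal.mk (Set.Iio κ) ^ Cardinal.mk (Set.Iio a.2.1))
        = Cardinal.mk (Σ a : Shape κ, (Set.Iio a.2.1 → Set.Iio κ)) := by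
          simp only [Cardinal.mk_sigma, Cardinal.mk_arrow, Cardinal.lift_id]
      _ = Cardinal.mk ((Set.Iio κ ⊕ Option (Op ⊕ Ex)) × Σ α : Set.Iio κ, (Set.Iio α.1 → Set.Iio κ)) :=
          Cardinal.mk_congr
            ⟨fun x => ⟨x.1.1, x.1.2, x.2⟩, fun x => ⟨⟨x.1, x.2.1⟩, x.2.2⟩, fun _ => rfl, fun _ => rfl⟩
      _ ≤ Cardinal.mk (Set.Iio κ) * Cardinal.mk (Set.Iio κ) := by
          rw [Cardinal.mk_prod, Cardinal.lift_id, Cardinal.lift_id]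
          refine mul_le_mul' ?_ hU.mk_seq_le
          rw [Cardinal.mk_sum]
          refine (Cardinal.add_le_max _ _).trans (max_le (max_le (by simp) ?_) h0)
          refine le_trans ?_ h0
          rw [Cardinal.lift_le_aleph0]
          exact Cardinal.mk_le_aleph0
      _ = _ := Cardinal.mul_eq_self h0
  · exact Cardinal.mk_le_of_injective (f := fun ξ : Set.Iio κ =>
      (⟨ξ.1.toZFSet, toZFSet_mem_hull ξ.2⟩ : hull κ U L c b))
      fun ξ η h => Subtype.ext (Ordinal.toZFSet_injective (congrArg Subtype.val h))

end Univ

namespace Univ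

/-- An enumeration of the hull in order type `κ`. -/
structure Dec (κ : Ordinal.{u}) (M : Set ZFSet.{u}) (d : Ordinal.{u} → ZFSet.{u})
    (e : ZFSet.{u} → Ordinal.{u}) : Prop where
  mem : ∀ a, a < κ → d a ∈ M
  lt : ∀ x ∈ M, e x < κ
  de : ∀ x ∈ M, d (e x) = x
  ed : ∀ a, a < κ → e (d a) = a

theorem exists_dec {κ : Ordinal.{u}} {M : Set ZFSet.{u}}
    (h : Cardinal.mk M = Cardinal.mk (Set.Iio κ)) : ∃ d e, Dec κ M d e := by
  obtain ⟨f⟩ := Cardinal.eq.1 h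
  classical
  refine ⟨fun a => if h : a < κ then f.symm ⟨a, h⟩ else ∅,
    fun x => if h : x ∈ M then f ⟨x, h⟩ else 0, ?_, ?_, ?_, ?_⟩
  · intro a ha
    rw [dif_pos ha]
    exact Subtype.prop _
  · intro x hx
    rw [dif_pos hx]
    exact (f ⟨x, hx⟩).2
  · intro x hx
    have : (f ⟨x, hx⟩ : Ordinal) < κ := (f ⟨x, hx⟩).2
    simp only [dif_pos hx, dif_pos this, Subtype.coe_eta, Equiv.symm_apply_apply]
  · intro a ha
    have : (f.symm ⟨a, ha⟩ : ZFSet) ∈ M := (f.symm ⟨a, ha⟩).2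
    simp only [dif_pos ha, dif_pos this, Subtype.coe_eta, Equiv.apply_symm_apply]

variable {κ : Ordinal.{u}} {U : Ultrafilter Ordinal.{u}}
  {L : Ordinal.{u} → Ordinal.{u} → Ordinal.{u} → Prop}
  {c : Ordinal.{u} → Ordinal.{u} → Prop} {b : Ordinal.{u} → Prop}
  {d : Ordinal.{u} → ZFSet.{u}} {e : ZFSet.{u} → Ordinal.{u}}

variable (κ U L c b d e) in
/-- The coded structure. -/
noncomputable def str : Str.{u} where
  E x y := d x ∈ d y
  F x := FV κ U (d x)
  o ξ := e ξ.toZFSet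
  B i x y := e (op κ U L c b i (d x) (d y))

section
variable (hd : Dec κ (hull κ U L c b) d e)

include hd

theorem Dec.d_inj {x y : Ordinal.{u}} (hx : x < κ) (hy : y < κ) : x = y ↔ d x = d y :=
  ⟨fun h => h ▸ rfl, fun h => by rw [← hd.ed x hx, ← hd.ed y hy, h]⟩

theorem Dec.o_lt {ξ : Ordinal.{u}} (h : ξ < κ) : (str κ U L c b d e).o ξ < κ :=
  hd.lt _ (toZFSet_mem_hull h)

theorem Dec.d_o {ξ : Ordinal.{u}} (h : ξ < κ) : d ((str κ U L c b d e).o ξ) = ξ.toZFSet :=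
  hd.de _ (toZFSet_mem_hull h)

theorem Dec.surj {x : ZFSet.{u}} (h : x ∈ hull κ U L c b) : ∃ a, a < κ ∧ d a = x :=
  ⟨e x, hd.lt x h, hd.de x h⟩

theorem Dec.mem_range {α : Ordinal.{u}} (hα : α < κ) {s : Ordinal.{u} → Ordinal.{u}}
    (hs : ∀ i, s i < κ) : ∃ a, a < κ ∧ ∀ z, z ∈ d a ↔ ∃ i, i < α ∧ z = d (s i) := by
  obtain ⟨a, ha, h⟩ := hd.surj (range_mem_hull (U := U) (L := L) (c := c) (b := b) hα
    (s := fun i : Set.Iio α => d (s i)) fun i => hd.mem _ (hs _))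
  refine ⟨a, ha, fun z => ?_⟩
  rw [h, ZFSet.mem_range]
  constructor
  · rintro ⟨i, rfl⟩
    exact ⟨i.1, i.2, rfl⟩
  · rintro ⟨i, hi, rfl⟩
    exact ⟨⟨i, hi⟩, rfl⟩

theorem Dec.E_o {ξ x : Ordinal.{u}} (h : ξ < κ) :
    (str κ U L c b d e).E ((str κ U L c b d e).o ξ) x ↔ ξ.toZFSet ∈ d x := by
  change d _ ∈ _ ↔ _
  rw [hd.d_o h]

variable (hU : NormalUltra κ U)
include hU

theorem Dec.B_lt {i : Op} {x y : Ordinal.{u}} (hx : x < κ) (hy : y < κ) :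
    (str κ U L c b d e).B i x y < κ :=
  hd.lt _ (op_mem_hull hU i (hd.mem x hx) (hd.mem y hy))

theorem Dec.d_B {i : Op} {x y : Ordinal.{u}} (hx : x < κ) (hy : y < κ) :
    d ((str κ U L c b d e).B i x y) = op κ U L c b i (d x) (d y) :=
  hd.de _ (op_mem_hull hU i (hd.mem x hx) (hd.mem y hy))

theorem Dec.d_c {n : ℕ} : d ((str κ U L c b d e).c n) = op κ U L c b (.cst n) ∅ ∅ := by
  rw [Str.c, hd.d_B hU hU.pos hU.pos]
  rcases n with _ | _ | _ | _ | _ | _ | _ | n <;> rfl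

theorem Dec.c_lt {n : ℕ} : (str κ U L c b d e).c n < κ := hd.B_lt hU hU.pos hU.pos

theorem Dec.ap_lt {t ξ : Ordinal.{u}} (ht : t < κ) (hξ : ξ < κ) :
    (str κ U L c b d e).ap t ξ < κ := hd.B_lt hU ht (hd.o_lt hξ)

theorem Dec.d_ap {t ξ : Ordinal.{u}} (ht : t < κ) (hξ : ξ < κ) :
    d ((str κ U L c b d e).ap t ξ) = app (d t) ξ.toZFSet := by
  rw [Str.ap, hd.d_B hU ht (hd.o_lt hξ), hd.d_o hξ, op]

theorem Dec.closed : (str κ U L c b d e).Closed κ :=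
  ⟨fun _ h => hd.o_lt h, fun _ _ ha _ hb => hd.B_lt hU ha hb⟩

theorem Dec.code {l : List Ordinal.{u}} (hl : ∀ x ∈ l, x < κ) :
    (str κ U L c b d e).code l < κ ∧ d ((str κ U L c b d e).code l) = code (l.map d) := by
  induction l with
  | nil => exact ⟨hd.c_lt hU, by rw [Str.code, hd.d_c hU]; simp [op, Univ.code]⟩
  | cons x l ih =>
    simp only [List.mem_cons, forall_eq_or_imp] at hl
    obtain ⟨h1, h2⟩ := ih hl.2
    exact ⟨hd.B_lt hU hl.1 h1, by rw [Str.code, hd.d_B hU hl.1 h1, op, h2]; rfl⟩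

theorem exists_wit {x y : ZFSet.{u}} (hx : x ∈ hull κ U L c b) (hy : y ∈ hull κ U L c b)
    (h : ¬ x ⊆ y) : ∃ z < κ, d z ∈ x ∧ d z ∉ y := by
  have h1 : ∃ z, z ∈ x ∧ z ∉ y := by
    by_contra h2
    push Not at h2
    exact h fun z hz => h2 z hz
  have h2 := Classical.epsilon_spec h1
  obtain ⟨z, hz, h3⟩ := hd.surj (opEx_mem_hull hU .wit hx hy)
  exact ⟨z, hz, by rw [h3]; exact h2⟩

theorem Dec.subset {x y : ZFSet.{u}} (hx : x ∈ hull κ U L c b) (hy : y ∈ hull κ U L c b)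
    (h : ∀ z, z < κ → d z ∈ x → d z ∈ y) : x ⊆ y := by
  by_contra h1
  obtain ⟨z, h2, h3, h4⟩ := exists_wit hd hU hx hy h1
  exact h4 (h z h2 h3)

theorem Dec.ext {x y : ZFSet.{u}} (hx : x ∈ hull κ U L c b) (hy : y ∈ hull κ U L c b)
    (h : ∀ z, z < κ → (d z ∈ x ↔ d z ∈ y)) : x = y :=
  ZFSet.ext fun _ => ⟨fun h1 => hd.subset hU hx hy (fun w hw => (h w hw).1) h1,
    fun h1 => hd.subset hU hy hx (fun w hw => (h w hw).2) h1⟩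

theorem Dec.axSet : AxSet κ (str κ U L c b d e) := by
  have hM := hd.mem
  refine ⟨?_, ?_, ?_, ?_, ?_, ?_, ?_, ?_⟩
  · intro x hx y hy h
    exact (hd.d_inj hx hy).2 (hd.ext hU (hM x hx) (hM y hy) h)
  · rintro α s ⟨hα, hs, -⟩
    obtain ⟨a, ha, h⟩ := hd.mem_range hα hs
    refine ⟨a, ha, fun z hz => ?_⟩
    change d z ∈ d a ↔ _
    rw [h]
    constructor
    · rintro ⟨i, h1, h2⟩
      exact ⟨i, h1.trans hα, h1, (hd.d_inj hz (hs i)).2 h2⟩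
    · rintro ⟨i, -, h1, rfl⟩
      exact ⟨i, h1, rfl⟩
  · intro s hs h
    exact (wellFounded_iff_isEmpty_descending_chain.1 ZFSet.mem_wf).false ⟨fun n => d (s n), h⟩
  · intro ξ hξ z hz
    change d z ∈ d _ ↔ _
    rw [hd.d_o hξ, Ordinal.mem_toZFSet_iff]
    constructor
    · rintro ⟨η, h1, h2⟩
      exact ⟨η, h1.trans hξ, h1, (hd.d_inj hz (hd.o_lt (h1.trans hξ))).2
        (by rw [hd.d_o (h1.trans hξ), h2])⟩
    · rintro ⟨η, h1, h2, rfl⟩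
      exact ⟨η, h2, (hd.d_o h1).symm⟩
  · intro z hz
    change d z ∈ d _ ↔ _
    rw [hd.d_c hU, op, Ordinal.mem_toZFSet_iff]
    constructor
    · rintro ⟨η, h1, h2⟩
      exact ⟨η, h1, (hd.d_inj hz (hd.o_lt h1)).2 (by rw [hd.d_o h1, h2])⟩
    · rintro ⟨η, h1, rfl⟩
      exact ⟨η, h1, (hd.d_o h1).symm⟩
  · intro x hx y hy z hz
    change d z ∈ d _ ↔ (∀ w, w < κ → (d w ∈ d z ↔ _)) ∨ (∀ w, w < κ → (d w ∈ d z ↔ _))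
    rw [hd.d_B hU hx hy, op]
    have h1 : ∀ x, x < κ → ∀ y, y < κ → (d z = {d x, d y} ↔
        ∀ w, w < κ → (d w ∈ d z ↔ w = x ∨ w = y)) := by
      intro x hx y hy
      constructor
      · intro h w hw
        rw [h, ZFSet.mem_pair, hd.d_inj hw hx, hd.d_inj hw hy]
      · intro h
        have h2 := opEx_mem_hull hU .upair (hM x hx) (hM y hy)
        rw [opEx] at h2
        refine hd.ext hU (hM z hz) h2 fun w hw => ?_
        rw [h w hw, ZFSet.mem_pair, hd.d_inj hw hx, hd.d_inj hw hy]
    have h2 := h1 x hx x hx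
    simp only [or_self, ZFSet.pair_eq_singleton] at h2
    rw [← h2, ← h1 x hx y hy, ZFSet.pair, ZFSet.mem_pair]
  · intro f hf ξ hξ y hy h1 h2
    have h3 : ∀ y, y < κ → ((str κ U L c b d e).E ((str κ U L c b d e).B .pr
        ((str κ U L c b d e).o ξ) y) f ↔ ZFSet.pair ξ.toZFSet (d y) ∈ d f) := by
      intro y hy
      change d _ ∈ _ ↔ _
      rw [hd.d_B hU (hd.o_lt hξ) hy, op, hd.d_o hξ]
    apply h2 _ (hd.ap_lt hU hf hξ)
    rw [h3 _ (hd.ap_lt hU hf hξ), hd.d_ap hU hf hξ]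
    exact Classical.epsilon_spec (p := fun y => ZFSet.pair ξ.toZFSet y ∈ d f) ⟨_, (h3 y hy).1 h1⟩
  · intro t ht z hz
    change d z ∈ d _ ↔ _
    rw [hd.d_B hU ht ht, op, mem_fn]
    refine exists_congr fun ξ => and_congr_right fun hξ => ?_
    have h := hd.ap_lt hU ht hξ
    rw [hd.d_inj hz (hd.B_lt hU (hd.o_lt hξ) h), hd.d_B hU (hd.o_lt hξ) h, op, hd.d_o hξ,
      hd.d_ap hU ht hξ]

theorem Dec.FV_of_AE {P : Ordinal.{u} → Prop} (h : (str κ U L c b d e).AE κ P) :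
    ∀ᶠ γ in U, P γ := by
  obtain ⟨x, -, h1, h2⟩ := h
  filter_upwards [hU.lt, h1.2] with γ h3 h4
  refine h2 γ h3 ?_
  change d _ ∈ d x
  rwa [hd.d_o h3]

theorem Dec.exists_osep {P : Ordinal.{u} → Prop} (h : ∀ᶠ γ in U, P γ)
    (hP : osep κ P ∈ hull κ U L c b) : ∃ x, x < κ ∧ (str κ U L c b d e).F x ∧
      ∀ ξ, ξ < κ → ((str κ U L c b d e).E ((str κ U L c b d e).o ξ) x ↔ P ξ) := by
  obtain ⟨x, hx, h1⟩ := hd.surj hP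
  refine ⟨x, hx, ?_, fun ξ hξ => ?_⟩
  · change FV κ U (d x)
    rw [h1, FV_osep U hU]
    exact h
  · change d _ ∈ d x ↔ _
    rw [h1, hd.d_o hξ, toZFSet_mem_osep]
    exact and_iff_right hξ

theorem Dec.AE_of_osep {P : Ordinal.{u} → Prop} (h : ∀ᶠ γ in U, P γ)
    (hP : osep κ P ∈ hull κ U L c b) : (str κ U L c b d e).AE κ P := by
  obtain ⟨x, hx, h1, h2⟩ := hd.exists_osep hU h hP
  exact ⟨x, hx, h1, fun ξ hξ => (h2 ξ hξ).1⟩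

theorem Dec.ex {i : Ex} {x y : Ordinal.{u}} (hx : x < κ) (hy : y < κ) :
    opEx κ U L c i (d x) (d y) ∈ hull κ U L c b :=
  opEx_mem_hull hU i (hd.mem x hx) (hd.mem y hy)

theorem Dec.subset_κ {x : Ordinal.{u}} (hx : x < κ) (h : ∀ z, z < κ →
    (str κ U L c b d e).E z x → (str κ U L c b d e).E z ((str κ U L c b d e).c 0)) :
    d x ⊆ κ.toZFSet := by
  have h0 : d ((str κ U L c b d e).c 0) = κ.toZFSet := by rw [hd.d_c hU, op]
  rw [← h0]
  exact hd.subset hU (hd.mem x hx) (hd.mem _ (hd.c_lt hU)) h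

theorem Dec.axMeas : AxMeas κ (str κ U L c b d e) := by
  have hM := hd.mem
  have hF : ∀ x, (str κ U L c b d e).F x ↔ FV κ U (d x) := fun _ => Iff.rfl
  have h0 : d ((str κ U L c b d e).c 0) = κ.toZFSet := by rw [hd.d_c hU, op]
  have h2 : d ((str κ U L c b d e).c 2) = one := by rw [hd.d_c hU, op]
  have ha1 : ∀ t, t < κ → ∀ ξ, ξ < κ →
      ((str κ U L c b d e).ap t ξ = (str κ U L c b d e).c 2 ↔ app (d t) ξ.toZFSet = one) := by
    intro t ht ξ hξ
    rw [hd.d_inj (hd.ap_lt hU ht hξ) (hd.c_lt hU), h2, hd.d_ap hU ht hξ]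
  refine ⟨?_, ?_, ?_, ?_, ?_, ?_, ?_, ?_, ?_, ?_⟩
  · intro x hx h z hz hzx
    change d z ∈ d _
    rw [h0]
    exact h.1 hzx
  · rw [hF, h0]
    exact ⟨fun _ h => h, hU.lt.mono fun γ h => by rwa [Ordinal.toZFSet_mem_toZFSet_iff]⟩
  · intro x hx y hy h hxy hyκ
    refine ⟨hd.subset_κ hU hy hyκ, ?_⟩
    have := hd.subset hU (hM x hx) (hM y hy) hxy
    exact h.2.mono fun γ h => this h
  · rintro α s ⟨hα, hs, -⟩ hF
    obtain ⟨a, ha, h⟩ := hd.mem_range hα hs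
    have := hd.ex hU (i := .inter) ha ha
    rw [opEx] at this
    have h5 : ∀ᶠ γ : Ordinal.{u} in U, ∀ z ∈ d a, γ.toZFSet ∈ z := by
      filter_upwards [hU.complete hα (P := fun i γ => γ.toZFSet ∈ d (s i))
        fun i hi => (hF i (hi.trans hα) hi).2]
      intro γ h4 z hz
      obtain ⟨i, hi, rfl⟩ := (h z).1 hz
      exact h4 i hi
    obtain ⟨x, hx, h1, h3⟩ := hd.exists_osep hU h5 this
    refine ⟨x, hx, h1, fun ξ hξ => ?_⟩
    rw [h3 ξ hξ]
    constructor
    · rintro h4 i - hi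
      exact (hd.E_o hξ).2 (h4 _ ((h _).2 ⟨i, hi, rfl⟩))
    · intro h4 z hz
      obtain ⟨i, hi, rfl⟩ := (h z).1 hz
      exact (hd.E_o hξ).1 (h4 i (hi.trans hα) hi)
  · intro x hx h
    by_cases h1 : ∀ᶠ γ : Ordinal.{u} in U, γ.toZFSet ∈ d x
    · exact .inl ⟨hd.subset_κ hU hx h, h1⟩
    · right
      have := hd.ex hU (i := .compl) hx hx
      rw [opEx] at this
      obtain ⟨y, hy, h3, h4⟩ := hd.exists_osep hU (Ultrafilter.eventually_not.2 h1) this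
      exact ⟨y, hy, h3, fun ξ hξ => by rw [h4 ξ hξ, hd.E_o hξ]⟩
  · intro η hη
    have := hd.ex hU (i := .tail) (hd.o_lt hη) (hd.o_lt hη)
    rw [opEx] at this
    have h1 := hd.AE_of_osep hU ?_ this
    · simpa only [hd.d_o hη, Ordinal.toZFSet_mem_toZFSet_iff] using h1
    · simpa only [hd.d_o hη, Ordinal.toZFSet_mem_toZFSet_iff] using hU.gt η hη
  · intro x hx h
    obtain ⟨γ, h1, h3⟩ := (h.2.and hU.lt).exists
    exact ⟨γ, h3, (hd.E_o h3).2 h1⟩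
  · intro t ht h
    have := hd.ex hU (i := .diag) ht ht
    rw [opEx] at this
    have h3 : ∀ ξ, ξ < κ → ∀ᶠ γ : Ordinal.{u} in U, γ.toZFSet ∈ app (d t) ξ.toZFSet := fun ξ hξ => by
      have := (h ξ hξ).2
      rwa [hd.d_ap hU ht hξ] at this
    have h4 : Refl U κ (fun γ => ∀ η, η < γ → (γ ≠ κ → γ.toZFSet ∈ app (d t) η.toZFSet)) := by
      refine hU.refl_forall fun η hη => ?_
      filter_upwards [h3 η hη] with γ h5
      simp [h5]
    have h5 : ∀ᶠ γ : Ordinal.{u} in U, ∀ η, η < γ → γ.toZFSet ∈ app (d t) η.toZFSet := by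
      filter_upwards [h4.iff.2 (by simp), hU.eventually_ne] with γ h6 h7 η hη using h6 η hη h7
    obtain ⟨x, hx, h1, h6⟩ := hd.exists_osep hU h5 this
    refine ⟨x, hx, h1, fun ξ hξ => ?_⟩
    rw [h6 ξ hξ]
    constructor
    · intro h7 η hη hlt
      rw [hd.E_o hξ, hd.d_ap hU ht hη]
      exact h7 η hlt
    · intro h7 η hlt
      have := h7 η (hlt.trans hξ) hlt
      rwa [hd.E_o hξ, hd.d_ap hU ht (hlt.trans hξ)] at this
  · intro t ht
    have h3 := hd.ex hU (i := .eqv) ht (hd.c_lt hU (n := 2))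
    have h4 : osep κ (fun ξ => app (d t) ξ.toZFSet ≠ one) ∈ hull κ U L c b := by
      have := opEx_mem_hull hU .compl h3 h3
      convert this using 1
      simp only [opEx, h2]
      ext z
      rw [mem_osep, mem_osep]
      refine exists_congr fun ξ => and_congr_right fun hξ => ?_
      simp only [toZFSet_mem_osep, hξ, true_and, ne_eq]
    rw [opEx, h2] at h3
    by_cases h5 : ∀ᶠ γ : Ordinal.{u} in U, app (d t) γ.toZFSet = one
    · left
      obtain ⟨x, hx, h6, h7⟩ := hd.exists_osep hU h5 h3
      exact ⟨x, hx, h6, fun ξ hξ h => (ha1 t ht ξ hξ).2 ((h7 ξ hξ).1 h)⟩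
    · right
      obtain ⟨x, hx, h6, h7⟩ := hd.exists_osep hU (Ultrafilter.eventually_not.2 h5) h4
      exact ⟨x, hx, h6, fun ξ hξ h => (ha1 t ht ξ hξ).not.2 ((h7 ξ hξ).1 h)⟩
  · intro t ht s hs h
    have key : ∀ ξ, ξ < κ → ∀ ζ, ζ < κ → ((str κ U L c b d e).ap t ξ =
        (str κ U L c b d e).ap ((str κ U L c b d e).ap s ξ) ζ ↔
        app (d t) ξ.toZFSet = app (app (d s) ξ.toZFSet) ζ.toZFSet) := by
      intro ξ hξ ζ hζ
      rw [hd.d_inj (hd.ap_lt hU ht hξ) (hd.ap_lt hU (hd.ap_lt hU hs hξ) hζ),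
        hd.d_ap hU ht hξ, hd.d_ap hU (hd.ap_lt hU hs hξ) hζ, hd.d_ap hU hs hξ]
    have h1 := hd.FV_of_AE hU h
    have h3 : ∃ ζ, ζ < κ ∧ ∀ᶠ γ : Ordinal.{u} in U,
        app (d t) γ.toZFSet = app (app (d s) γ.toZFSet) ζ.toZFSet := by
      have : ∀ᶠ γ : Ordinal.{u} in U, ∃ ζ : Ordinal.{u}, ζ < γ ∧ app (d t) γ.toZFSet = app (app (d s) γ.toZFSet) ζ.toZFSet := by
        filter_upwards [h1, hU.lt] with γ ⟨ζ, h4, h5, h6⟩ h7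
        exact ⟨ζ, h5, (key γ h7 ζ h4).1 h6⟩
      obtain ⟨f, hf⟩ := this.choice
      obtain ⟨ζ, hζ, h4⟩ := hU.press f (hf.mono fun _ h => h.1)
      refine ⟨ζ, hζ, ?_⟩
      filter_upwards [hf, h4] with γ h5 h6
      rw [← h6]
      exact h5.2
    have h4 : pressVal κ U (d t) (d s) < κ ∧ ∀ᶠ γ : Ordinal.{u} in U, app (d t) γ.toZFSet =
        app (app (d s) γ.toZFSet) (pressVal κ U (d t) (d s)).toZFSet := Classical.epsilon_spec h3
    refine ⟨_, h4.1, ?_, ?_⟩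
    · rw [hd.d_inj (hd.B_lt hU ht hs) (hd.o_lt h4.1), hd.d_o h4.1, hd.d_B hU ht hs, op]
    · have h5 := hd.ex hU (i := .pset) ht hs
      rw [opEx] at h5
      obtain ⟨x, hx, h6, h7⟩ := hd.exists_osep hU h4.2 h5
      exact ⟨x, hx, h6, fun ξ hξ h => (key ξ hξ _ h4.1).2 ((h7 ξ hξ).1 h)⟩

end

end Univ

namespace Univ

variable {κ : Ordinal.{u}} {U : Ultrafilter Ordinal.{u}}
  {L : Ordinal.{u} → Ordinal.{u} → Ordinal.{u} → Prop}
  {c : Ordinal.{u} → Ordinal.{u} → Prop} {b : Ordinal.{u} → Prop}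
  {d : Ordinal.{u} → ZFSet.{u}} {e : ZFSet.{u} → Ordinal.{u}}

theorem op_sk {φ : Fm} {l : List ZFSet.{u}} {y w : ZFSet.{u}}
    (h : ¬ Sat (fun _ => True) (fun x y => x ∈ y) (FV κ U) φ (y :: l)) :
    ¬ Sat (fun _ => True) (fun x y => x ∈ y) (FV κ U) φ
      (op κ U L c b (.sk φ l.length) (code l) w :: l) := by
  have h1 : ∃ y, ∃ l' : List ZFSet.{u}, l'.length = l.length ∧ code l' = code l ∧
      ¬ Sat (fun _ => True) (fun x y => x ∈ y) (FV κ U) φ (y :: l') := ⟨y, l, rfl, rfl, h⟩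
  obtain ⟨l', h2, h3, h4⟩ := Classical.epsilon_spec h1
  rw [code_inj h2 h3] at h4
  exact h4

theorem op_chi {φ : Fm} {l : List ZFSet.{u}} {w : ZFSet.{u}} :
    op κ U L c b (.chi φ l.length) (code l) w = one ↔
      Sat (fun _ => True) (fun x y => x ∈ y) (FV κ U) φ l := by
  rw [op]
  constructor
  · intro h
    by_contra h1
    rw [if_neg] at h
    · exact one_ne h.symm
    · rintro ⟨l', h2, h3, h4⟩
      rw [code_inj h2 h3] at h4
      exact h1 h4
  · intro h
    rw [if_pos]
    exact ⟨l, rfl, rfl, h⟩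

section
variable (hd : Dec κ (hull κ U L c b) d e) (hU : NormalUltra κ U)

include hd hU

theorem Dec.sat {φ : Fm} {l : List Ordinal.{u}} (hl : ∀ x ∈ l, x < κ) :
    Sat (· < κ) (str κ U L c b d e).E (str κ U L c b d e).F φ l ↔
      Sat (fun _ => True) (fun x y => x ∈ y) (FV κ U) φ (l.map d) := by
  induction φ generalizing l with
  | fls => rfl
  | eq i j =>
    simp only [Sat, List.getElem?_map]
    rcases hi : l[i]? with _ | x
    · rfl
    · rcases hj : l[j]? with _ | y
      · rfl
      · exact hd.d_inj (hl _ (List.mem_of_getElem? hi)) (hl _ (List.mem_of_getElem? hj))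
  | mem i j =>
    simp only [Sat, List.getElem?_map]
    rcases l[i]? with _ | x
    · rfl
    · rcases l[j]? with _ | y <;> rfl
  | meas i =>
    simp only [Sat, List.getElem?_map]
    rcases l[i]? with _ | x <;> rfl
  | imp φ ψ h1 h2 => exact imp_congr (h1 hl) (h2 hl)
  | all φ ih =>
    have key : ∀ y, y < κ → (Sat (· < κ) (str κ U L c b d e).E (str κ U L c b d e).F φ (y :: l) ↔
        Sat (fun _ => True) (fun x y => x ∈ y) (FV κ U) φ (d y :: l.map d)) :=
      fun y hy => ih (l := y :: l) (by simpa [hy] using hl)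
    constructor
    · intro h
      by_contra h1
      simp only [Sat, true_imp_iff, not_forall] at h1
      obtain ⟨z, hz⟩ := h1
      have h2 := op_sk (L := L) (c := c) (b := b) (w := d 0) hz
      have h3 := hd.code hU hl
      obtain ⟨y, hy, h4⟩ := hd.surj (op_mem_hull hU (.sk φ (l.map d).length)
        (hd.mem _ h3.1) (hd.mem 0 hU.pos))
      rw [← h3.2, ← h4] at h2
      exact h2 ((key y hy).1 (h y hy))
    · intro h y hy
      exact (key y hy).2 (h _ trivial)

theorem Dec.axOp : AxOp κ (str κ U L c b d e) := by
  have hM := hd.mem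
  have h2 : d ((str κ U L c b d e).c 2) = one := by rw [hd.d_c hU, op]
  have ha1 : ∀ t, t < κ → ∀ ξ, ξ < κ →
      ((str κ U L c b d e).ap t ξ = (str κ U L c b d e).c 2 ↔ app (d t) ξ.toZFSet = one) := by
    intro t ht ξ hξ
    rw [hd.d_inj (hd.ap_lt hU ht hξ) (hd.c_lt hU), h2, hd.d_ap hU ht hξ]
  refine ⟨?_, ?_, ?_, ?_, ?_, ?_, ?_, ?_⟩
  · intro i t ht s hs ξ hξ
    rw [hd.d_inj (hd.ap_lt hU (hd.B_lt hU ht hs) hξ)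
      (hd.B_lt hU (hd.ap_lt hU ht hξ) (hd.ap_lt hU hs hξ)), hd.d_ap hU (hd.B_lt hU ht hs) hξ,
      hd.d_B hU ht hs, hd.d_B hU (hd.ap_lt hU ht hξ) (hd.ap_lt hU hs hξ), op, app_fn hξ,
      hd.d_ap hU ht hξ, hd.d_ap hU hs hξ]
  · intro x hx y hy ξ hξ
    rw [hd.d_inj (hd.ap_lt hU (hd.B_lt hU hx hy) hξ) hx, hd.d_ap hU (hd.B_lt hU hx hy) hξ,
      hd.d_B hU hx hy, op, app_fn hξ]
  · intro ξ hξ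
    rw [hd.d_inj (hd.ap_lt hU (hd.c_lt hU) hξ) (hd.o_lt hξ), hd.d_ap hU (hd.c_lt hU) hξ,
      hd.d_c hU, op, app_fn hξ, hd.d_o hξ]
  · intro t ht s hs
    rw [hd.d_inj (hd.B_lt hU ht hs) (hd.c_lt hU), h2, hd.d_B hU ht hs, op]
    constructor
    · intro h
      split_ifs at h with h3
      · have h4 := hd.ex hU (i := .eqv) ht (hd.c_lt hU (n := 2))
        rw [opEx, h2] at h4
        obtain ⟨x, hx, h6, h7⟩ := hd.exists_osep hU h3 h4
        exact ⟨x, hx, h6, fun ξ hξ h => (ha1 t ht ξ hξ).2 ((h7 ξ hξ).1 h)⟩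
      · exact absurd h.symm one_ne
    · intro h
      rw [if_pos]
      filter_upwards [hd.FV_of_AE hU h, hU.lt] with γ h3 h4 using (ha1 t ht γ h4).1 h3
  · intro t ht s hs ξ hξ
    change d _ ∈ d _
    rw [hd.d_ap hU ht hξ, hd.d_B hU ht hs, op, mem_img]
    exact ⟨_, Ordinal.toZFSet_mem_toZFSet_iff.2 hξ, rfl⟩
  · intro x hx y hy z hz
    change d z ∈ d _ ↔ d z ∈ d x ∧ FV κ U (d z)
    rw [hd.d_B hU hx hy, op, ZFSet.mem_sep]
  · intro φ l hl w hw
    obtain ⟨h3, h4⟩ := hd.code hU hl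
    rw [hd.d_inj (hd.B_lt hU h3 hw) (hd.c_lt hU), h2, hd.d_B hU h3 hw, h4, hd.sat hU hl,
      ← op_chi (L := L) (c := c) (b := b) (w := d w), List.length_map]
  · intro φ l hl w hw y hy h
    obtain ⟨h3, h4⟩ := hd.code hU hl
    rw [hd.sat hU (by simpa [hy] using hl)] at h
    rw [hd.sat hU (by simpa [hd.B_lt hU h3 hw] using hl), List.map_cons, hd.d_B hU h3 hw, h4,
      ← List.length_map (f := d)]
    exact op_sk h

theorem Dec.axData (hL : ∀ᶠ γ in U, ∀ ζ, ζ < γ → ∀ η, η < γ → (L γ ζ η ↔ c ζ η)) :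
    AxData κ (str κ U L c b d e) L c b := by
  have h5 : ∀ ξ, ξ < κ → ∀ η, η < κ → d ((str κ U L c b d e).ap
      ((str κ U L c b d e).ap ((str κ U L c b d e).c 5) ξ) η) = coll ξ (L ξ) η := by
    intro ξ hξ η hη
    rw [hd.d_ap hU (hd.ap_lt hU (hd.c_lt hU) hξ) hη, hd.d_ap hU (hd.c_lt hU) hξ, hd.d_c hU, op,
      app_fn hξ, app_fn hη]
  refine ⟨?_, ?_, ?_, ?_, ?_⟩
  · intro z hz
    change d z ∈ d _ ↔ _
    rw [hd.d_c hU, op, mem_osep]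
    refine exists_congr fun ξ => and_congr_right fun hξ => and_congr_right fun _ => ?_
    rw [hd.d_inj hz (hd.o_lt hξ), hd.d_o hξ]
  · intro hc η hη z hz
    have h4 : ∀ η, η < κ → d ((str κ U L c b d e).ap ((str κ U L c b d e).c 4) η) = coll κ c η := by
      intro η hη
      rw [hd.d_ap hU (hd.c_lt hU) hη, hd.d_c hU, op, app_fn hη]
    change d z ∈ d _ ↔ _
    rw [h4 η hη, hc.coll η hη]
    refine exists_congr fun ζ => and_congr_right fun hζ => and_congr_right fun _ => ?_
    rw [hd.d_inj hz (hd.ap_lt hU (hd.c_lt hU) hζ), h4 ζ hζ]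
  · intro ξ hξ hc η hη hηξ z hz
    change d z ∈ d _ ↔ _
    rw [h5 ξ hξ η hη, hc.coll η hηξ]
    constructor
    · rintro ⟨ζ, hζ, h1, h2⟩
      refine ⟨ζ, hζ.trans hξ, hζ, h1, ?_⟩
      rw [hd.d_inj hz (hd.ap_lt hU (hd.ap_lt hU (hd.c_lt hU) hξ) (hζ.trans hξ)),
        h5 ξ hξ ζ (hζ.trans hξ), h2]
    · rintro ⟨ζ, h1, hζ, h2, rfl⟩
      exact ⟨ζ, hζ, h2, h5 ξ hξ ζ h1⟩
  · intro z hz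
    change d z ∈ d _ ↔ _
    rw [hd.d_c hU, op, mem_img]
    have h6 : ∀ ξ, ξ < κ → (z = (str κ U L c b d e).B .pr ((str κ U L c b d e).o ξ)
        ((str κ U L c b d e).ap ((str κ U L c b d e).ap ((str κ U L c b d e).c 5) ξ) 0) ↔
        ZFSet.pair ξ.toZFSet (coll ξ (L ξ) 0) = d z) := by
      intro ξ hξ
      have := hd.ap_lt hU (hd.ap_lt hU (hd.c_lt hU (n := 5)) hξ) hU.pos
      rw [hd.d_inj hz (hd.B_lt hU (hd.o_lt hξ) this), hd.d_B hU (hd.o_lt hξ) this, op,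
        hd.d_o hξ, h5 ξ hξ 0 hU.pos, eq_comm]
    constructor
    · rintro ⟨_, h1, h2⟩
      obtain ⟨ξ, h3, h4, rfl⟩ := mem_osep.1 h1
      rw [Ordinal.rank_toZFSet] at h2
      exact ⟨ξ, h3, h4.1, h4.2, (h6 ξ h3).2 h2⟩
    · rintro ⟨ξ, h3, h4, h7, h8⟩
      refine ⟨ξ.toZFSet, mem_osep.2 ⟨ξ, h3, ⟨h4, h7⟩, rfl⟩, ?_⟩
      rw [Ordinal.rank_toZFSet]
      exact (h6 ξ h3).1 h8
  · have h6 := hd.ex hU (i := .guess) hU.pos hU.pos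
    rw [opEx] at h6
    obtain ⟨x, hx, h7, h8⟩ := hd.exists_osep hU (P := fun ξ => ∀ ζ < ξ, ∀ η < ξ, (L ξ ζ η ↔ c ζ η))
      hL h6
    exact ⟨x, hx, h7, fun ξ hξ h ζ _ η _ hζ hη => (h8 ξ hξ).1 h ζ hζ η hη⟩

end

theorem good (hU : NormalUltra κ U)
    (hL : ∀ᶠ γ in U, ∀ ζ, ζ < γ → ∀ η, η < γ → (L γ ζ η ↔ c ζ η)) : Good κ L c b := by
  obtain ⟨d, e, hd⟩ := exists_dec (mk_hull (L := L) (c := c) (b := b) hU)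
  exact ⟨str κ U L c b d e, hd.closed hU, hd.axSet hU, hd.axMeas hU, hd.axOp hU, hd.axData hU hL⟩

end Univ

theorem NormalUltra.good {κ : Ordinal.{u}} {U : Ultrafilter Ordinal.{u}} (hU : NormalUltra κ U)
    (c : Ordinal.{u} → Ordinal.{u} → Prop) (b : Ordinal.{u} → Prop) :
    Good κ (trunc κ laver) c b := by
  refine hU.good_laver (fun c b h => Univ.good hU ?_) c b
  filter_upwards [h, hU.lt] with γ h1 h2
  simpa [trunc, h2] using h1

/-! ### Coded structures on the type of ordinals below `κ` -/

/-- A coded structure, on the type of ordinals below `κ`. -/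
structure Cod (κ : Ordinal.{u}) where
  omega_lt : Ordinal.omega0 < κ
  E : Set.Iio κ → Set.Iio κ → Prop
  F : Set.Iio κ → Prop
  o : Set.Iio κ → Set.Iio κ
  B : Op → Set.Iio κ → Set.Iio κ → Set.Iio κ
  c : ℕ → Set.Iio κ
  ext : ∀ a b, (∀ z, E z a ↔ E z b) → a = b
  seq : ∀ (α : Ordinal.{u}) (s : Ordinal.{u} → Set.Iio κ), α < κ →
    ∃ a, ∀ z, E z a ↔ ∃ i, i < α ∧ z = s i
  wf : WellFounded E
  mem_o : ∀ ξ z, E z (o ξ) ↔ ∃ η, η < ξ ∧ z = o η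
  mem_zero : ∀ z, E z (c 0) ↔ ∃ η, z = o η
  mem_pr : ∀ a b z, E z (B .pr a b) ↔ (∀ w, E w z ↔ w = a) ∨ ∀ w, E w z ↔ w = a ∨ w = b
  ev_eq : ∀ f ξ y, E (B .pr (o ξ) y) f → (∀ y', E (B .pr (o ξ) y') f → y' = y) →
    B .ev f (o ξ) = y
  mem_graph : ∀ t z, E z (B .graph t t) ↔ ∃ ξ, z = B .pr (o ξ) (B .ev t (o ξ))
  F_sub : ∀ a, F a → ∀ z, E z a → E z (c 0)
  F_zero : F (c 0)
  F_mono : ∀ a b, F a → (∀ z, E z a → E z b) → (∀ z, E z b → E z (c 0)) → F b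
  F_seq : ∀ (α : Ordinal.{u}) (s : Ordinal.{u} → Set.Iio κ), α < κ → (∀ i, i < α → F (s i)) →
    ∃ d, F d ∧ ∀ ξ, E (o ξ) d ↔ ∀ i, i < α → E (o ξ) (s i)
  F_compl : ∀ a, (∀ z, E z a → E z (c 0)) → F a ∨ ∃ d, F d ∧ ∀ ξ, E (o ξ) d ↔ ¬ E (o ξ) a
  F_tail : ∀ η, ∃ d, F d ∧ ∀ ξ, E (o ξ) d → η < ξ
  F_ne : ∀ a, F a → ∃ ξ, E (o ξ) a
  F_diag : ∀ t, (∀ ξ, F (B .ev t (o ξ))) →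
    ∃ d, F d ∧ ∀ ξ, E (o ξ) d ↔ ∀ η, η < ξ → E (o ξ) (B .ev t (o η))
  F_dec : ∀ t, (∃ d, F d ∧ ∀ ξ, E (o ξ) d → B .ev t (o ξ) = c 2) ∨
    ∃ d, F d ∧ ∀ ξ, E (o ξ) d → B .ev t (o ξ) ≠ c 2
  F_press : ∀ t s, (∃ d, F d ∧ ∀ ξ, E (o ξ) d → ∃ ζ, ζ < ξ ∧
      B .ev t (o ξ) = B .ev (B .ev s (o ξ)) (o ζ)) →
    ∃ ζ, B .press t s = o ζ ∧ ∃ d, F d ∧ ∀ ξ, E (o ξ) d →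
      B .ev t (o ξ) = B .ev (B .ev s (o ξ)) (o ζ)
  ev_sharp : ∀ i t s ξ, B .ev (B (.sharp i) t s) (o ξ) = B i (B .ev t (o ξ)) (B .ev s (o ξ))
  ev_cnst : ∀ a b ξ, B .ev (B .cnst a b) (o ξ) = a
  ev_one : ∀ ξ, B .ev (c 1) (o ξ) = o ξ
  quant_iff : ∀ t s, B .quant t s = c 2 ↔ ∃ d, F d ∧ ∀ ξ, E (o ξ) d → B .ev t (o ξ) = c 2
  mem_cov : ∀ t s ξ, E (B .ev t (o ξ)) (B .cov t s)
  mem_amen : ∀ a b z, E z (B .amen a b) ↔ E z a ∧ F z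
  chi_iff : ∀ φ (l : List (Set.Iio κ)) w,
    B (.chi φ l.length) (l.foldr (B .pr) (c 2)) w = c 2 ↔ Sat (fun _ => True) E F φ l
  sk_spec : ∀ φ (l : List (Set.Iio κ)) w y, ¬ Sat (fun _ => True) E F φ (y :: l) →
    ¬ Sat (fun _ => True) E F φ (B (.sk φ l.length) (l.foldr (B .pr) (c 2)) w :: l)

/-- The data of the coded Laver function and parameters. -/
structure Cod.Data {κ : Ordinal.{u}} (G : Cod κ)
    (L : Ordinal.{u} → Ordinal.{u} → Ordinal.{u} → Prop)
    (c : Ordinal.{u} → Ordinal.{u} → Prop) (b : Ordinal.{u} → Prop) : Prop where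
  mem_three : ∀ z, G.E z (G.c 3) ↔ ∃ ξ : Set.Iio κ, b ξ ∧ z = G.o ξ
  mem_four : NoDesc κ c → ∀ (η : Set.Iio κ) z, G.E z (G.B .ev (G.c 4) (G.o η)) ↔
    ∃ ζ : Set.Iio κ, c ζ η ∧ z = G.B .ev (G.c 4) (G.o ζ)
  mem_five : ∀ ξ : Set.Iio κ, NoDesc ξ (L ξ) → ∀ η : Set.Iio κ, η < ξ → ∀ z,
    G.E z (G.B .ev (G.B .ev (G.c 5) (G.o ξ)) (G.o η)) ↔ ∃ ζ : Set.Iio κ, ζ < ξ ∧ L ξ ζ η ∧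
      z = G.B .ev (G.B .ev (G.c 5) (G.o ξ)) (G.o ζ)
  mem_six : ∀ (zero : Set.Iio κ), (zero : Ordinal.{u}) = 0 → ∀ z, G.E z (G.c 6) ↔
    ∃ ξ : Set.Iio κ, zero < ξ ∧ NoDesc ξ (L ξ) ∧
      z = G.B .pr (G.o ξ) (G.B .ev (G.B .ev (G.c 5) (G.o ξ)) (G.o zero))
  guess : ∃ d, G.F d ∧ ∀ ξ, G.E (G.o ξ) d → ∀ ζ : Set.Iio κ, ∀ η : Set.Iio κ, ζ < ξ → η < ξ →
    (L ξ ζ η ↔ c ζ η)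

theorem sat_subtype {κ : Ordinal.{u}} (G : Str.{u}) {φ : Fm} {l : List (Set.Iio κ)} :
    Sat (fun _ => True) (fun x y : Set.Iio κ => G.E x y) (fun x => G.F x) φ l ↔
      Sat (· < κ) G.E G.F φ (l.map Subtype.val) := by
  induction φ generalizing l with
  | fls => rfl
  | eq i j =>
    simp only [Sat, List.getElem?_map]
    rcases l[i]? with _ | x
    · rfl
    · rcases l[j]? with _ | y
      · rfl
      · exact Subtype.ext_iff
  | mem i j =>
    simp only [Sat, List.getElem?_map]
    rcases l[i]? with _ | x
    · rfl
    · rcases l[j]? with _ | y <;> rfl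
  | meas i =>
    simp only [Sat, List.getElem?_map]
    rcases l[i]? with _ | x <;> rfl
  | imp φ ψ h1 h2 => exact imp_congr h1 h2
  | all φ ih =>
    constructor
    · intro h y hy
      exact (ih (l := ⟨y, hy⟩ :: l)).1 (h ⟨y, hy⟩ trivial)
    · intro h y _
      exact (ih (l := y :: l)).2 (h y y.2)

theorem ex_Iio {κ : Ordinal.{u}} {P : Ordinal.{u} → Prop} :
    (∃ x, x < κ ∧ P x) ↔ ∃ x : Set.Iio κ, P x :=
  ⟨fun ⟨x, h, h1⟩ => ⟨⟨x, h⟩, h1⟩, fun ⟨x, h⟩ => ⟨x, x.2, h⟩⟩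

theorem all_Iio {κ : Ordinal.{u}} {P : Ordinal.{u} → Prop} :
    (∀ x, x < κ → P x) ↔ ∀ x : Set.Iio κ, P x :=
  ⟨fun h x => h x x.2, fun h x hx => h ⟨x, hx⟩⟩

theorem Good.cod {κ : Ordinal.{u}} (hω : Ordinal.omega0 < κ)
    {L : Ordinal.{u} → Ordinal.{u} → Ordinal.{u} → Prop}
    {c : Ordinal.{u} → Ordinal.{u} → Prop} {b : Ordinal.{u} → Prop} (h : Good κ L c b) :
    ∃ G : Cod κ, G.Data L c b := by
  classical
  have hκ : 0 < κ := Ordinal.omega0_pos.trans hω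
  obtain ⟨G, ⟨ho, hB⟩, hS, hM, hO, hD⟩ := h
  obtain ⟨s1, s2, s3, s4, s5, s6, s7, s8⟩ := hS
  obtain ⟨m1, m2, m3, m4, m5, m6, m7, m8, m9, m10⟩ := hM
  obtain ⟨o1, o2, o3, o4, o5, o6, o7, o8⟩ := hO
  obtain ⟨d1, d2, d3, d4, d5⟩ := hD
  have hap : ∀ t, t < κ → ∀ ξ, ξ < κ → G.ap t ξ < κ := fun t ht ξ hξ => hB _ _ ht _ (ho _ hξ)
  have hc : ∀ n, G.c n < κ := fun n => hB _ _ hκ _ hκ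
  let E : Set.Iio κ → Set.Iio κ → Prop := fun x y => G.E x y
  let F : Set.Iio κ → Prop := fun x => G.F x
  let o : Set.Iio κ → Set.Iio κ := fun x => ⟨G.o x, ho _ x.2⟩
  let B : Op → Set.Iio κ → Set.Iio κ → Set.Iio κ := fun i x y => ⟨G.B i x y, hB i _ x.2 _ y.2⟩
  let cc : ℕ → Set.Iio κ := fun n => ⟨G.c n, hc n⟩
  have hcode : ∀ l : List (Set.Iio κ), (l.foldr (B .pr) (cc 2)).1 =
      G.code (l.map Subtype.val) := by
    intro l
    induction l with
    | nil => rfl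
    | cons x l ih =>
      change G.B .pr x _ = G.B .pr x _
      rw [ih]
  let s' (α : Ordinal.{u}) (s : Ordinal.{u} → Set.Iio κ) : Ordinal.{u} → Ordinal.{u} :=
    fun i => if i < α then s i else 0
  have hs' : ∀ α s, α < κ → α < κ ∧ (∀ i, s' α s i < κ) ∧ ∀ i, α ≤ i → s' α s i = 0 := by
    intro α s hα
    refine ⟨hα, fun i => ?_, fun i hi => if_neg hi.not_gt⟩
    simp only [s']
    split_ifs
    · exact (s i).2
    · exact hκ
  have hs1 : ∀ {α s i}, i < α → s' α s i = s i := fun h => if_pos h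
  have AE_iff : ∀ P : Ordinal.{u} → Prop, G.AE κ P ↔
      ∃ d, F d ∧ ∀ ξ, E (o ξ) d → P (ξ : Set.Iio κ) := by
    intro P
    constructor
    · rintro ⟨d, h1, h2, h3⟩
      exact ⟨⟨d, h1⟩, h2, fun ξ h => h3 ξ ξ.2 h⟩
    · rintro ⟨d, h1, h2⟩
      exact ⟨d, d.2, h1, fun ξ hξ h => h2 ⟨ξ, hξ⟩ h⟩
  let G' : Cod κ := {
    omega_lt := hω
    E := E
    F := F
    o := o
    B := B
    c := cc
    ext := fun x y h => Subtype.ext (s1 x x.2 y y.2 fun z hz => h ⟨z, hz⟩)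
    seq := by
      intro α s hα
      obtain ⟨a, ha, h⟩ := s2 α (s' α s) (hs' α s hα)
      refine ⟨⟨a, ha⟩, fun z => (h z z.2).trans ⟨?_, ?_⟩⟩
      · rintro ⟨i, -, hi, h2⟩
        exact ⟨i, hi, Subtype.ext (h2.trans (hs1 hi))⟩
      · rintro ⟨i, hi, rfl⟩
        exact ⟨i, hi.trans hα, hi, (hs1 hi).symm⟩
    wf := by
      rw [wellFounded_iff_isEmpty_descending_chain]
      exact ⟨fun s => s3 (fun n => s.1 n) (fun n => (s.1 n).2) s.2⟩
    mem_o := by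
      intro ξ z
      refine (s4 ξ ξ.2 z z.2).trans (ex_Iio.trans ?_)
      simp only [Subtype.ext_iff, o, Subtype.coe_lt_coe]
    mem_zero := by
      intro z
      refine (s5 z z.2).trans (ex_Iio.trans ?_)
      simp only [Subtype.ext_iff, o]
    mem_pr := by
      intro x y z
      refine (s6 x x.2 y y.2 z z.2).trans ?_
      rw [all_Iio, all_Iio]
      simp only [Subtype.ext_iff, E]
    ev_eq := by
      intro f ξ y h1 h2
      refine Subtype.ext (s7 f f.2 ξ ξ.2 y y.2 h1 fun y' hy' h3 => ?_)
      exact congrArg Subtype.val (h2 ⟨y', hy'⟩ h3)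
    mem_graph := by
      intro t z
      refine (s8 t t.2 z z.2).trans (ex_Iio.trans ?_)
      simp only [Subtype.ext_iff, o, B]
    F_sub := fun x h z hz => m1 x x.2 h z z.2 hz
    F_zero := m2
    F_mono := fun x y h h1 h2 => m3 x x.2 y y.2 h (fun z hz => h1 ⟨z, hz⟩) fun z hz => h2 ⟨z, hz⟩
    F_seq := by
      intro α s hα h
      obtain ⟨d, hd, h1, h2⟩ := m4 α (s' α s) (hs' α s hα) fun i _ hi => by
        rw [hs1 hi]
        exact h i hi
      refine ⟨⟨d, hd⟩, h1, fun ξ => (h2 ξ ξ.2).trans ⟨fun h3 i hi => ?_, fun h3 i _ hi => ?_⟩⟩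
      · have := h3 i (hi.trans hα) hi
        rwa [hs1 hi] at this
      · rw [hs1 hi]
        exact h3 i hi
    F_compl := by
      intro x h
      refine (m5 x x.2 fun z hz => h ⟨z, hz⟩).imp_right ?_
      rintro ⟨d, h1, h2, h3⟩
      exact ⟨⟨d, h1⟩, h2, fun ξ => h3 ξ ξ.2⟩
    F_tail := fun η => (AE_iff _).1 (m6 η η.2)
    F_ne := by
      intro x h
      obtain ⟨ξ, h1, h2⟩ := m7 x x.2 h
      exact ⟨⟨ξ, h1⟩, h2⟩
    F_diag := by
      intro t ht
      obtain ⟨d, h1, h2, h3⟩ := m8 t t.2 fun ξ hξ => ht ⟨ξ, hξ⟩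
      refine ⟨⟨d, h1⟩, h2, fun ξ => (h3 ξ ξ.2).trans ?_⟩
      rw [all_Iio]
      rfl
    F_dec := by
      intro t
      refine (m9 t t.2).imp (fun h => ?_) fun h => ?_
      · obtain ⟨d, h1, h2⟩ := (AE_iff _).1 h
        exact ⟨d, h1, fun ξ h => Subtype.ext (h2 ξ h)⟩
      · obtain ⟨d, h1, h2⟩ := (AE_iff _).1 h
        exact ⟨d, h1, fun ξ h h3 => h2 ξ h (congrArg Subtype.val h3)⟩
    F_press := by
      rintro t s ⟨d, h1, h2⟩
      obtain ⟨ζ, hζ, h3, h4⟩ := m10 t t.2 s s.2 ((AE_iff _).2 ⟨d, h1, fun ξ h => by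
        obtain ⟨ζ, h3, h4⟩ := h2 ξ h
        exact ⟨ζ, ζ.2, h3, congrArg Subtype.val h4⟩⟩)
      refine ⟨⟨ζ, hζ⟩, Subtype.ext h3, ?_⟩
      obtain ⟨d, h5, h6⟩ := (AE_iff _).1 h4
      exact ⟨d, h5, fun ξ h => Subtype.ext (h6 ξ h)⟩
    ev_sharp := fun i t s ξ => Subtype.ext (o1 i t t.2 s s.2 ξ ξ.2)
    ev_cnst := fun x y ξ => Subtype.ext (o2 x x.2 y y.2 ξ ξ.2)
    ev_one := fun ξ => Subtype.ext (o3 ξ ξ.2)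
    quant_iff := by
      intro t s
      refine Subtype.ext_iff.trans ((o4 t t.2 s s.2).trans ((AE_iff _).trans ?_))
      simp only [Subtype.ext_iff, B, cc, o]
    mem_cov := fun t s ξ => o5 t t.2 s s.2 ξ ξ.2
    mem_amen := fun x y z => o6 x x.2 y y.2 z z.2
    chi_iff := by
      intro φ l w
      have := o7 φ (l.map Subtype.val) (fun x hx => by
        obtain ⟨y, -, rfl⟩ := List.mem_map.1 hx
        exact y.2) w w.2
      rw [← sat_subtype, List.length_map, ← hcode] at this
      exact Subtype.ext_iff.trans this
    sk_spec := by
      intro φ l w y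
      have := o8 φ (l.map Subtype.val) (fun x hx => by
        obtain ⟨y, -, rfl⟩ := List.mem_map.1 hx
        exact y.2) w w.2 y y.2
      rw [← List.map_cons, ← sat_subtype, List.length_map, ← hcode] at this
      intro h h1
      exact this h (sat_subtype G (l := B (.sk φ l.length) (l.foldr (B .pr) (cc 2)) w :: l) |>.1 h1) }
  refine ⟨G', ?_, ?_, ?_, ?_, ?_⟩
  · intro z
    refine (d1 z z.2).trans (ex_Iio.trans ?_)
    simp only [Subtype.ext_iff, G', o]
  · intro h η z
    refine (d2 h η η.2 z z.2).trans (ex_Iio.trans ?_)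
    simp only [Subtype.ext_iff, G', o, B, cc]
  · intro ξ h η hη z
    refine (d3 ξ ξ.2 h η η.2 hη z z.2).trans (ex_Iio.trans ?_)
    simp only [Subtype.ext_iff, G', o, B, cc, Subtype.coe_lt_coe]
  · intro zero h0 z
    refine (d4 z z.2).trans (ex_Iio.trans ?_)
    simp only [Subtype.ext_iff, G', o, B, cc, ← Subtype.coe_lt_coe, h0]
  · obtain ⟨d, h1, h2⟩ := (AE_iff _).1 d5
    exact ⟨d, h1, fun ξ h ζ η hζ hη => h2 ξ h ζ ζ.2 η η.2 hζ hη⟩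

namespace Cod

variable {κ : Ordinal.{u}} (G : Cod κ)

/-! ### The filters -/

theorem and_F {a b : Set.Iio κ} (ha : G.F a) (hb : G.F b) :
    ∃ d, G.F d ∧ ∀ ξ, G.E (G.o ξ) d ↔ G.E (G.o ξ) a ∧ G.E (G.o ξ) b := by
  obtain ⟨d, h1, h2⟩ := G.F_seq 2 (fun i => if i = 0 then a else b)
    ((Ordinal.natCast_lt_omega0 2).trans G.omega_lt) (fun i _ => by split_ifs <;> assumption)
  refine ⟨d, h1, fun ξ => (h2 ξ).trans ⟨fun h => ⟨?_, ?_⟩, fun h i _ => ?_⟩⟩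
  · simpa using h 0 (by norm_num)
  · simpa using h 1 (by norm_num)
  · split_ifs
    exacts [h.1, h.2]

/-- The filter generated by the measure. -/
def fil : Filter (Set.Iio κ) where
  sets := {P | ∃ d, G.F d ∧ ∀ ξ, G.E (G.o ξ) d → ξ ∈ P}
  univ_sets := ⟨_, G.F_zero, fun _ _ => trivial⟩
  sets_of_superset := fun ⟨d, h1, h2⟩ h => ⟨d, h1, fun ξ h3 => h (h2 ξ h3)⟩
  inter_sets := by
    rintro P Q ⟨a, ha, h1⟩ ⟨b, hb, h2⟩
    obtain ⟨d, hd, h3⟩ := G.and_F ha hb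
    exact ⟨d, hd, fun ξ h => ⟨h1 _ ((h3 ξ).1 h).1, h2 _ ((h3 ξ).1 h).2⟩⟩

theorem eventually_fil {P : Set.Iio κ → Prop} :
    (∀ᶠ ξ in G.fil, P ξ) ↔ ∃ d, G.F d ∧ ∀ ξ, G.E (G.o ξ) d → P ξ := Iff.rfl

instance : G.fil.NeBot := by
  refine Filter.neBot_iff.2 fun h => ?_
  obtain ⟨d, h1, h2⟩ := Filter.empty_mem_iff_bot.2 h
  obtain ⟨ξ, h3⟩ := G.F_ne d h1
  exact h2 ξ h3

instance : CountableInterFilter G.fil where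
  countable_sInter_mem := by
    intro 𝓢 h𝓢 h
    rcases 𝓢.eq_empty_or_nonempty with rfl | hne
    · rw [Set.sInter_empty]
      exact Filter.univ_mem
    obtain ⟨f, rfl⟩ := h𝓢.exists_eq_range hne
    choose d h1 h2 using fun n => h (f n) ⟨n, rfl⟩
    obtain ⟨a, ha, h3⟩ := G.F_seq Ordinal.omega0
      (fun i => d (Function.invFun (Nat.cast : ℕ → Ordinal.{u}) i)) G.omega_lt fun i _ => h1 _
    refine ⟨a, ha, fun ξ hξ => ?_⟩
    rintro _ ⟨n, rfl⟩
    have := (h3 ξ).1 hξ n (Ordinal.natCast_lt_omega0 n)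
    rw [Function.leftInverse_invFun Nat.cast_injective n] at this
    exact h2 n ξ this

theorem eventually_lt (η : Set.Iio κ) : ∀ᶠ ξ in G.fil, η < ξ := G.F_tail η

theorem eventually_mem {a : Set.Iio κ} (h : G.F a) : ∀ᶠ ξ in G.fil, G.E (G.o ξ) a :=
  ⟨a, h, fun _ h => h⟩

theorem mem_zero_o (ξ) : G.E (G.o ξ) (G.c 0) := (G.mem_zero _).2 ⟨ξ, rfl⟩

theorem F_iff {a : Set.Iio κ} :
    G.F a ↔ (∀ z, G.E z a → G.E z (G.c 0)) ∧ ∀ᶠ ξ in G.fil, G.E (G.o ξ) a := by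
  refine ⟨fun h => ⟨G.F_sub a h, G.eventually_mem h⟩, ?_⟩
  rintro ⟨h1, d, hd, h2⟩
  refine G.F_mono d a hd (fun z hz => ?_) h1
  obtain ⟨ξ, rfl⟩ := (G.mem_zero z).1 (G.F_sub d hd z hz)
  exact h2 ξ hz

/-- The generic filter on sequences of ordinals. -/
def gen : Filter (Ordinal.{u} → Set.Iio κ) where
  sets := {P | ∃ S : Ordinal.{u} → (Ordinal.{u} → Set.Iio κ) → Set (Set.Iio κ),
    (∀ i x, S i x ∈ G.fil) ∧ (∀ i x y, (∀ k < i, x k = y k) → S i x = S i y) ∧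
      ∀ x, (∀ i, x i ∈ S i x) → x ∈ P}
  univ_sets := ⟨fun _ _ => Set.univ, fun _ _ => Filter.univ_mem, fun _ _ _ _ => rfl,
    fun _ _ => trivial⟩
  sets_of_superset := by
    rintro P Q ⟨S, h1, h2, h3⟩ h
    exact ⟨S, h1, h2, fun x h4 => h (h3 x h4)⟩
  inter_sets := by
    rintro P Q ⟨S, h1, h2, h3⟩ ⟨T, h4, h5, h6⟩
    refine ⟨fun i x => S i x ∩ T i x, fun i x => Filter.inter_mem (h1 i x) (h4 i x),
      fun i x y h => ?_, fun x h => ⟨h3 x fun i => (h i).1, h6 x fun i => (h i).2⟩⟩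
    dsimp only
    rw [h2 i x y h, h5 i x y h]

instance : CountableInterFilter G.gen where
  countable_sInter_mem := by
    intro 𝓢 h𝓢 h
    have := h𝓢.to_subtype
    choose S h1 h2 h3 using fun P : 𝓢 => h P P.2
    refine ⟨fun i x => ⋂ P, S P i x, fun i x => countable_iInter_mem.2 fun P => h1 P i x,
      fun i x y hxy => Set.iInter_congr fun P => h2 P i x y hxy, fun x hx P hP => ?_⟩
    exact h3 ⟨P, hP⟩ x fun i => Set.mem_iInter.1 (hx i) ⟨P, hP⟩

theorem pos (G : Cod κ) : 0 < κ := Ordinal.omega0_pos.trans G.omega_lt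

instance : G.gen.NeBot := by
  classical
  refine Filter.neBot_iff.2 fun h => ?_
  obtain ⟨S, h1, h2, h3⟩ := Filter.empty_mem_iff_bot.2 h
  have hne : ∀ i x, (S i x).Nonempty := fun i x => Filter.nonempty_of_mem (h1 i x)
  let step : (i : Ordinal.{u}) → ((k : Ordinal.{u}) → k < i → Set.Iio κ) → Set.Iio κ :=
    fun i r => (hne i fun k => if h : k < i then r k h else ⟨0, G.pos⟩).some
  let x : Ordinal.{u} → Set.Iio κ := (Ordinal.lt_wf).fix step
  refine h3 x fun i => ?_
  have h4 : x i = step i fun k _ => x k := (Ordinal.lt_wf).fix_eq step i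
  rw [h4]
  rw [h2 i x (fun k => if h : k < i then x k else ⟨0, G.pos⟩) (fun k hk => by simp [hk])]
  exact (hne i fun k => if h : k < i then x k else ⟨0, G.pos⟩).some_mem

theorem gen_at (i : Ordinal.{u}) {R : (Ordinal.{u} → Set.Iio κ) → Set.Iio κ → Prop}
    (hR : ∀ x y, (∀ k < i, x k = y k) → R x = R y) :
    ∀ᶠ x in G.gen, (∀ᶠ ξ in G.fil, R x ξ) → R x (x i) := by
  classical
  refine ⟨fun k x => if k = i then {ξ | (∀ᶠ ξ in G.fil, R x ξ) → R x ξ} else Set.univ, fun k x => ?_,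
    fun k x y h => ?_, fun x h => ?_⟩
  · dsimp only
    split_ifs
    · by_cases h : ∀ᶠ ξ in G.fil, R x ξ
      · filter_upwards [h] with ξ hξ _ using hξ
      · exact Filter.Eventually.of_forall fun _ h' => (h h').elim
    · exact Filter.univ_mem
  · dsimp only
    split_ifs with hk
    · subst hk
      rw [hR x y h]
    · rfl
  · have := h i
    simpa using this

end Cod

namespace Cod

variable {κ : Ordinal.{u}} (G : Cod κ)

/-! ### Terms -/

/-- The value of the coded function `t` at the ordinal `ξ`. -/
abbrev ap (t ξ : Set.Iio κ) : Set.Iio κ := G.B .ev t (G.o ξ)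

/-- The functions in the `i`-th iterated ultrapower. -/
inductive Int : Ordinal.{u} → ((Ordinal.{u} → Set.Iio κ) → Set.Iio κ) → Prop
  | const (i : Ordinal.{u}) (a : Set.Iio κ) : Int i fun _ => a
  | step (i k : Ordinal.{u}) (g : (Ordinal.{u} → Set.Iio κ) → Set.Iio κ) (hk : k < i) (hg : Int k g) :
    Int i fun x => G.ap (g x) (x k)

variable {G}

theorem Int.mono {i j : Ordinal.{u}} {f} (h : G.Int i f) (hij : i ≤ j) : G.Int j f := by
  cases h with
  | const _ a => exact .const j a
  | step _ k g hk hg => exact .step j k g (hk.trans_le hij) hg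

theorem Int.congr {i : Ordinal.{u}} {f} (h : G.Int i f) {x y : Ordinal.{u} → Set.Iio κ}
    (hxy : ∀ k < i, x k = y k) : f x = f y := by
  induction h with
  | const => rfl
  | step i k g hk hg ih =>
    dsimp only
    rw [ih fun l hl => hxy l (hl.trans hk), hxy k hk]

theorem Int.rep_aux {i : Ordinal.{u}}
    (ih : ∀ k < i, ∀ b f g, G.Int k f → G.Int k g → G.Int k fun x => G.B b (f x) (g x))
    {k : Ordinal.{u}} {f} (hk : k < i) (hf : (∃ a, f = fun _ => a) ∨ ∃ l ≤ k, ∃ f', G.Int l f' ∧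
      f = fun x => G.ap (f' x) (x l)) :
    ∃ f', G.Int k f' ∧ f = fun x => G.ap (f' x) (x k) := by
  rcases hf with ⟨a, rfl⟩ | ⟨l, hl, f', h, rfl⟩
  · exact ⟨_, .const k (G.B .cnst a a), funext fun x => (G.ev_cnst a a _).symm⟩
  · rcases hl.eq_or_lt with rfl | hl
    · exact ⟨f', h, rfl⟩
    · exact ⟨_, ih k hk .cnst _ _ (.step k l f' hl h) (.step k l f' hl h),
        funext fun x => (G.ev_cnst _ _ _).symm⟩

theorem Int.cases' {i : Ordinal.{u}} {f} (h : G.Int i f) : (∃ a, f = fun _ => a) ∨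
    ∃ k < i, ∃ f', G.Int k f' ∧ f = fun x => G.ap (f' x) (x k) := by
  cases h with
  | const _ a => exact .inl ⟨a, rfl⟩
  | step _ k g hk hg => exact .inr ⟨k, hk, g, hg, rfl⟩

theorem Int.op {i : Ordinal.{u}} (b : Op) {f g} (hf : G.Int i f) (hg : G.Int i g) :
    G.Int i fun x => G.B b (f x) (g x) := by
  induction i using WellFoundedLT.induction generalizing b f g with
  | ind i ih =>
    have key : ∀ k < i, ((∃ a, f = fun _ => a) ∨ ∃ l ≤ k, ∃ f', G.Int l f' ∧
        f = fun x => G.ap (f' x) (x l)) → ((∃ a, g = fun _ => a) ∨ ∃ l ≤ k, ∃ f', G.Int l f' ∧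
        g = fun x => G.ap (f' x) (x l)) → G.Int i fun x => G.B b (f x) (g x) := by
      intro k hk h1 h2
      obtain ⟨f', hf', rfl⟩ := Int.rep_aux (fun k hk b f g => ih k hk b) hk h1
      obtain ⟨g', hg', rfl⟩ := Int.rep_aux (fun k hk b f g => ih k hk b) hk h2
      have := Int.step i k _ hk (ih k hk (.sharp b) hf' hg')
      simpa only [ap, G.ev_sharp] using this
    rcases hf.cases' with ⟨a, rfl⟩ | ⟨k, hk, f', hf', rfl⟩
    · rcases hg.cases' with ⟨b', rfl⟩ | ⟨l, hl, g', hg', rfl⟩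
      · exact .const i _
      · exact key l hl (.inl ⟨a, rfl⟩) (.inr ⟨l, le_rfl, g', hg', rfl⟩)
    · rcases hg.cases' with ⟨b', rfl⟩ | ⟨l, hl, g', hg', rfl⟩
      · exact key k hk (.inr ⟨k, le_rfl, f', hf', rfl⟩) (.inl ⟨b', rfl⟩)
      · exact key (max k l) (max_lt hk hl) (.inr ⟨k, le_max_left _ _, f', hf', rfl⟩)
          (.inr ⟨l, le_max_right _ _, g', hg', rfl⟩)

theorem Int.rep {i k : Ordinal.{u}} {f} (hf : G.Int i f) (hi : i ≤ k + 1) :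
    ∃ f', G.Int k f' ∧ f = fun x => G.ap (f' x) (x k) := by
  refine Int.rep_aux (i := k + 1) (fun k _ b f g => Int.op b) (Order.lt_add_one_iff.2 le_rfl) ?_
  refine hf.cases'.imp_right ?_
  rintro ⟨l, hl, h⟩
  exact ⟨l, Order.lt_add_one_iff.1 (hl.trans_le hi), h⟩

theorem Int.coord {i k : Ordinal.{u}} (hk : k < i) : G.Int i fun x => G.o (x k) := by
  have := Int.step (G := G) i k _ hk (.const k (G.c 1))
  simpa only [ap, G.ev_one] using this

theorem Int.code {i : Ordinal.{u}} {l : List ((Ordinal.{u} → Set.Iio κ) → Set.Iio κ)}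
    (hl : ∀ f ∈ l, G.Int i f) :
    G.Int i fun x => (l.map (· x)).foldr (G.B .pr) (G.c 2) := by
  induction l with
  | nil => exact .const i _
  | cons f l ih =>
    exact Int.op .pr (hl f (by simp)) (ih fun g hg => hl g (by simp [hg]))

instance small_Int (i : Ordinal.{u}) : Small.{u} {f // G.Int i f} := by
  induction i using WellFoundedLT.induction with
  | ind i ih =>
    have : {f | G.Int i f} ⊆ Set.range (fun (a : Set.Iio κ) (_ : Ordinal.{u} → Set.Iio κ) => a) ∪
        ⋃ k : Set.Iio i, Set.range (fun (f : {f // G.Int (k : Ordinal.{u}) f})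
          (x : Ordinal.{u} → Set.Iio κ) => G.ap (f.1 x) (x k)) := by
      intro f hf
      rcases Int.cases' hf with ⟨a, rfl⟩ | ⟨k, hk, f', hf', rfl⟩
      · exact .inl ⟨a, rfl⟩
      · exact .inr (Set.mem_iUnion.2 ⟨⟨k, hk⟩, ⟨f', hf'⟩, rfl⟩)
    have h2 : ∀ k : Set.Iio i, Small.{u} {f // G.Int (k : Ordinal.{u}) f} := fun k => ih k k.2
    exact small_subset this

/-! ### Decidedness -/

variable (G) in
/-- Satisfaction in the coded structure. -/
abbrev S (φ : Fm) (l : List (Set.Iio κ)) : Prop := Sat (fun _ => True) G.E G.F φ l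

theorem Int.decided {i : Ordinal.{u}} {f} (hf : G.Int i f) :
    (∀ᶠ x in G.gen, f x = G.c 2) ∨ ∀ᶠ x in G.gen, f x ≠ G.c 2 := by
  induction i using WellFoundedLT.induction generalizing f with
  | ind i ih =>
  rcases hf.cases' with ⟨a, rfl⟩ | ⟨k, hk, g, hg, rfl⟩
  · by_cases h : a = G.c 2
    · exact .inl (.of_forall fun _ => h)
    · exact .inr (.of_forall fun _ => h)
  · have hq := ih k hk (Int.op .quant hg hg)
    have h1 := G.gen_at k (R := fun x ξ => G.ap (g x) ξ = G.c 2) fun x y h => by rw [hg.congr h]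
    have h2 := G.gen_at k (R := fun x ξ => G.ap (g x) ξ ≠ G.c 2) fun x y h => by rw [hg.congr h]
    rcases hq with h | h
    · left
      filter_upwards [h, h1] with x h3 h4
      exact h4 ((G.quant_iff _ _).1 h3)
    · right
      filter_upwards [h, h2] with x h3 h4
      exact h4 ((G.F_dec (g x)).resolve_left fun h5 => h3 ((G.quant_iff _ _).2 h5))

theorem Int.sat_decided {i : Ordinal.{u}} {l : List ((Ordinal.{u} → Set.Iio κ) → Set.Iio κ)}
    (hl : ∀ f ∈ l, G.Int i f) (φ : Fm) :
    (∀ᶠ x in G.gen, G.S φ (l.map (· x))) ∨ ∀ᶠ x in G.gen, ¬ G.S φ (l.map (· x)) := by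
  have h (x : Ordinal.{u} → Set.Iio κ) := G.chi_iff φ (l.map (· x)) (G.c 2)
  simp only [List.length_map] at h
  simp only [S, ← h]
  exact (Int.op (.chi φ l.length) (Int.code hl) (.const i (G.c 2))).decided

theorem Int.sk {i : Ordinal.{u}} {l : List ((Ordinal.{u} → Set.Iio κ) → Set.Iio κ)}
    (hl : ∀ f ∈ l, G.Int i f) (φ : Fm) : ∃ s, G.Int i s ∧ ∀ x,
      ¬ G.S (.all φ) (l.map (· x)) → ¬ G.S φ (s x :: l.map (· x)) := by
  refine ⟨_, Int.op (.sk φ l.length) (Int.code hl) (.const i (G.c 2)), fun x h => ?_⟩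
  simp only [Sat, not_forall] at h
  obtain ⟨y, -, h⟩ := h
  have := G.sk_spec φ (l.map (· x)) (G.c 2) y h
  rwa [List.length_map] at this

end Cod

/-! ### Derived connectives -/

namespace Fm

/-- Negation. -/
def not (φ : Fm) : Fm := .imp φ .fls
/-- Conjunction. -/
def and (φ ψ : Fm) : Fm := .not (.imp φ (.not ψ))
/-- Disjunction. -/
def or (φ ψ : Fm) : Fm := .imp (.not φ) ψ
/-- Equivalence. -/
def iff (φ ψ : Fm) : Fm := .and (.imp φ ψ) (.imp ψ φ)
/-- Existential quantification. -/
def ex (φ : Fm) : Fm := .not (.all (.not φ))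

end Fm

section

variable {X : Type*} {D : X → Prop} {E : X → X → Prop} {F : X → Prop} {φ ψ : Fm} {l : List X}

@[simp] theorem sat_fls : Sat D E F .fls l ↔ False := Iff.rfl
@[simp] theorem sat_imp : Sat D E F (.imp φ ψ) l ↔ (Sat D E F φ l → Sat D E F ψ l) := Iff.rfl
@[simp] theorem sat_all : Sat D E F (.all φ) l ↔ ∀ y, D y → Sat D E F φ (y :: l) := Iff.rfl
@[simp] theorem sat_not : Sat D E F (.not φ) l ↔ ¬ Sat D E F φ l := Iff.rfl
@[simp] theorem sat_and : Sat D E F (.and φ ψ) l ↔ Sat D E F φ l ∧ Sat D E F ψ l := by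
  simp [Fm.and]
@[simp] theorem sat_or : Sat D E F (.or φ ψ) l ↔ Sat D E F φ l ∨ Sat D E F ψ l := by
  simp [Fm.or, or_iff_not_imp_left]
@[simp] theorem sat_iff : Sat D E F (.iff φ ψ) l ↔ (Sat D E F φ l ↔ Sat D E F ψ l) := by
  simp [Fm.iff, iff_def]
@[simp] theorem sat_ex : Sat D E F (.ex φ) l ↔ ∃ y, D y ∧ Sat D E F φ (y :: l) := by
  simp [Fm.ex]
@[simp] theorem optRel_some {R : X → X → Prop} {a b : X} :
    OptRel R (some a) (some b) ↔ R a b := Iff.rfl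
@[simp] theorem sat_eq {i j : ℕ} : Sat D E F (.eq i j) l ↔ OptRel (· = ·) l[i]? l[j]? := Iff.rfl
@[simp] theorem sat_mem {i j : ℕ} : Sat D E F (.mem i j) l ↔ OptRel E l[i]? l[j]? := Iff.rfl
@[simp] theorem sat_meas {i : ℕ} :
    Sat D E F (.meas i) l ↔ OptRel (fun a _ => F a) l[i]? l[i]? := Iff.rfl

end

namespace Cod

variable {κ : Ordinal.{u}} {G : Cod κ}

/-! ### The models -/

variable (G) in
/-- Membership in the iterated ultrapowers. -/
def prec (f g : (Ordinal.{u} → Set.Iio κ) → Set.Iio κ) : Prop := ∀ᶠ x in G.gen, G.E (f x) (g x)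

variable (G) in
theorem prec_wf : WellFounded G.prec := by
  rw [wellFounded_iff_isEmpty_descending_chain]
  refine ⟨fun s => ?_⟩
  obtain ⟨x, hx⟩ := (eventually_countable_forall.2 s.2).exists
  have h := wellFounded_iff_isEmpty_descending_chain.1 G.wf
  exact h.false ⟨fun n => s.1 n x, hx⟩

instance small_prec (i : Ordinal.{u}) (f : (Ordinal.{u} → Set.Iio κ) → Set.Iio κ) :
    Small.{u} {g // G.Int i g ∧ G.prec g f} :=
  small_of_injective (β := {g // G.Int i g}) (f := fun g => ⟨g.1, g.2.1⟩) fun _ _ h =>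
    Subtype.ext (congrArg (fun z : {g // G.Int i g} => z.1) h)

@[simp] theorem gen_ne_bot : G.gen ≠ ⊥ := Filter.NeBot.ne inferInstance

variable (G) in
/-- The transitive collapse. -/
noncomputable def proj (i : Ordinal.{u}) : ((Ordinal.{u} → Set.Iio κ) → Set.Iio κ) → ZFSet.{u} :=
  G.prec_wf.fix fun f ih =>
    ZFSet.range fun g : {g // G.Int i g ∧ G.prec g f} => ih g.1 g.2.2

theorem mem_proj {i : Ordinal.{u}} {f} {z : ZFSet.{u}} :
    z ∈ G.proj i f ↔ ∃ g, G.Int i g ∧ G.prec g f ∧ z = G.proj i g := by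
  rw [proj, G.prec_wf.fix_eq, ZFSet.mem_range]
  constructor
  · rintro ⟨⟨g, h1, h2⟩, rfl⟩
    exact ⟨g, h1, h2, rfl⟩
  · rintro ⟨g, h1, h2, rfl⟩
    exact ⟨⟨g, h1, h2⟩, rfl⟩

theorem proj_congr {i : Ordinal.{u}} {f g} (h : ∀ᶠ x in G.gen, f x = g x) :
    G.proj i f = G.proj i g := by
  ext z
  simp only [mem_proj]
  refine exists_congr fun t => and_congr_right fun _ => and_congr_left fun _ => ?_
  exact Filter.eventually_congr (h.mono fun x hx => by rw [hx])

theorem Int.prec_decided {i : Ordinal.{u}} {f g} (hf : G.Int i f) (hg : G.Int i g) :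
    G.prec f g ∨ ∀ᶠ x in G.gen, ¬ G.E (f x) (g x) := by
  simpa [prec] using Int.sat_decided (i := i) (l := [f, g]) (by simp [hf, hg]) (.mem 0 1)

theorem proj_inj {i : Ordinal.{u}} {f g} (hf : G.Int i f) (hg : G.Int i g)
    (h : G.proj i f = G.proj i g) : ∀ᶠ x in G.gen, f x = g x := by
  induction f using G.prec_wf.induction generalizing g with
  | _ f ih =>
  have hl : ∀ t ∈ [f, g], G.Int i t := by simp [hf, hg]
  have hd := Int.sat_decided hl (.eq 0 1)
  simp at hd
  refine hd.resolve_right fun hne => ?_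
  obtain ⟨s, hs, h1⟩ := Int.sk hl (.iff (.mem 0 1) (.mem 0 2))
  simp at h1
  have h2 : ∀ᶠ x in G.gen, ¬ (G.E (s x) (f x) ↔ G.E (s x) (g x)) := by
    filter_upwards [hne] with x hx h3
    have : ∃ y, ¬ (G.E y (f x) ↔ G.E y (g x)) := by
      by_contra! h4
      exact hx (G.ext _ _ h4)
    obtain ⟨y, hy⟩ := this
    exact h1 x y y.2 hy h3
  rcases hs.prec_decided hf with h3 | h3
  · have h4 : G.proj i s ∈ G.proj i g := h ▸ mem_proj.2 ⟨s, hs, h3, rfl⟩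
    obtain ⟨t, ht, h5, h6⟩ := mem_proj.1 h4
    obtain ⟨x, h7, h8, h9, h10⟩ := (h2.and (h3.and (h5.and (ih s h3 hs ht h6)))).exists
    rw [← h10] at h9
    exact h7 ⟨fun _ => h9, fun _ => h8⟩
  · have h4 : G.prec s g := by
      filter_upwards [h2, h3] with x h5 h6
      tauto
    have h5 : G.proj i s ∈ G.proj i f := h ▸ mem_proj.2 ⟨s, hs, h4, rfl⟩
    obtain ⟨t, ht, h6, h7⟩ := mem_proj.1 h5
    obtain ⟨x, h8, h9, h10⟩ := (h6.and (h3.and (ih t h6 ht hs h7.symm))).exists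
    rw [h10] at h8
    exact h9 h8

theorem proj_eq_iff {i : Ordinal.{u}} {f g} (hf : G.Int i f) (hg : G.Int i g) :
    G.proj i f = G.proj i g ↔ ∀ᶠ x in G.gen, f x = g x :=
  ⟨proj_inj hf hg, proj_congr⟩

theorem proj_mem_iff {i : Ordinal.{u}} {f g} (hf : G.Int i f) :
    G.proj i f ∈ G.proj i g ↔ ∀ᶠ x in G.gen, G.E (f x) (g x) := by
  rw [mem_proj]
  constructor
  · rintro ⟨t, ht, h1, h2⟩
    filter_upwards [h1, proj_inj hf ht h2] with x h3 h4
    rwa [h4]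
  · exact fun h => ⟨f, hf, h, rfl⟩

variable (G) in
/-- The `i`-th iterated ultrapower. -/
noncomputable def mod (i : Ordinal.{u}) : ZFSet.{u} := ZFSet.range fun f : {f // G.Int i f} => G.proj i f

theorem mem_mod {i : Ordinal.{u}} {z : ZFSet.{u}} : z ∈ G.mod i ↔ ∃ f, G.Int i f ∧ G.proj i f = z := by
  rw [mod, ZFSet.mem_range]
  exact ⟨fun ⟨f, h⟩ => ⟨f.1, f.2, h⟩, fun ⟨f, h1, h2⟩ => ⟨⟨f, h1⟩, h2⟩⟩

theorem Int.mem_mod {i : Ordinal.{u}} {f} (hf : G.Int i f) : G.proj i f ∈ G.mod i :=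
  Cod.mem_mod.2 ⟨f, hf, rfl⟩

theorem mod_trans {i : Ordinal.{u}} {y z : ZFSet.{u}} (hz : z ∈ G.mod i) (hy : y ∈ z) : y ∈ G.mod i := by
  obtain ⟨f, hf, rfl⟩ := Cod.mem_mod.1 hz
  obtain ⟨g, hg, -, rfl⟩ := mem_proj.1 hy
  exact hg.mem_mod

variable (G) in
/-- The measure of the `i`-th iterated ultrapower. -/
noncomputable def meas (i : Ordinal.{u}) : ZFSet.{u} :=
  ZFSet.sep (fun z => ∀ f, G.Int i f → G.proj i f = z → ∀ᶠ x in G.gen, G.F (f x)) (G.mod i)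

theorem proj_mem_meas {i : Ordinal.{u}} {f} (hf : G.Int i f) :
    G.proj i f ∈ G.meas i ↔ ∀ᶠ x in G.gen, G.F (f x) := by
  rw [meas, ZFSet.mem_sep]
  refine ⟨fun h => h.2 f hf rfl, fun h => ⟨hf.mem_mod, fun g hg h1 => ?_⟩⟩
  filter_upwards [h, proj_inj hg hf h1] with x h2 h3
  rwa [h3]

theorem mem_meas {i : Ordinal.{u}} {z : ZFSet.{u}} :
    z ∈ G.meas i ↔ ∃ f, G.Int i f ∧ (∀ᶠ x in G.gen, G.F (f x)) ∧ G.proj i f = z := by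
  constructor
  · intro h
    obtain ⟨f, hf, rfl⟩ := Cod.mem_mod.1 (ZFSet.mem_sep.1 h).1
    exact ⟨f, hf, (proj_mem_meas hf).1 h, rfl⟩
  · rintro ⟨f, hf, h, rfl⟩
    exact (proj_mem_meas hf).2 h

theorem los {i : Ordinal.{u}} {φ : Fm} {l : List ((Ordinal.{u} → Set.Iio κ) → Set.Iio κ)}
    (hl : ∀ f ∈ l, G.Int i f) :
    Sat (· ∈ G.mod i) (· ∈ ·) (· ∈ G.meas i) φ (l.map (G.proj i)) ↔
      ∀ᶠ x in G.gen, G.S φ (l.map (· x)) := by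
  have hget : ∀ j f, l[j]? = some f → G.Int i f := fun _ _ h => hl _ (List.mem_of_getElem? h)
  induction φ generalizing l with
  | fls => simp
  | eq j k =>
    simp only [sat_eq, List.getElem?_map, S]
    rcases hj : l[j]? with _ | f
    · simp [OptRel]
    · rcases hk : l[k]? with _ | g
      · simp [OptRel]
      · exact proj_eq_iff (hget _ _ hj) (hget _ _ hk)
  | mem j k =>
    simp only [sat_mem, List.getElem?_map, S]
    rcases hj : l[j]? with _ | f
    · simp [OptRel]
    · rcases hk : l[k]? with _ | g
      · simp [OptRel]
      · exact proj_mem_iff (hget _ _ hj)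
  | meas j =>
    simp only [sat_meas, List.getElem?_map, S]
    rcases hj : l[j]? with _ | f
    · simp [OptRel]
    · exact proj_mem_meas (hget _ _ hj)
  | imp φ ψ h1 h2 =>
    refine (imp_congr (h1 hl hget) (h2 hl hget)).trans ?_
    constructor
    · intro h
      rcases Int.sat_decided hl φ with h3 | h3
      · exact (h h3).mono fun x hx _ => hx
      · exact h3.mono fun x hx hx' => (hx hx').elim
    · intro h h3
      filter_upwards [h, h3] with x h4 h5 using h4 h5
  | all φ ih =>
    have ih' : ∀ f, G.Int i f → (Sat (· ∈ G.mod i) (· ∈ ·) (· ∈ G.meas i) φ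
        (G.proj i f :: l.map (G.proj i)) ↔ ∀ᶠ x in G.gen, G.S φ (f x :: l.map (· x))) := by
      intro f hf
      have hl' : ∀ g ∈ f :: l, G.Int i g := by simpa [hf] using hl
      exact ih hl' fun _ _ h => hl' _ (List.mem_of_getElem? h)
    constructor
    · intro h
      refine (Int.sat_decided hl (.all φ)).resolve_right fun h1 => ?_
      obtain ⟨s, hs, h2⟩ := Int.sk hl φ
      obtain ⟨x, h3, h4⟩ := (h1.and ((ih' s hs).1 (h _ hs.mem_mod))).exists
      exact h2 x h3 h4
    · intro h z hz
      obtain ⟨f, hf, rfl⟩ := Cod.mem_mod.1 hz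
      exact (ih' f hf).2 (h.mono fun x hx => hx _ trivial)

end Cod

/-! ### First-order formulas -/

/-- The de Bruijn index of a variable. -/
def varIdx {m n : ℕ} : Fin m ⊕ Fin n → ℕ
  | .inl i => n + i
  | .inr i => n - 1 - i

/-- The de Bruijn index of a term. -/
def termIdx {m n : ℕ} : SetLang.Term (Fin m ⊕ Fin n) → ℕ
  | .var x => varIdx x
  | .func (_ : Empty) _ => 0

/-- The atomic formula of a relation symbol. -/
def relFm : {l : ℕ} → memRel l → (Fin l → ℕ) → Fm
  | _, .mem, k => .mem (k 0) (k 1)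

/-- The translation of first-order formulas. -/
def toFm {m : ℕ} : {n : ℕ} → SetLang.BoundedFormula (Fin m) n → Fm
  | _, .falsum => .fls
  | _, .equal t s => .eq (termIdx t) (termIdx s)
  | _, .rel (R : memRel _) ts => relFm R fun i => termIdx (ts i)
  | _, .imp φ ψ => .imp (toFm φ) (toFm ψ)
  | _, .all φ => .all (toFm φ)

theorem getElem?_env {X : Type*} {m n : ℕ} (v : Fin m → X) (xs : Fin n → X) (a : Fin m ⊕ Fin n) :
    ((List.ofFn xs).reverse ++ List.ofFn v)[varIdx a]? = some (Sum.elim v xs a) := by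
  rcases a with i | i
  · simp [varIdx]
  · have hi := i.2
    rw [varIdx, List.getElem?_append_left (by simp; omega), List.getElem?_reverse (by simp; omega)]
    have : n - 1 - (n - 1 - (i : ℕ)) = i := by omega
    simp [this]

theorem getElem?_termIdx {M : Set ZFSet.{u}} {m n : ℕ} (v : Fin m → M) (xs : Fin n → M)
    (t : SetLang.Term (Fin m ⊕ Fin n)) :
    ((List.ofFn fun i => (xs i : ZFSet.{u})).reverse ++ List.ofFn fun i => (v i : ZFSet.{u}))[termIdx t]? =
      some (t.realize (Sum.elim v xs) : M).1 := by
  rcases t with a | ⟨f, ts⟩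
  · rw [termIdx, getElem?_env]
    rcases a <;> rfl
  · exact Empty.elim f

theorem realize_iff_sat {M : Set ZFSet.{u}} {P : ZFSet.{u} → Prop} {m n : ℕ}
    (φ : SetLang.BoundedFormula (Fin m) n) (v : Fin m → M) (xs : Fin n → M) :
    φ.Realize v xs ↔ Sat (· ∈ M) (· ∈ ·) P (toFm φ)
      ((List.ofFn fun i => (xs i : ZFSet.{u})).reverse ++ List.ofFn fun i => (v i : ZFSet.{u})) := by
  induction φ with
  | falsum => rfl
  | equal t s =>
    rw [toFm, sat_eq, getElem?_termIdx, getElem?_termIdx]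
    exact Subtype.ext_iff
  | rel R ts =>
    cases R
    change _ ↔ Sat _ _ _ (.mem _ _) _
    rw [sat_mem, getElem?_termIdx, getElem?_termIdx]
    rfl
  | imp φ ψ h1 h2 => exact imp_congr (h1 xs) (h2 xs)
  | all φ ih =>
    rw [toFm, sat_all, FirstOrder.Language.BoundedFormula.realize_all]
    rw [Subtype.forall]
    refine forall₂_congr fun y hy => ?_
    rw [ih, List.ofFn_succ']
    simp

theorem formula_realize_iff {M : Set ZFSet.{u}} {P : ZFSet.{u} → Prop} {m : ℕ}
    (φ : SetLang.Formula (Fin m)) (v : Fin m → M) :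
    φ.Realize v ↔ Sat (· ∈ M) (· ∈ ·) P (toFm φ) (List.ofFn fun i => (v i : ZFSet.{u})) := by
  have := realize_iff_sat (P := P) φ v default
  simpa only [FirstOrder.Language.Formula.Realize, List.ofFn_zero, List.reverse_nil,
    List.nil_append] using this

namespace Cod

variable {κ : Ordinal.{u}} (G : Cod κ)

open Classical in
/-- The embedding from the `i`-th to the `k`-th iterated ultrapower. -/
noncomputable def emb (i k : Ordinal.{u}) (z : ZFSet.{u}) : ZFSet.{u} :=
  if h : ∃ f, G.Int i f ∧ G.proj i f = z then G.proj k h.choose else ∅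

variable {G}

theorem emb_proj {i k : Ordinal.{u}} {f} (hf : G.Int i f) : G.emb i k (G.proj i f) = G.proj k f := by
  have h : ∃ g, G.Int i g ∧ G.proj i g = G.proj i f := ⟨f, hf, rfl⟩
  rw [emb, dif_pos h]
  exact proj_congr (proj_inj h.choose_spec.1 hf h.choose_spec.2)

theorem exists_classEmb {i k : Ordinal.{u}} (hik : i ≤ k) :
    ∃ e : ClassEmb (G.mod i).toSet (G.mod k).toSet, e.j = G.emb i k := by
  have hmaps : ∀ x, x ∈ (G.mod i).toSet → G.emb i k x ∈ (G.mod k).toSet := by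
    intro x hx
    obtain ⟨f, hf, rfl⟩ := Cod.mem_mod.1 hx
    rw [emb_proj hf]
    exact (hf.mono hik).mem_mod
  refine ⟨⟨G.emb i k, hmaps, ?_⟩, rfl⟩
  intro n φ v hv
  choose f hf hfv using fun j => Cod.mem_mod.1 (hv j)
  have h1 : ∀ g ∈ List.ofFn f, G.Int i g := by
    intro g hg
    obtain ⟨j, rfl⟩ := (List.mem_ofFn' _ _).1 hg
    exact hf j
  have h2 : (List.ofFn fun j => v j) = (List.ofFn f).map (G.proj i) := by
    rw [List.map_ofFn]
    exact congrArg List.ofFn (funext fun j => (hfv j).symm)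
  have h3 : (List.ofFn fun j => G.emb i k (v j)) = (List.ofFn f).map (G.proj k) := by
    rw [List.map_ofFn]
    refine congrArg List.ofFn (funext fun j => ?_)
    rw [← hfv j, emb_proj (hf j)]
    rfl
  rw [formula_realize_iff (P := (· ∈ G.meas i)), formula_realize_iff (P := (· ∈ G.meas k))]
  refine (iff_of_eq (congrArg _ h2)).trans ((los h1).trans
    ((los fun g hg => (h1 g hg).mono hik).symm.trans (iff_of_eq (congrArg _ h3)).symm))

/-! ### Set operations -/

variable (G) in
/-- Existence of unordered pairs. -/
theorem exists_unordered (a b : Set.Iio κ) : ∃ y, ∀ w, G.E w y ↔ w = a ∨ w = b := by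
  obtain ⟨y, h⟩ := G.seq 2 (fun i => if i = 0 then a else b)
    ((Ordinal.natCast_lt_omega0 2).trans G.omega_lt)
  refine ⟨y, fun w => (h w).trans ⟨?_, ?_⟩⟩
  · rintro ⟨i, -, rfl⟩
    split_ifs <;> simp
  · rintro (rfl | rfl)
    · exact ⟨0, by norm_num, by simp⟩
    · exact ⟨1, by norm_num, by simp⟩

/-- The pair of elements of a model is the value of `pr`. -/
theorem proj_pr {i : Ordinal.{u}} {f g} (hf : G.Int i f) (hg : G.Int i g) :
    G.proj i (fun x => G.B .pr (f x) (g x)) = ZFSet.pair (G.proj i f) (G.proj i g) := by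
  have hex : ∀ f g, G.Int i f → G.Int i g →
      ({G.proj i f, G.proj i g} : ZFSet.{u}) ∈ G.mod i := by
    intro f g hf hg
    have h := (los (G := G) (i := i) (l := [f, g]) (φ := .ex (.all (.iff (.mem 0 1) (.or (.eq 0 2) (.eq 0 3)))))
      (by simp [hf, hg])).2 (.of_forall fun x => by simpa [S] using G.exists_unordered (f x) (g x))
    simp at h
    obtain ⟨y, hy, h⟩ := h
    convert hy using 1
    ext w
    rw [ZFSet.mem_pair]
    by_cases hw : w ∈ G.mod i
    · exact (h w hw).symm
    · refine iff_of_false ?_ fun h => hw (mod_trans hy h)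
      rintro (rfl | rfl)
      exacts [hw hf.mem_mod, hw hg.mem_mod]
  have hpr := Int.op .pr hf hg
  have hpm := hpr.mem_mod
  have h := (los (G := G) (i := i) (l := [fun x => G.B .pr (f x) (g x), f, g])
    (φ := .all (.iff (.mem 0 1) (.or (.all (.iff (.mem 0 1) (.eq 0 3)))
      (.all (.iff (.mem 0 1) (.or (.eq 0 3) (.eq 0 4)))))))
      (by simp [hf, hg, hpr])).2 (.of_forall fun x => by
        simpa [S] using fun z hz => G.mem_pr (f x) (g x) ⟨z, hz⟩)
  simp at h
  have key : ∀ y ∈ G.mod i, ∀ a b, a ∈ G.mod i → b ∈ G.mod i →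
      ((∀ w ∈ G.mod i, (w ∈ y ↔ w = a ∨ w = b)) ↔ y = {a, b}) := by
    intro y hy a b ha hb
    constructor
    · intro h1
      ext w
      rw [ZFSet.mem_pair]
      by_cases hw : w ∈ G.mod i
      · exact h1 w hw
      · refine iff_of_false (fun h => hw (mod_trans hy h)) ?_
        rintro (rfl | rfl)
        exacts [hw ha, hw hb]
    · rintro rfl w -
      rw [ZFSet.mem_pair]
  ext z
  rw [ZFSet.pair, ZFSet.mem_pair]
  have hsingle : ({G.proj i f} : ZFSet.{u}) = {G.proj i f, G.proj i f} := by simp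
  constructor
  · intro hz
    have hzm := mod_trans hpm hz
    refine ((h z hzm).1 hz).imp (fun h1 => ?_) fun h1 => ?_
    · rw [hsingle]
      exact (key z hzm _ _ hf.mem_mod hf.mem_mod).1 (by simpa using h1)
    · exact (key z hzm _ _ hf.mem_mod hg.mem_mod).1 h1
  · intro h1
    have hzm : z ∈ G.mod i := by
      rcases h1 with rfl | rfl
      · rw [hsingle]
        exact hex f f hf hf
      · exact hex f g hf hg
    refine (h z hzm).2 (h1.imp (fun h1 => ?_) fun h1 => ?_)
    · rw [hsingle] at h1
      simpa using (key z hzm _ _ hf.mem_mod hf.mem_mod).2 h1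
    · exact (key z hzm _ _ hf.mem_mod hg.mem_mod).2 h1

variable (G) in
theorem pr_inj {a b a' b' : Set.Iio κ} (h : G.B .pr a b = G.B .pr a' b') : a = a' ∧ b = b' := by
  have h1 := proj_pr (G := G) (i := 0) (.const 0 a) (.const 0 b)
  have h2 := proj_pr (G := G) (i := 0) (.const 0 a') (.const 0 b')
  simp only [h] at h1
  obtain ⟨h3, h4⟩ := ZFSet.pair_inj.1 (h1.symm.trans h2)
  exact ⟨by simpa using proj_inj (.const 0 a) (.const 0 a') h3,
    by simpa using proj_inj (.const 0 b) (.const 0 b') h4⟩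

end Cod

namespace Cod

variable {κ : Ordinal.{u}} {G : Cod κ}

/-! ### Ultrapower steps -/

theorem ap_code (ts : List (Set.Iio κ)) (ξ : Set.Iio κ) :
    G.ap (ts.foldr (G.B (.sharp .pr)) (G.B .cnst (G.c 2) (G.c 2))) ξ =
      (ts.map (G.ap · ξ)).foldr (G.B .pr) (G.c 2) := by
  induction ts with
  | nil => exact G.ev_cnst _ _ _
  | cons t ts ih =>
    rw [List.foldr_cons, ap, G.ev_sharp]
    exact congrArg _ ih

theorem fil_decided (φ : Fm) (ts : List (Set.Iio κ)) :
    (∀ᶠ ξ in G.fil, G.S φ (ts.map (G.ap · ξ))) ∨ ∀ᶠ ξ in G.fil, ¬ G.S φ (ts.map (G.ap · ξ)) := by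
  have h (ξ : Set.Iio κ) := G.chi_iff φ (ts.map (G.ap · ξ)) (G.c 2)
  simp only [List.length_map, ← ap_code] at h
  simp only [S, ← h]
  have h2 := G.F_dec (G.B (.sharp (.chi φ ts.length))
    (ts.foldr (G.B (.sharp .pr)) (G.B .cnst (G.c 2) (G.c 2))) (G.B .cnst (G.c 2) (G.c 2)))
  simpa only [G.ev_sharp, G.ev_cnst, ← eventually_fil] using h2

theorem gen_sat {i : Ordinal.{u}} (φ : Fm) {l : List ((Ordinal.{u} → Set.Iio κ) → Set.Iio κ)}
    (hl : ∀ f ∈ l, G.Int i f) : ∀ᶠ x in G.gen,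
      ((∀ᶠ ξ in G.fil, G.S φ (l.map fun f => G.ap (f x) ξ)) ↔ G.S φ (l.map fun f => G.ap (f x) (x i))) := by
  have h0 : ∀ x y, (∀ k < i, x k = y k) → (l.map fun f => f x) = l.map fun f => f y := by
    intro x y h
    exact List.map_congr_left fun f hf => (hl f hf).congr h
  have h1 := G.gen_at i (R := fun x ξ => G.S φ ((l.map fun f => f x).map (G.ap · ξ)))
    fun x y h => by rw [h0 x y h]
  have h2 := G.gen_at i (R := fun x ξ => ¬ G.S φ ((l.map fun f => f x).map (G.ap · ξ)))
    fun x y h => by rw [h0 x y h]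
  filter_upwards [h1, h2] with x h3 h4
  have h5 := fil_decided (G := G) φ (l.map fun f => f x)
  simp only [List.map_map] at h3 h4 h5
  exact ⟨h3, fun h => h5.resolve_right fun h6 => h4 h6 h⟩

theorem E_irrefl (a : Set.Iio κ) : ¬ G.E a a := fun h => G.wf.asymmetric a a h h

theorem E_o {η ξ : Set.Iio κ} (h : η < ξ) : G.E (G.o η) (G.o ξ) := (G.mem_o _ _).2 ⟨η, h, rfl⟩

theorem o_inj {η ξ : Set.Iio κ} (h : G.o η = G.o ξ) : η = ξ := by
  rcases lt_trichotomy η ξ with h1 | h1 | h1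
  · have h2 := E_o (G := G) h1
    rw [h] at h2
    exact (E_irrefl _ h2).elim
  · exact h1
  · have h2 := E_o (G := G) h1
    rw [h] at h2
    exact (E_irrefl _ h2).elim

theorem gen_lt {i : Ordinal.{u}} {g} (hg : G.Int i g) :
    ∀ᶠ x in G.gen, ∀ η, g x = G.o η → η < x i := by
  have h := G.gen_at i (R := fun x ξ => ∀ η, g x = G.o η → η < ξ) fun x y h => by rw [hg.congr h]
  refine h.mono fun x hx => hx ?_
  by_cases h1 : ∃ η, g x = G.o η
  · obtain ⟨η, hη⟩ := h1
    filter_upwards [G.eventually_lt η] with ξ hξ η' h2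
    rwa [o_inj (h2.symm.trans hη)]
  · exact .of_forall fun ξ η h2 => (h1 ⟨η, h2⟩).elim

theorem exists_int_of_lt {i : Ordinal.{u}} {f} (hf : G.Int (i + 1) f)
    (h : ∀ᶠ x in G.gen, G.E (f x) (G.o (x i))) : ∃ g, G.Int i g ∧ ∀ᶠ x in G.gen, f x = g x := by
  obtain ⟨t, ht, rfl⟩ := hf.rep le_rfl
  have hc := Int.const (G := G) i (G.B .cnst (G.c 1) (G.c 1))
  refine ⟨_, Int.op .press ht hc, ?_⟩
  have h1 := gen_sat (G := G) (i := i) (.mem 0 1) (l := [t, fun _ => G.c 1]) (by simp [ht, Int.const])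
  have h2 := G.gen_at i (R := fun x ξ => G.ap (t x) ξ = G.B .press (t x) (G.B .cnst (G.c 1) (G.c 1)))
    fun x y h => by rw [ht.congr h]
  filter_upwards [h, h1, h2] with x h3 h4 h5
  simp only [S, List.map_cons, List.map_nil, sat_mem, List.getElem?_cons_zero,
    List.getElem?_cons_succ, optRel_some, ap, G.ev_one] at h4
  have h6 := h4.2 h3
  obtain ⟨ζ, h7, h8⟩ := G.F_press (t x) (G.B .cnst (G.c 1) (G.c 1)) (G.eventually_fil.1 (by
    refine h6.mono fun ξ hξ => ?_
    obtain ⟨ζ, h7, h8⟩ := (G.mem_o _ _).1 hξ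
    exact ⟨ζ, h7, by rw [h8, G.ev_cnst, G.ev_one]⟩))
  refine h5 ((G.eventually_fil.2 h8).mono fun ξ hξ => ?_)
  rw [h7, ap, hξ, G.ev_cnst, G.ev_one]

theorem proj_succ {i : Ordinal.{u}} {g} (hg : G.Int i g) (h : ∀ᶠ x in G.gen, G.E (g x) (G.c 0)) :
    G.proj (i + 1) g = G.proj i g := by
  induction g using G.prec_wf.induction with
  | _ g ih =>
  have hi : i ≤ i + 1 := (Order.lt_add_one_iff.2 le_rfl).le
  ext z
  rw [mem_proj, mem_proj]
  constructor
  · rintro ⟨f, hf, h1, rfl⟩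
    obtain ⟨f', hf', h2⟩ := exists_int_of_lt hf (by
      filter_upwards [h, h1, gen_lt hg] with x h2 h3 h4
      obtain ⟨η, hη⟩ := (G.mem_zero _).1 h2
      rw [hη] at h3
      obtain ⟨ζ, h5, h6⟩ := (G.mem_o _ _).1 h3
      rw [h6]
      exact E_o (h5.trans (h4 η hη)))
    have h3 : G.prec f' g := by
      filter_upwards [h1, h2] with x h3 h4
      rwa [← h4]
    refine ⟨f', hf', h3, ?_⟩
    rw [proj_congr h2]
    refine ih f' h3 hf' ?_
    filter_upwards [h3, h] with x h4 h5
    obtain ⟨η, hη⟩ := (G.mem_zero _).1 h5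
    rw [hη] at h4
    obtain ⟨ζ, -, h6⟩ := (G.mem_o _ _).1 h4
    rw [h6]
    exact G.mem_zero_o ζ
  · rintro ⟨f, hf, h1, rfl⟩
    refine ⟨f, hf.mono hi, h1, (ih f h1 hf ?_).symm⟩
    filter_upwards [h1, h] with x h4 h5
    obtain ⟨η, hη⟩ := (G.mem_zero _).1 h5
    rw [hη] at h4
    obtain ⟨ζ, -, h6⟩ := (G.mem_o _ _).1 h4
    rw [h6]
    exact G.mem_zero_o ζ

variable (G) in
/-- The image of `κ` in the `i`-th iterated ultrapower. -/
noncomputable def crit (i : Ordinal.{u}) : ZFSet.{u} := G.proj i fun _ => G.c 0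

theorem mem_crit {i : Ordinal.{u}} {z : ZFSet.{u}} : z ∈ G.crit i ↔
    ∃ f, G.Int i f ∧ (∀ᶠ x in G.gen, ∃ ξ, f x = G.o ξ) ∧ z = G.proj i f := by
  rw [crit, mem_proj]
  simp only [prec, G.mem_zero]

theorem proj_coord (i : Ordinal.{u}) : G.proj (i + 1) (fun x => G.o (x i)) = G.crit i := by
  have hi : i < i + 1 := Order.lt_add_one_iff.2 le_rfl
  ext z
  rw [mem_proj, mem_crit]
  constructor
  · rintro ⟨f, hf, h1, rfl⟩
    obtain ⟨f', hf', h2⟩ := exists_int_of_lt hf h1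
    have h3 : ∀ᶠ x in G.gen, ∃ ξ, f' x = G.o ξ := by
      filter_upwards [h1, h2] with x h3 h4
      obtain ⟨ζ, -, h6⟩ := (G.mem_o _ _).1 h3
      exact ⟨ζ, by rw [← h4, h6]⟩
    refine ⟨f', hf', h3, ?_⟩
    rw [proj_congr h2]
    exact proj_succ hf' (by simpa only [G.mem_zero] using h3)
  · rintro ⟨f, hf, h1, rfl⟩
    refine ⟨f, hf.mono hi.le, ?_, (proj_succ hf (by simpa only [G.mem_zero] using h1)).symm⟩
    filter_upwards [h1, gen_lt hf] with x h2 h3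
    obtain ⟨ξ, hξ⟩ := h2
    rw [hξ]
    exact E_o (h3 ξ hξ)

theorem isOrdinal_crit (i : Ordinal.{u}) : (G.crit i).IsOrdinal := by
  constructor
  · intro y hy z hz
    obtain ⟨f, hf, h1, rfl⟩ := mem_crit.1 hy
    obtain ⟨g, hg, h2, rfl⟩ := mem_proj.1 hz
    refine mem_crit.2 ⟨g, hg, ?_, rfl⟩
    filter_upwards [h1, h2] with x h3 h4
    obtain ⟨ξ, hξ⟩ := h3
    rw [hξ, G.mem_o] at h4
    obtain ⟨ζ, -, h5⟩ := h4
    exact ⟨ζ, h5⟩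
  · intro a b c ha hb hc
    obtain ⟨f, hf, h1, rfl⟩ := mem_crit.1 hc
    obtain ⟨g, hg, h2, rfl⟩ := mem_proj.1 hb
    obtain ⟨e, he, h3, rfl⟩ := mem_proj.1 ha
    refine mem_proj.2 ⟨e, he, ?_, rfl⟩
    filter_upwards [h1, h2, h3] with x h4 h5 h6
    obtain ⟨ξ, hξ⟩ := h4
    rw [hξ, G.mem_o] at h5
    obtain ⟨ζ, h7, h8⟩ := h5
    rw [h8, G.mem_o] at h6
    obtain ⟨ζ', h9, h10⟩ := h6
    rw [h10, hξ]
    exact E_o (h9.trans h7)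

theorem critPt (i : Ordinal.{u}) : CritPt (G.emb i (i + 1)) (G.crit i) := by
  have hi : i < i + 1 := Order.lt_add_one_iff.2 le_rfl
  refine ⟨isOrdinal_crit i, ?_, ?_⟩
  · have h : G.emb i (i + 1) (G.crit i) = G.proj (i + 1) fun _ => G.c 0 := emb_proj (.const i _)
    rw [h, ← proj_coord, proj_mem_iff (Int.coord hi)]
    exact .of_forall fun x => G.mem_zero_o _
  · intro α _ hα
    obtain ⟨f, hf, h1, rfl⟩ := mem_crit.1 hα
    rw [emb_proj hf]
    exact proj_succ hf (by simpa only [G.mem_zero] using h1)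

theorem eventually_subset {i : Ordinal.{u}} {f g} (hf : G.Int i f) (hg : G.Int i g)
    (h : G.proj i f ⊆ G.proj i g) : ∀ᶠ x in G.gen, ∀ z, G.E z (f x) → G.E z (g x) := by
  have := (los (G := G) (i := i) (l := [f, g]) (φ := .all (.imp (.mem 0 1) (.mem 0 2)))
    (by simp [hf, hg])).1 (by simpa using fun y _ hy => h hy)
  simpa [S] using this

theorem mem_meas_iff {i : Ordinal.{u}} {X : ZFSet.{u}} (hX : X ∈ G.mod i) (h : X ⊆ G.crit i) :
    X ∈ G.meas i ↔ G.crit i ∈ G.emb i (i + 1) X := by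
  obtain ⟨g, hg, rfl⟩ := Cod.mem_mod.1 hX
  have hi : i < i + 1 := Order.lt_add_one_iff.2 le_rfl
  have h1 := eventually_subset hg (.const i (G.c 0)) h
  rw [proj_mem_meas hg, emb_proj hg, ← proj_coord, proj_mem_iff (Int.coord hi)]
  have h2 := gen_sat (G := G) (i := i) (.mem 0 1) (l := [fun _ => G.c 1, fun x => G.B .cnst (g x) (g x)])
    (by simp [Int.op .cnst hg hg, Int.const])
  refine Filter.eventually_congr ?_
  filter_upwards [h1, h2] with x h3 h4
  simp only [S, List.map_cons, List.map_nil, sat_mem, List.getElem?_cons_zero,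
    List.getElem?_cons_succ, optRel_some, ap, G.ev_one, G.ev_cnst] at h4
  rw [← h4, G.F_iff]
  exact and_iff_right h3

theorem pr_graph {t g : Set.Iio κ} {ξ : Set.Iio κ} :
    G.E (G.B .pr (G.o ξ) g) (G.B .graph t t) ↔ g = G.ap t ξ := by
  rw [G.mem_graph]
  constructor
  · rintro ⟨ζ, h⟩
    obtain ⟨h1, h2⟩ := G.pr_inj h
    rw [h2, o_inj h1]
  · rintro rfl
    exact ⟨ξ, rfl⟩

theorem exists_function {i : Ordinal.{u}} {y : ZFSet.{u}} (hy : y ∈ G.mod (i + 1)) :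
    ∃ f : ZFSet.{u}, f ∈ G.mod i ∧ (∀ a ∈ G.crit i, ∃! b : ZFSet.{u}, ZFSet.pair a b ∈ f) ∧
      ZFSet.pair (G.crit i) y ∈ G.emb i (i + 1) f := by
  obtain ⟨f, hf, rfl⟩ := Cod.mem_mod.1 hy
  have hi : i < i + 1 := Order.lt_add_one_iff.2 le_rfl
  obtain ⟨t, ht, rfl⟩ := hf.rep le_rfl
  have hgr := Int.op .graph ht ht
  refine ⟨_, hgr.mem_mod, fun a ha => ?_, ?_⟩
  · obtain ⟨g, hg, h1, rfl⟩ := mem_crit.1 ha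
    have hev := Int.op .ev ht hg
    refine ⟨G.proj i fun x => G.B .ev (t x) (g x), ?_, fun b hb => ?_⟩
    · dsimp only
      rw [← proj_pr hg hev, proj_mem_iff (Int.op .pr hg hev)]
      refine h1.mono fun x ⟨ξ, hξ⟩ => ?_
      rw [hξ, pr_graph]
    · have h2 := mod_trans hgr.mem_mod hb
      have h3 : b ∈ G.mod i := by
        refine mod_trans (mod_trans h2 (y := {G.proj i g, b}) ?_) (y := b) ?_
        · simp [ZFSet.pair]
        · simp
      obtain ⟨e, he, rfl⟩ := Cod.mem_mod.1 h3
      rw [← proj_pr hg he, proj_mem_iff (Int.op .pr hg he)] at hb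
      refine proj_congr ?_
      filter_upwards [hb, h1] with x h4 ⟨ξ, hξ⟩
      rw [hξ, pr_graph] at h4
      rw [h4, hξ]
  · rw [emb_proj hgr, ← proj_coord, ← proj_pr (Int.coord hi) hf, proj_mem_iff (Int.op .pr (Int.coord hi) hf)]
    exact .of_forall fun x => pr_graph.2 rfl

theorem isUltrapowerMap (i : Ordinal.{u}) :
    IsUltrapowerMap (G.crit i) (G.mod i) (G.meas i) (G.mod (i + 1)) (G.emb i (i + 1)) :=
  ⟨fun _ hz _ hy => mod_trans hz hy, exists_classEmb (Order.lt_add_one_iff.2 le_rfl).le, critPt i,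
    fun _ => mem_meas_iff, fun _ => exists_function⟩

theorem meas_inter {i : Ordinal.{u}} {d} :
    G.meas i ∩ G.proj i d = G.proj i fun x => G.B .amen (d x) (d x) := by
  ext z
  rw [ZFSet.mem_inter, mem_meas]
  constructor
  · rintro ⟨⟨f, hf, h1, rfl⟩, h2⟩
    rw [proj_mem_iff hf] at h2 ⊢
    filter_upwards [h1, h2] with x h3 h4 using (G.mem_amen _ _ _).2 ⟨h4, h3⟩
  · intro h
    obtain ⟨f, hf, h1, rfl⟩ := mem_proj.1 h
    refine ⟨⟨f, hf, h1.mono fun x hx => ((G.mem_amen _ _ _).1 hx).2, rfl⟩, ?_⟩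
    exact (proj_mem_iff hf).2 (h1.mono fun x hx => ((G.mem_amen _ _ _).1 hx).1)

theorem mem_meas_of_mem_emb {i k : Ordinal.{u}} {Y D : ZFSet.{u}} (hD : D ∈ G.mod i)
    (h : Y ∈ G.emb i k (G.meas i ∩ D)) : Y ∈ G.meas k := by
  obtain ⟨d, hd, rfl⟩ := Cod.mem_mod.1 hD
  rw [meas_inter, emb_proj (Int.op .amen hd hd)] at h
  obtain ⟨f, hf, h1, rfl⟩ := mem_proj.1 h
  exact (proj_mem_meas hf).2 (h1.mono fun x hx => ((G.mem_amen _ _ _).1 hx).2)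

theorem exists_mem_emb {i k : Ordinal.{u}} {f d} (hf : G.Int k f) (hd : G.Int i d)
    (h : ∀ᶠ x in G.gen, G.F (f x)) (h1 : ∀ᶠ x in G.gen, G.E (f x) (d x)) :
    ∃ D, D ∈ G.mod i ∧ G.proj k f ∈ G.emb i k (G.meas i ∩ D) := by
  refine ⟨_, hd.mem_mod, ?_⟩
  rw [meas_inter, emb_proj (Int.op .amen hd hd), proj_mem_iff hf]
  filter_upwards [h, h1] with x h2 h3 using (G.mem_amen _ _ _).2 ⟨h3, h2⟩

theorem mem_meas_succ {i : Ordinal.{u}} {Y : ZFSet.{u}} : Y ∈ G.meas (i + 1) ↔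
    ∃ D, D ∈ G.mod i ∧ Y ∈ G.emb i (i + 1) (G.meas i ∩ D) := by
  have hi : i ≤ i + 1 := (Order.lt_add_one_iff.2 le_rfl).le
  constructor
  · intro h
    obtain ⟨f, hf, h1, rfl⟩ := mem_meas.1 h
    obtain ⟨t, ht, rfl⟩ := hf.rep le_rfl
    exact exists_mem_emb hf (Int.op .cov ht ht) h1 (.of_forall fun x => G.mem_cov _ _ _)
  · rintro ⟨D, hD, h⟩
    exact mem_meas_of_mem_emb hD h

theorem Int.exists_lt {l : Ordinal.{u}} {f} (hf : G.Int l f) (h0 : l ≠ 0) (hl : ∀ i < l, i + 1 < l) :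
    ∃ i < l, G.Int i f := by
  rcases hf.cases' with ⟨a, rfl⟩ | ⟨k, hk, t, ht, rfl⟩
  · exact ⟨0, pos_iff_ne_zero.2 h0, .const 0 a⟩
  · exact ⟨k + 1, hl k hk, .step _ k t (Order.lt_add_one_iff.2 le_rfl) ht⟩

theorem mem_meas_limit {l : Ordinal.{u}} {Y : ZFSet.{u}} (h0 : l ≠ 0) (hl : ∀ i < l, i + 1 < l) :
    Y ∈ G.meas l ↔ ∃ i, i < l ∧ ∃ D, D ∈ G.mod i ∧ Y ∈ G.emb i l (G.meas i ∩ D) := by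
  constructor
  · intro h
    obtain ⟨f, hf, h1, rfl⟩ := mem_meas.1 h
    obtain ⟨i, hi, hfi⟩ := hf.exists_lt h0 hl
    have hc := Int.op .cnst hfi hfi
    refine ⟨i, hi, exists_mem_emb hf (Int.op .cov hc hc) h1 (.of_forall fun x => ?_)⟩
    have := G.mem_cov (G.B .cnst (f x) (f x)) (G.B .cnst (f x) (f x)) (x i)
    rwa [G.ev_cnst] at this
  · rintro ⟨i, hi, D, hD, h⟩
    exact mem_meas_of_mem_emb hD h

/-! ### The iteration -/

theorem rank_insert_self (i : ZFSet.{u}) : (insert i i : ZFSet.{u}).rank = i.rank + 1 := by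
  rw [ZFSet.rank_insert, ← Order.succ_eq_add_one]
  exact max_eq_left (Order.le_succ _)

theorem iterable : Iterable (G.crit 0) (G.mod 0) (G.meas 0) := by
  intro δ hδ
  refine ⟨{
    Mod := fun i => G.mod i.rank
    Meas := fun i => G.meas i.rank
    cp := fun i => G.crit i.rank
    emb := fun i k => G.emb i.rank k.rank
    mod_zero := by rw [ZFSet.rank_empty]
    meas_zero := by rw [ZFSet.rank_empty]
    cp_zero := by rw [ZFSet.rank_empty]
    trans' := fun i _ _ hz _ hy => mod_trans hz hy
    elem' := fun i k _ _ h => exists_classEmb (ZFSet.rank_lt_of_mem h).le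
    comm := ?_
    cp_emb := ?_
    succ' := ?_
    limit' := ?_ }⟩
  · intro i k l _ _ _ h1 h2 x hx
    obtain ⟨f, hf, rfl⟩ := Cod.mem_mod.1 hx
    rw [emb_proj hf, emb_proj hf, emb_proj (hf.mono (ZFSet.rank_lt_of_mem h1).le)]
  · intro i _ _
    rw [ZFSet.rank_empty, crit, crit, emb_proj (.const 0 _)]
  · intro i _ _
    rw [rank_insert_self]
    exact ⟨isUltrapowerMap _, fun Y => mem_meas_succ⟩
  · intro l hl hne hlim
    have hlo : l.IsOrdinal := hδ.mem hl
    have hmem : ∀ i, i < l.rank → i.toZFSet ∈ l := by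
      intro i hi
      rw [← hlo.toZFSet_rank_eq, Ordinal.mem_toZFSet_iff]
      exact ⟨i, hi, rfl⟩
    have h0 : l.rank ≠ 0 := by
      intro h
      apply hne
      rw [← hlo.toZFSet_rank_eq, h, Ordinal.toZFSet_zero]
    have hs : ∀ i < l.rank, i + 1 < l.rank := by
      intro i hi
      have := ZFSet.rank_lt_of_mem (hlim _ (hmem i hi))
      rwa [rank_insert_self, Ordinal.rank_toZFSet] at this
    refine ⟨fun y hy => ?_, fun Y => (mem_meas_limit h0 hs).trans ?_⟩
    · obtain ⟨f, hf, rfl⟩ := Cod.mem_mod.1 hy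
      obtain ⟨i, hi, hfi⟩ := hf.exists_lt h0 hs
      refine ⟨i.toZFSet, hmem i hi, G.proj i f, ?_, ?_⟩
      · rw [Ordinal.rank_toZFSet]
        exact hfi.mem_mod
      · rw [Ordinal.rank_toZFSet, emb_proj hfi]
    · constructor
      · rintro ⟨i, hi, D, h⟩
        refine ⟨i.toZFSet, hmem i hi, D, ?_⟩
        rwa [Ordinal.rank_toZFSet]
      · rintro ⟨i, hi, D, h⟩
        exact ⟨i.rank, ZFSet.rank_lt_of_mem hi, D, h⟩

end Cod

namespace Cod

variable {κ : Ordinal.{u}} {G : Cod κ}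

/-! ### The coded structure -/

theorem int_zero_iff {f} : G.Int 0 f ↔ ∃ a, f = fun _ => a := by
  constructor
  · intro h
    rcases h.cases' with h | ⟨k, hk, -⟩
    · exact h
    · exact (not_lt_zero hk).elim
  · rintro ⟨a, rfl⟩
    exact .const 0 a

variable (G) in
/-- The transitive collapse of the coded structure. -/
noncomputable def val (a : Set.Iio κ) : ZFSet.{u} := G.proj 0 fun _ => a

theorem val_inj {a b : Set.Iio κ} : G.val a = G.val b ↔ a = b := by
  rw [val, val, proj_eq_iff (.const 0 a) (.const 0 b), Filter.eventually_const]

theorem val_mem_val {a b : Set.Iio κ} : G.val a ∈ G.val b ↔ G.E a b := by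
  rw [val, val, proj_mem_iff (.const 0 a), Filter.eventually_const]

theorem mem_mod_zero {z : ZFSet.{u}} : z ∈ G.mod 0 ↔ ∃ a, z = G.val a := by
  rw [Cod.mem_mod]
  constructor
  · rintro ⟨f, hf, rfl⟩
    obtain ⟨a, rfl⟩ := int_zero_iff.1 hf
    exact ⟨a, rfl⟩
  · rintro ⟨a, rfl⟩
    exact ⟨_, .const 0 a, rfl⟩

theorem val_mem_mod (a : Set.Iio κ) : G.val a ∈ G.mod 0 := mem_mod_zero.2 ⟨a, rfl⟩

theorem mem_val {a : Set.Iio κ} {z : ZFSet.{u}} : z ∈ G.val a ↔ ∃ b, G.E b a ∧ z = G.val b := by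
  constructor
  · intro h
    obtain ⟨b, rfl⟩ := mem_mod_zero.1 (mod_trans (val_mem_mod a) h)
    exact ⟨b, val_mem_val.1 h, rfl⟩
  · rintro ⟨b, h, rfl⟩
    exact val_mem_val.2 h

theorem val_mem_meas {a : Set.Iio κ} : G.val a ∈ G.meas 0 ↔ G.F a := by
  rw [val, proj_mem_meas (.const 0 a), Filter.eventually_const]

theorem val_pr (a b : Set.Iio κ) : G.val (G.B .pr a b) = ZFSet.pair (G.val a) (G.val b) :=
  proj_pr (.const 0 a) (.const 0 b)

theorem val_o (ξ : Set.Iio κ) : G.val (G.o ξ) = (ξ : Ordinal.{u}).toZFSet := by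
  obtain ⟨ξ, hξ⟩ := ξ
  induction ξ using WellFoundedLT.induction with
  | _ ξ ih =>
  ext z
  rw [mem_val, Ordinal.mem_toZFSet_iff]
  constructor
  · rintro ⟨b, hb, rfl⟩
    obtain ⟨⟨η, hη⟩, h, rfl⟩ := (G.mem_o _ _).1 hb
    exact ⟨η, h, (ih η h hη).symm⟩
  · rintro ⟨η, h, rfl⟩
    exact ⟨G.o ⟨η, h.trans hξ⟩, E_o h, (ih η h _).symm⟩

theorem mem_crit_zero {z : ZFSet.{u}} : z ∈ G.crit 0 ↔ ∃ ξ, z = G.val (G.o ξ) := by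
  change z ∈ G.val (G.c 0) ↔ _
  rw [mem_val]
  constructor
  · rintro ⟨b, hb, rfl⟩
    obtain ⟨ξ, rfl⟩ := (G.mem_zero b).1 hb
    exact ⟨ξ, rfl⟩
  · rintro ⟨ξ, rfl⟩
    exact ⟨_, mem_zero_o G ξ, rfl⟩

theorem crit_zero : G.crit 0 = κ.toZFSet := by
  ext z
  rw [mem_crit_zero, Ordinal.mem_toZFSet_iff]
  constructor
  · rintro ⟨ξ, rfl⟩
    exact ⟨ξ, ξ.2, (val_o ξ).symm⟩
  · rintro ⟨η, h, rfl⟩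
    exact ⟨⟨η, h⟩, (val_o ⟨η, h⟩).symm⟩

theorem mem_val_o {ξ : Set.Iio κ} {z : ZFSet.{u}} :
    z ∈ G.val (G.o ξ) ↔ ∃ η, η < ξ ∧ z = G.val (G.o η) := by
  rw [mem_val]
  constructor
  · rintro ⟨b, hb, rfl⟩
    obtain ⟨η, h, rfl⟩ := (G.mem_o _ _).1 hb
    exact ⟨η, h, rfl⟩
  · rintro ⟨η, h, rfl⟩
    exact ⟨_, E_o h, rfl⟩

theorem mk_toZFSet (α : Ordinal.{u}) : Cardinal.mk α.toZFSet.toSet = Cardinal.mk (Set.Iio α) := by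
  refine (Cardinal.mk_congr (Equiv.ofBijective
    (fun a : Set.Iio α => (⟨a.1.toZFSet, Ordinal.mem_toZFSet_iff.2 ⟨a, a.2, rfl⟩⟩ : α.toZFSet.toSet))
    ⟨fun a b h => ?_, fun ⟨z, hz⟩ => ?_⟩)).symm
  · exact Subtype.ext (Ordinal.toZFSet_injective (congrArg (fun z : α.toZFSet.toSet => z.1) h))
  · obtain ⟨a, h, rfl⟩ := Ordinal.mem_toZFSet_iff.1 hz
    exact ⟨⟨a, h⟩, rfl⟩

theorem mk_mod_zero : Cardinal.mk (G.mod 0).toSet = Cardinal.mk (Set.Iio κ) := by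
  refine (Cardinal.mk_congr (Equiv.ofBijective
    (fun a : Set.Iio κ => (⟨G.val a, val_mem_mod a⟩ : (G.mod 0).toSet))
    ⟨fun a b h => ?_, fun ⟨z, hz⟩ => ?_⟩)).symm
  · exact val_inj.1 (congrArg (fun z : (G.mod 0).toSet => z.1) h)
  · obtain ⟨a, rfl⟩ := mem_mod_zero.1 hz
    exact ⟨a, rfl⟩

theorem seqClosedLt : SeqClosedLt (G.crit 0) (G.mod 0) := by
  intro α hα f ⟨h1, h2⟩
  obtain ⟨ξ, rfl⟩ := mem_crit_zero.1 hα
  have h3 : ∀ i : Ordinal.{u}, ∃ p, ∀ h : i < ξ, ∃ b, p = G.B .pr (G.o ⟨i, h.trans ξ.2⟩) b ∧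
      ZFSet.pair (G.val (G.o ⟨i, h.trans ξ.2⟩)) (G.val b) ∈ f := by
    intro i
    by_cases h : i < ξ
    · obtain ⟨y, hy, -⟩ := h2 (G.val (G.o ⟨i, h.trans ξ.2⟩)) (val_mem_val.2 (E_o h))
      obtain ⟨a, b, -, h4, h5⟩ := h1 _ hy
      obtain ⟨-, rfl⟩ := ZFSet.pair_inj.1 h5
      obtain ⟨b, rfl⟩ := mem_mod_zero.1 h4
      exact ⟨G.B .pr (G.o ⟨i, h.trans ξ.2⟩) b, fun _ => ⟨b, rfl, hy⟩⟩
    · exact ⟨G.c 0, fun h' => (h h').elim⟩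
  choose s hs using h3
  obtain ⟨d, hd⟩ := G.seq ξ s ξ.2
  refine mem_mod_zero.2 ⟨d, ?_⟩
  ext p
  rw [mem_val]
  constructor
  · intro hp
    obtain ⟨a, b, ha, -, rfl⟩ := h1 p hp
    obtain ⟨η, hη, rfl⟩ := mem_val_o.1 ha
    obtain ⟨b', h4, h5⟩ := hs η hη
    refine ⟨s η, (hd _).2 ⟨η, hη, rfl⟩, ?_⟩
    rw [h4, val_pr, (h2 _ ha).unique hp h5]
  · rintro ⟨b, hb, rfl⟩
    obtain ⟨i, hi, rfl⟩ := (hd _).1 hb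
    obtain ⟨b', h4, h5⟩ := hs i hi
    rwa [h4, val_pr]

theorem nice : Nice (G.crit 0) (G.mod 0) := by
  refine ⟨fun _ hz _ hy => mod_trans hz hy, ?_, seqClosedLt, val_mem_mod _⟩
  rw [mk_mod_zero, crit_zero, mk_toZFSet]

/-! ### The measure -/

theorem mem_meas_zero {Z : ZFSet.{u}} {d : Set.Iio κ} (hd : G.F d) (hZ : Z ⊆ G.crit 0)
    (h : ∀ ξ, G.E (G.o ξ) d ↔ G.val (G.o ξ) ∈ Z) : Z ∈ G.meas 0 := by
  have : Z = G.val d := by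
    ext z
    constructor
    · intro hz
      obtain ⟨ξ, rfl⟩ := mem_crit_zero.1 (hZ hz)
      exact val_mem_val.2 ((h ξ).2 hz)
    · intro hz
      obtain ⟨b, hb, rfl⟩ := mem_val.1 hz
      obtain ⟨ξ, rfl⟩ := (G.mem_zero b).1 (G.F_sub d hd b hb)
      exact (h ξ).1 hb
  rw [this, val_mem_meas]
  exact hd

theorem exists_F {X : ZFSet.{u}} (h : X ∈ G.meas 0) : ∃ a, G.F a ∧ X = G.val a := by
  obtain ⟨f, hf, h1, rfl⟩ := mem_meas.1 h
  obtain ⟨a, rfl⟩ := int_zero_iff.1 hf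
  exact ⟨a, by simpa using h1, rfl⟩

theorem val_subset_crit {a : Set.Iio κ} :
    G.val a ⊆ G.crit 0 ↔ ∀ z, G.E z a → G.E z (G.c 0) := by
  constructor
  · intro h z hz
    exact val_mem_val.1 (h (val_mem_val.2 hz))
  · intro h z hz
    obtain ⟨b, hb, rfl⟩ := mem_val.1 hz
    exact val_mem_val.2 (h b hb)

theorem normalMeasure : MNormalMeasure (G.crit 0) (G.mod 0) (G.meas 0) := by
  have hsep : ∀ P : ZFSet.{u} → Prop, ZFSet.sep P (G.crit 0) ⊆ G.crit 0 := fun P z hz =>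
    (ZFSet.mem_sep.1 hz).1
  have hcr : ∀ ξ, G.val (G.o ξ) ∈ G.crit 0 := fun ξ => mem_crit_zero.2 ⟨ξ, rfl⟩
  refine ⟨?_, val_mem_meas.2 G.F_zero, ?_, ?_, ?_, ?_, ?_, ?_, ?_, ?_⟩
  · intro X hX
    obtain ⟨a, ha, rfl⟩ := exists_F hX
    exact ⟨val_subset_crit.2 (G.F_sub a ha), val_mem_mod a⟩
  · intro h
    obtain ⟨a, ha, h1⟩ := exists_F h
    obtain ⟨ξ, hξ⟩ := G.F_ne a ha
    have := val_mem_val.2 hξ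
    rw [← h1] at this
    exact ZFSet.notMem_empty _ this
  · intro X Y hX hY
    obtain ⟨a, ha, rfl⟩ := exists_F hX
    obtain ⟨b, hb, rfl⟩ := exists_F hY
    obtain ⟨d, hd, h⟩ := G.and_F ha hb
    refine mem_meas_zero hd (fun z hz => ?_) fun ξ => ?_
    · exact val_subset_crit.2 (G.F_sub a ha) (ZFSet.mem_inter.1 hz).1
    · rw [ZFSet.mem_inter, val_mem_val, val_mem_val, h]
  · intro X Y hX hY hXY hYκ
    obtain ⟨a, ha, rfl⟩ := exists_F hX
    obtain ⟨b, rfl⟩ := mem_mod_zero.1 hY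
    exact val_mem_meas.2 (G.F_mono a b ha (fun z hz => val_mem_val.1 (hXY (val_mem_val.2 hz)))
      (val_subset_crit.1 hYκ))
  · intro X hX hXκ
    obtain ⟨a, rfl⟩ := mem_mod_zero.1 hX
    rcases G.F_compl a (val_subset_crit.1 hXκ) with h | ⟨d, hd, h⟩
    · exact .inl (val_mem_meas.2 h)
    · refine .inr (mem_meas_zero hd (fun z hz => (ZFSet.mem_sdiff.1 hz).1) fun ξ => ?_)
      rw [ZFSet.mem_sdiff, val_mem_val, h]
      exact (and_iff_right (hcr ξ)).symm
  · intro ξ hξ h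
    obtain ⟨ξ, rfl⟩ := mem_crit_zero.1 hξ
    obtain ⟨a, ha, h1⟩ := exists_F h
    obtain ⟨η, h2, h3⟩ := ((G.eventually_lt ξ).and (G.eventually_mem ha)).exists
    have := val_mem_val.2 h3
    rw [← h1, ZFSet.mem_singleton, val_inj] at this
    exact h2.ne' (o_inj this)
  · intro γ f hγ _ ⟨h1, h2⟩
    obtain ⟨ξ, rfl⟩ := mem_crit_zero.1 hγ
    have h3 : ∀ i : Ordinal.{u}, ∃ b, ∀ h : i < ξ, G.F b ∧
        ZFSet.pair (G.val (G.o ⟨i, h.trans ξ.2⟩)) (G.val b) ∈ f := by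
      intro i
      by_cases h : i < ξ
      · obtain ⟨y, hy, -⟩ := h2 (G.val (G.o ⟨i, h.trans ξ.2⟩)) (val_mem_val.2 (E_o h))
        obtain ⟨a, b, -, h4, h5⟩ := h1 _ hy
        obtain ⟨-, rfl⟩ := ZFSet.pair_inj.1 h5
        obtain ⟨b, hb, rfl⟩ := exists_F h4
        exact ⟨b, fun _ => ⟨hb, hy⟩⟩
      · exact ⟨G.c 0, fun h' => (h h').elim⟩
    choose s hs using h3
    obtain ⟨d, hd, h⟩ := G.F_seq ξ s ξ.2 fun i hi => (hs i hi).1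
    refine mem_meas_zero hd (hsep _) fun ζ => ?_
    rw [h, ZFSet.mem_sep, and_iff_right (hcr ζ)]
    constructor
    · intro h4 a X hp
      obtain ⟨a', b', ha, -, h5⟩ := h1 _ hp
      obtain ⟨rfl, rfl⟩ := ZFSet.pair_inj.1 h5
      obtain ⟨η, hη, rfl⟩ := mem_val_o.1 ha
      rw [(h2 _ ha).unique hp (hs η hη).2, val_mem_val]
      exact h4 η hη
    · intro h4 i hi
      exact val_mem_val.1 (h4 _ _ (hs i hi).2)
  · intro f hf ⟨h1, h2⟩
    obtain ⟨t, rfl⟩ := mem_mod_zero.1 hf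
    have h3 : ∀ ξ, G.F (G.B .ev t (G.o ξ)) ∧
        ZFSet.pair (G.val (G.o ξ)) (G.val (G.B .ev t (G.o ξ))) ∈ G.val t := by
      intro ξ
      obtain ⟨y, hy, hy'⟩ := h2 _ (hcr ξ)
      obtain ⟨a, b, -, h4, h5⟩ := h1 _ hy
      obtain ⟨-, rfl⟩ := ZFSet.pair_inj.1 h5
      obtain ⟨b, hb, rfl⟩ := exists_F h4
      have h6 : G.B .ev t (G.o ξ) = b := by
        refine G.ev_eq _ _ _ (val_mem_val.1 (by rwa [val_pr])) fun y' h7 => ?_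
        exact val_inj.1 (hy' _ (by
          dsimp only
          rw [← val_pr]
          exact val_mem_val.2 h7))
      rw [h6]
      exact ⟨hb, hy⟩
    obtain ⟨d, hd, h⟩ := G.F_diag t fun ξ => (h3 ξ).1
    refine mem_meas_zero hd (hsep _) fun ζ => ?_
    rw [h, ZFSet.mem_sep, and_iff_right (hcr ζ)]
    constructor
    · intro h4 a X hp haζ
      obtain ⟨η, hη, rfl⟩ := mem_val_o.1 haζ
      rw [(h2 _ (hcr η)).unique hp (h3 η).2, val_mem_val]
      exact h4 η hη
    · intro h4 η hη
      exact val_mem_val.1 (h4 _ _ (h3 η).2 (val_mem_val.2 (E_o hη)))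
  · intro D hD _
    obtain ⟨d, rfl⟩ := mem_mod_zero.1 hD
    rw [val, meas_inter]
    exact val_mem_mod _

end Cod

/-- The partial function guessing the collapses of the relations `L ξ`. -/
noncomputable def guessSet (κ : Ordinal.{u})
    (L : Ordinal.{u} → Ordinal.{u} → Ordinal.{u} → Prop) : ZFSet.{u} :=
  ZFSet.range fun ξ : {ξ : Set.Iio κ // 0 < ξ.1 ∧ NoDesc ξ.1 (L ξ.1)} =>
    ZFSet.pair ξ.1.1.toZFSet (coll ξ.1 (L ξ.1) 0)

theorem mem_guessSet {κ : Ordinal.{u}} {L : Ordinal.{u} → Ordinal.{u} → Ordinal.{u} → Prop}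
    {p : ZFSet.{u}} : p ∈ guessSet κ L ↔ ∃ ξ : Set.Iio κ, 0 < ξ.1 ∧ NoDesc ξ.1 (L ξ.1) ∧
      p = ZFSet.pair ξ.1.toZFSet (coll ξ (L ξ) 0) := by
  rw [guessSet, ZFSet.mem_range]
  constructor
  · rintro ⟨⟨ξ, h1, h2⟩, rfl⟩
    exact ⟨ξ, h1, h2, rfl⟩
  · rintro ⟨ξ, h1, h2, rfl⟩
    exact ⟨⟨ξ, h1, h2⟩, rfl⟩

namespace Cod

variable {κ : Ordinal.{u}} {G : Cod κ}

theorem val_eq_coll {γ : Ordinal.{u}} (hγ : γ ≤ κ) {R : Ordinal.{u} → Ordinal.{u} → Prop}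
    (h : NoDesc γ R) {f : Ordinal.{u} → ZFSet.{u}} (hf : IsColl γ R f) {p : Set.Iio κ → Set.Iio κ}
    (hp : ∀ η : Set.Iio κ, η < γ → ∀ z, G.E z (p η) ↔ ∃ ζ : Set.Iio κ, ζ < γ ∧ R ζ η ∧ z = p ζ)
    (η : Set.Iio γ) : G.val (p ⟨η, η.2.trans_le hγ⟩) = f η := by
  induction η using h.wf.induction with
  | _ η ih =>
  ext z
  rw [mem_val, hf η η.2]
  constructor
  · rintro ⟨b, hb, rfl⟩
    obtain ⟨ζ, h1, h2, rfl⟩ := (hp _ η.2 b).1 hb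
    exact ⟨ζ, h1, h2, ih ⟨ζ, h1⟩ h2⟩
  · rintro ⟨ζ, h1, h2, rfl⟩
    exact ⟨_, (hp _ η.2 _).2 ⟨⟨ζ, h1.trans_le hγ⟩, h1, h2, rfl⟩, (ih ⟨ζ, h1⟩ h2).symm⟩

theorem eventually_gen {P : Set.Iio κ → Prop} (h : ∀ᶠ ξ in G.fil, P ξ) (i : Ordinal.{u}) :
    ∀ᶠ x in G.gen, P (x i) :=
  (G.gen_at i (R := fun _ ξ => P ξ) fun _ _ _ => rfl).mono fun _ hx => hx h

namespace Data

variable {L : Ordinal.{u} → Ordinal.{u} → Ordinal.{u} → Prop}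
  {c : Ordinal.{u} → Ordinal.{u} → Prop} {b : Ordinal.{u} → Prop}

theorem val_three (hD : G.Data L c b) {X : ZFSet.{u}} (hX : X ⊆ κ.toZFSet)
    (hb : ∀ ξ, ξ < κ → (b ξ ↔ ξ.toZFSet ∈ X)) : G.val (G.c 3) = X := by
  ext z
  rw [mem_val]
  constructor
  · rintro ⟨a, ha, rfl⟩
    obtain ⟨ξ, h, rfl⟩ := (hD.mem_three a).1 ha
    rw [val_o]
    exact (hb ξ ξ.2).1 h
  · intro hz
    obtain ⟨ξ, h, rfl⟩ := Ordinal.mem_toZFSet_iff.1 (hX hz)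
    exact ⟨_, (hD.mem_three _).2 ⟨⟨ξ, h⟩, (hb ξ h).2 hz, rfl⟩, (val_o ⟨ξ, h⟩).symm⟩

theorem val_four (hD : G.Data L c b) (hc : NoDesc κ c) {f : Ordinal.{u} → ZFSet.{u}}
    (hf : IsColl κ c f) (η : Set.Iio κ) : G.val (G.ap (G.c 4) η) = f η :=
  val_eq_coll (G := G) le_rfl hc hf (p := G.ap (G.c 4)) (fun η _ z => (hD.mem_four hc η z).trans
    (exists_congr fun ζ => (and_iff_right ζ.2).symm)) η

theorem val_five (hD : G.Data L c b) {ξ : Set.Iio κ} (h : NoDesc ξ (L ξ)) {η : Set.Iio κ}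
    (hη : η < ξ) : G.val (G.ap (G.ap (G.c 5) ξ) η) = coll ξ (L ξ) η :=
  val_eq_coll (G := G) ξ.2.le h h.coll (p := G.ap (G.ap (G.c 5) ξ))
    (fun η hη z => hD.mem_five ξ h η hη z) ⟨η, hη⟩

theorem val_six (hD : G.Data L c b) : G.val (G.c 6) = guessSet κ L := by
  ext p
  rw [mem_val, mem_guessSet]
  have h0 : ∀ ξ : Set.Iio κ, NoDesc ξ (L ξ) → (⟨0, G.pos⟩ : Set.Iio κ) < ξ →
      G.val (G.B .pr (G.o ξ) (G.ap (G.ap (G.c 5) ξ) ⟨0, G.pos⟩)) =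
        ZFSet.pair ξ.1.toZFSet (coll ξ (L ξ) 0) := by
    intro ξ h1 h2
    rw [val_pr, val_o, hD.val_five h1 h2]
  constructor
  · rintro ⟨a, ha, rfl⟩
    obtain ⟨ξ, h1, h2, rfl⟩ := (hD.mem_six ⟨0, G.pos⟩ rfl a).1 ha
    exact ⟨ξ, h1, h2, h0 ξ h2 h1⟩
  · rintro ⟨ξ, h1, h2, rfl⟩
    exact ⟨_, (hD.mem_six ⟨0, G.pos⟩ rfl _).2 ⟨ξ, h1, h2, rfl⟩, (h0 ξ h2 h1).symm⟩

theorem eventually_guess (hD : G.Data L c b) : ∀ᶠ ξ in G.fil, ∀ ζ η : Set.Iio κ, ζ < ξ → η < ξ →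
    (L ξ ζ η ↔ c ζ η) := hD.guess

theorem eventually_noDesc (hD : G.Data L c b) (hc : NoDesc κ c) :
    ∀ᶠ ξ : Set.Iio κ in G.fil, NoDesc ξ (L ξ) := by
  filter_upwards [hD.eventually_guess] with ξ h s hs h1
  have h2 : ∀ n, s n < κ := fun n => (hs n).trans ξ.2
  exact hc s h2 fun n => (h ⟨_, h2 (n + 1)⟩ ⟨_, h2 n⟩ (hs _) (hs _)).1 (h1 n)

theorem exists_press (hD : G.Data L c b) (hc : NoDesc κ c) {t η : Set.Iio κ}
    (h : ∀ᶠ ξ in G.fil, G.E (G.ap t ξ) (G.ap (G.ap (G.c 5) ξ) η)) :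
    ∃ ζ, G.E (G.ap (G.c 4) ζ) (G.ap (G.c 4) η) ∧
      ∀ᶠ ξ in G.fil, G.ap t ξ = G.ap (G.ap (G.c 5) ξ) ζ := by
  let cn (a : Set.Iio κ) : Set.Iio κ := G.B .cnst a a
  let q : Set.Iio κ := G.B (.sharp .pr) (G.c 4) (cn (G.B .pr (G.ap (G.c 4) η) (G.c 2)))
  let r : Set.Iio κ := G.B (.sharp (.chi (.mem 0 1) 2)) q q
  have hr : ∀ ζ, G.ap r ζ = G.c 2 ↔ G.E (G.ap (G.c 4) ζ) (G.ap (G.c 4) η) := by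
    intro ζ
    have h1 := G.chi_iff (.mem 0 1) [G.ap (G.c 4) ζ, G.ap (G.c 4) η] (G.ap q ζ)
    simp only [sat_mem, List.getElem?_cons_zero, List.getElem?_cons_succ, optRel_some] at h1
    rw [← h1]
    simp only [r, ap, G.ev_sharp, q, cn, G.ev_cnst]
    rfl
  obtain ⟨ζ, -, h1⟩ := G.F_press (G.B (.sharp .pr) t (cn (G.c 2)))
    (G.B (.sharp (.sharp .pr)) (G.c 5) (cn r)) (by
      change ∀ᶠ ξ in G.fil, _
      filter_upwards [h, hD.eventually_guess, hD.eventually_noDesc hc, G.eventually_lt η]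
        with ξ h1 h2 h3 h4
      obtain ⟨ζ, h5, h6, h7⟩ := (hD.mem_five ξ h3 η h4 _).1 h1
      refine ⟨ζ, h5, ?_⟩
      have h8 : G.B .ev r (G.o ζ) = G.c 2 :=
        (hr ζ).2 ((hD.mem_four hc η _).2 ⟨ζ, (h2 ζ η h5 h4).1 h6, rfl⟩)
      rw [G.ev_sharp, G.ev_sharp, G.ev_sharp, G.ev_cnst, G.ev_cnst, h8]
      exact congrArg (G.B .pr · _) h7)
  have h2 : ∀ᶠ ξ in G.fil, G.ap t ξ = G.ap (G.ap (G.c 5) ξ) ζ ∧ G.c 2 = G.ap r ζ := by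
    refine Filter.Eventually.mono (f := G.fil) h1 fun ξ hξ => ?_
    rw [G.ev_sharp, G.ev_sharp, G.ev_sharp, G.ev_cnst, G.ev_cnst] at hξ
    exact G.pr_inj hξ
  exact ⟨ζ, (hr ζ).1 h2.exists.choose_spec.2.symm, h2.mono fun ξ hξ => hξ.1⟩

theorem int_five (G : Cod κ) (η : Set.Iio κ) :
    G.Int 1 fun x => G.ap (G.ap (G.c 5) (x 0)) η := by
  have h := Int.step (G := G) 1 0 (fun _ => G.c 5) zero_lt_one (.const 0 _)
  exact Int.op .ev h (.const 1 (G.o η))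

theorem proj_five (hD : G.Data L c b) (hc : NoDesc κ c) (η : Set.Iio κ) :
    G.proj 1 (fun x => G.ap (G.ap (G.c 5) (x 0)) η) = G.val (G.ap (G.c 4) η) := by
  generalize ha : G.ap (G.c 4) η = a
  induction a using G.wf.induction generalizing η with
  | _ a ih =>
  subst ha
  ext z
  rw [mem_proj, mem_val]
  constructor
  · rintro ⟨f, hf, h1, rfl⟩
    obtain ⟨f', hf', rfl⟩ := hf.rep (k := 0) (by simp)
    obtain ⟨t, rfl⟩ := int_zero_iff.1 hf'
    have h2 : ∀ᶠ ξ in G.fil, G.E (G.ap t ξ) (G.ap (G.ap (G.c 5) ξ) η) := by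
      have h3 := gen_sat (G := G) (i := 0) (.mem 0 1)
        (l := [fun _ => t, fun _ => G.B (.sharp .ev) (G.c 5) (G.B .cnst (G.o η) (G.o η))])
        (by simp [Int.const])
      simp only [S, List.map_cons, List.map_nil, sat_mem, List.getElem?_cons_zero,
        List.getElem?_cons_succ, optRel_some, ap, G.ev_sharp, G.ev_cnst] at h3
      obtain ⟨x, h4, h5⟩ := (h1.and h3).exists
      exact h5.2 h4
    obtain ⟨ζ, h3, h4⟩ := hD.exists_press hc h2
    refine ⟨_, h3, ?_⟩
    rw [← ih _ h3 ζ rfl]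
    exact proj_congr (eventually_gen h4 0)
  · rintro ⟨a, ha, rfl⟩
    obtain ⟨ζ, h1, rfl⟩ := (hD.mem_four hc η a).1 ha
    refine ⟨_, int_five G ζ, ?_, (ih _ ha ζ rfl).symm⟩
    refine eventually_gen (P := fun ξ => G.E (G.ap (G.ap (G.c 5) ξ) ζ) (G.ap (G.ap (G.c 5) ξ) η)) ?_ 0
    filter_upwards [hD.eventually_guess, hD.eventually_noDesc hc, G.eventually_lt η,
      G.eventually_lt ζ] with ξ h2 h3 h4 h5
    exact (hD.mem_five ξ h3 η h4 _).2 ⟨ζ, h5, (h2 ζ η h5 h4).2 h1, rfl⟩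

theorem pair_mem_emb (hD : G.Data L c b) (hc : NoDesc κ c) :
    ZFSet.pair (G.crit 0) (G.val (G.ap (G.c 4) ⟨0, G.pos⟩)) ∈ G.emb 0 (0 + 1) (G.val (G.c 6)) := by
  have h1 : G.Int 1 fun x => G.o (x 0) := Int.coord zero_lt_one
  have h2 := Int.op .pr h1 (int_five G ⟨0, G.pos⟩)
  rw [val, emb_proj (.const 0 _), ← proj_coord, ← hD.proj_five hc, zero_add,
    ← proj_pr h1 (int_five G ⟨0, G.pos⟩), proj_mem_iff h2]
  refine eventually_gen (P := fun ξ => G.E (G.B .pr (G.o ξ) (G.ap (G.ap (G.c 5) ξ) ⟨0, G.pos⟩))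
    (G.c 6)) ?_ 0
  filter_upwards [hD.eventually_noDesc hc, G.eventually_lt ⟨0, G.pos⟩] with ξ h3 h4
  exact (hD.mem_six ⟨0, G.pos⟩ rfl _).2 ⟨ξ, h4, h3, rfl⟩

end Data

end Cod

/-! ### The Laver function as a set -/

theorem rank_coll_lt {κ : Ordinal.{u}} {U : Ultrafilter Ordinal.{u}} (hU : NormalUltra κ U)
    {ξ : Ordinal.{u}} (hξ : ξ < κ) {R : Ordinal.{u} → Ordinal.{u} → Prop} (h : NoDesc ξ R)
    (η : Set.Iio ξ) : (coll ξ R η).rank < κ := by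
  classical
  induction η using h.wf.induction with
  | _ η ih =>
  obtain ⟨β, hβ, h1⟩ := hU.sup_lt hξ (f := fun ζ => if R ζ η then (coll ξ R ζ).rank else 0) (by
    intro ζ hζ
    split_ifs with h2
    · exact ih ⟨ζ, hζ⟩ h2
    · exact hU.pos)
  refine lt_of_le_of_lt (ZFSet.rank_le_iff.2 fun y hy => ?_) hβ
  obtain ⟨ζ, hζ, h2, rfl⟩ := (h.coll η η.2 y).1 hy
  simpa [h2] using h1 ζ hζ

theorem isPFun_guessSet {κ : Ordinal.{u}} {U : Ultrafilter Ordinal.{u}} (hU : NormalUltra κ U)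
    (L : Ordinal.{u} → Ordinal.{u} → Ordinal.{u} → Prop) : IsPFun κ.toZFSet (guessSet κ L) := by
  constructor
  · intro p hp
    obtain ⟨ξ, h1, h2, rfl⟩ := mem_guessSet.1 hp
    refine ⟨_, _, Ordinal.mem_toZFSet_iff.2 ⟨ξ, ξ.2, rfl⟩, ?_, rfl⟩
    rw [MemV, Ordinal.rank_toZFSet]
    exact rank_coll_lt hU ξ.2 h2 ⟨0, h1⟩
  · intro γ A B hA hB
    obtain ⟨ξ, -, -, h1⟩ := mem_guessSet.1 hA
    obtain ⟨ξ', -, -, h2⟩ := mem_guessSet.1 hB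
    obtain ⟨rfl, rfl⟩ := ZFSet.pair_inj.1 h1
    obtain ⟨h3, rfl⟩ := ZFSet.pair_inj.1 h2
    rw [Ordinal.toZFSet_injective h3]

theorem exists_isColl {κ : Ordinal.{u}} (hs : ∀ η < κ, η + 1 < κ) {A : ZFSet.{u}}
    (hA : MemH κ.toZFSet A) : ∃ c f, NoDesc κ c ∧ IsColl κ c f ∧ f 0 = A := by
  classical
  obtain ⟨t, ht, hAt, hc⟩ := hA
  rw [Cod.mk_toZFSet] at hc
  obtain ⟨e⟩ := Cardinal.le_def _ _ |>.1 hc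
  let g : Ordinal.{u} → ZFSet.{u} := fun η =>
    if h : ∃ x : t.toSet, (e x).1 + 1 = η then h.choose else A
  have hg : ∀ η, g η ∈ t := by
    intro η
    dsimp only [g]
    split_ifs with h
    · exact h.choose.2
    · exact hAt
  have hs' : ∀ x ∈ t, ∃ η < κ, g η = x := by
    intro x hx
    have h : ∃ y : t.toSet, (e y).1 + 1 = (e ⟨x, hx⟩).1 + 1 := ⟨_, rfl⟩
    refine ⟨(e ⟨x, hx⟩).1 + 1, hs _ (e ⟨x, hx⟩).2, ?_⟩
    dsimp only [g]
    rw [dif_pos h]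
    exact congrArg Subtype.val (e.injective (Subtype.ext (Order.succ_injective h.choose_spec)))
  refine ⟨fun ζ η => g ζ ∈ g η, g, fun s _ h => ?_, fun η _ z => ⟨fun hz => ?_, ?_⟩, ?_⟩
  · exact (wellFounded_iff_isEmpty_descending_chain.1 ZFSet.mem_wf).false ⟨fun n => g (s n), h⟩
  · obtain ⟨ζ, h1, rfl⟩ := hs' z (ht.mem_trans hz (hg η))
    exact ⟨ζ, h1, hz, rfl⟩
  · rintro ⟨ζ, -, h1, rfl⟩
    exact h1
  · refine dif_neg ?_
    rintro ⟨x, hx⟩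
    simp at hx

theorem NormalUltra.exists_structure {κ : Ordinal.{u}} {U : Ultrafilter Ordinal.{u}}
    (hU : NormalUltra κ U) {A B : ZFSet.{u}} (hA : MemH κ.toZFSet A) (hB : B ⊆ κ.toZFSet) :
    ∃ M F N : ZFSet, Nice κ.toZFSet M ∧ MNormalMeasure κ.toZFSet M F ∧ Iterable κ.toZFSet M F ∧
      guessSet κ (trunc κ laver) ∈ M ∧ A ∈ M ∧ B ∈ M ∧
      ∃ j : ZFSet → ZFSet, IsUltrapowerMap κ.toZFSet M F N j ∧
        ZFSet.pair κ.toZFSet A ∈ j (guessSet κ (trunc κ laver)) := by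
  obtain ⟨c, f, hc, hf, rfl⟩ := exists_isColl (fun _ => hU.succ_lt) hA
  obtain ⟨G, hD⟩ := Good.cod hU.omega_lt
    (hU.good c fun ξ => ξ.toZFSet ∈ B)
  have h1 := hD.val_four hc hf ⟨0, G.pos⟩
  have h2 := hD.pair_mem_emb hc
  rw [h1, hD.val_six] at h2
  rw [← G.crit_zero]
  refine ⟨G.mod 0, G.meas 0, G.mod (0 + 1), G.nice, G.normalMeasure, G.iterable, ?_, ?_, ?_,
    G.emb 0 (0 + 1), G.isUltrapowerMap 0, h2⟩
  · rw [← hD.val_six]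
    exact G.val_mem_mod _
  · rw [← h1]
    exact G.val_mem_mod _
  · rw [← hD.val_three hB fun _ _ => Iff.rfl]
    exact G.val_mem_mod _

end LaverDiamond

open LaverDiamond

/-- If `κ` is a measurable cardinal, then `LD^Ramsey_κ` holds: there is a partial
function `ℓ : κ ⇀ V_κ` such that for every `A ∈ H(κ⁺)` and every `B ⊆ κ` there is a
nice, iterable, weakly amenable structure `⟨M, F⟩` with `ℓ, A, B ∈ M` whose ultrapower
map `j` satisfies `j(ℓ)(κ) = A`. -/
theorem LDRamsey_of_measurable (κ : ZFSet.{u}) (h : MeasurableCard κ) :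
    ∃ ℓ : ZFSet, IsPFun κ ℓ ∧
      ∀ A B : ZFSet, MemH κ A → B ⊆ κ →
        ∃ M F N : ZFSet, Nice κ M ∧ MNormalMeasure κ M F ∧ Iterable κ M F ∧
          ℓ ∈ M ∧ A ∈ M ∧ B ∈ M ∧
          ∃ j : ZFSet → ZFSet, IsUltrapowerMap κ M F N j ∧ ZFSet.pair κ A ∈ j ℓ := by
  obtain ⟨E⟩ := h
  have hU := E.normal
  rw [← E.crit.1.toZFSet_rank_eq]
  exact ⟨guessSet κ.rank (trunc κ.rank laver), isPFun_guessSet hU _,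
    fun A B hA hB => hU.exists_structure hA hB⟩
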